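/- arXiv:1404.6647 — 2 statements merged into one kernel-verified Lean document; each statement's English description precedes it below -/
import Mathlib

section
/- Let 𝔣 be an additive, κ-Lipschitz, concave graph parameter and let μ be a probability measure on ℕ with finite mean μ̄. Then for any finite disjoint sets A and B, E[𝔣(𝔾^iid_{μ,|A|})] + E[𝔣(𝔾^iid_{μ,|B|})] ≤ E[𝔣(𝔾^iid_{μ,|A|+|B|})] + φ((μ̄/2)·(|A| + |B|)), where φ(x) = 7κ·√(x·ln(1+x)). -/
open Finset Filter Topology MeasureTheory
open scoped Classical BigOperators ENNReal

structure Multigraph where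
  (V : Type)
  [fintypeV : Fintype V]
  (edges : Multiset (Sym2 V))

attribute [instance] Multigraph.fintypeV

def Multigraph.addEdge (G : Multigraph) (i j : G.V) : Multigraph :=
  { V := G.V, edges := s(i, j) ::ₘ G.edges }

def Multigraph.disjUnion (G₁ G₂ : Multigraph) : Multigraph :=
  { V := G₁.V ⊕ G₂.V,
    edges := G₁.edges.map (Sym2.map Sum.inl) + G₂.edges.map (Sym2.map Sum.inr) }

/-- A graph parameter is invariant under graph isomorphism. -/
def GraphParam.Invariant (f : Multigraph → ℝ) : Prop :=
  ∀ (G₁ G₂ : Multigraph) (e : G₁.V ≃ G₂.V),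
    G₂.edges = G₁.edges.map (Sym2.map e) → f G₁ = f G₂

def GraphParam.Additive (f : Multigraph → ℝ) : Prop :=
  ∀ G₁ G₂ : Multigraph, f (G₁.disjUnion G₂) = f G₁ + f G₂

def GraphParam.Lipschitz (f : Multigraph → ℝ) (κ : ℝ) : Prop :=
  ∀ (G : Multigraph) (i j : G.V), |f (G.addEdge i j) - f G| ≤ κ

def GraphParam.Concave (f : Multigraph → ℝ) : Prop :=
  ∀ (G : Multigraph) (x : G.V → ℝ), (∑ i, x i) = 0 →
    ∑ i, ∑ j, (f (G.addEdge i j) - f G) * x i * x j ≤ 0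

abbrev HalfEdge (V : Type) (d : V → ℕ) : Type := Σ i : V, Fin (d i)

def IsPairMatching {α : Type} (m : Finset (Sym2 α)) : Prop :=
  (∀ p ∈ m, ¬ p.IsDiag) ∧
    ∀ p ∈ m, ∀ q ∈ m, p ≠ q → ∀ h : α, h ∈ p → h ∉ q

def IsMaximalMatching {α : Type} (m : Finset (Sym2 α)) : Prop :=
  IsPairMatching m ∧ ∀ m' : Finset (Sym2 α), IsPairMatching m' → m ⊆ m' → m' = m

/-- The multigraph `G[m]` induced on `V` by a matching `m` of the half-edges. -/
def matchingGraph (V : Type) [Fintype V] (d : V → ℕ)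
    (m : Finset (Sym2 (HalfEdge V d))) : Multigraph :=
  { V := V, edges := m.val.map (Sym2.map Sigma.fst) }

noncomputable def maximalMatchings (V : Type) [Fintype V] [DecidableEq V] (d : V → ℕ) :
    Finset (Finset (Sym2 (HalfEdge V d))) :=
  Finset.univ.filter fun m => IsMaximalMatching m

/-- `E[f(𝔾_d)]`: expectation of `f` under the configuration model with degrees `d`. -/
noncomputable def configExpect (V : Type) [Fintype V] [DecidableEq V] (d : V → ℕ)
    (f : Multigraph → ℝ) : ℝ :=
  (∑ m ∈ maximalMatchings V d, f (matchingGraph V d m)) / ((maximalMatchings V d).card : ℝ)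

/-- `E[f(𝔾^iid_{μ,n})]`. -/
noncomputable def iidExpect (μ : ℕ → ℝ) (n : ℕ) (f : Multigraph → ℝ) : ℝ :=
  ∑' D : Fin n → ℕ, (∏ i, μ (D i)) * configExpect (Fin n) D f

noncomputable def tailSum (μ : ℕ → ℝ) (i : ℕ) : ℝ := ∑' k : ℕ, if i ≤ k then μ k else 0

/-- The Wasserstein distance `W(μ, μ') = Σ_{i≥1} |Σ_{k≥i} (μ k - μ' k)|`. -/
noncomputable def wasserstein (μ μ' : ℕ → ℝ) : ℝ :=
  ∑' i : ℕ, |tailSum μ (i + 1) - tailSum μ' (i + 1)|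

/-- Empirical degree distribution of `d : Fin n → ℕ`. -/
noncomputable def empirical (n : ℕ) (d : Fin n → ℕ) : ℕ → ℝ :=
  fun k => ((Finset.univ.filter fun i => d i = k).card : ℝ) / (n : ℝ)

/-- The degree sequences `d n` approach the degree distribution `μ` (with mean `Σ k·μ(k)`). -/
def Approaches (d : (n : ℕ) → Fin n → ℕ) (μ : ℕ → ℝ) : Prop :=
  (∀ k : ℕ, Tendsto (fun n => empirical n (d n) k) atTop (nhds (μ k))) ∧
    Tendsto (fun n => (∑ i, (d n i : ℝ)) / (n : ℝ)) atTop
      (nhds (∑' k : ℕ, (k : ℝ) * μ k))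

namespace S9

/-- The multigraph on `V` obtained from pairs of half-edges labelled by `l`. -/
def gr {H V : Type} [Fintype V] (l : H → V) (E : Multiset (Sym2 H)) : Multigraph :=
  { V := V, edges := E.map (Sym2.map l) }

lemma gr_cons {H V : Type} [Fintype V] (l : H → V) (E : Multiset (Sym2 H)) (h h' : H) :
    gr l (s(h, h') ::ₘ E) = (gr l E).addEdge (l h) (l h') := by
  simp only [gr, Multigraph.addEdge, Multiset.map_cons, Sym2.map_mk]
  rfl

lemma gr_map {H H' V : Type} [Fintype V] (l : H' → V) (p : H → H') (E : Multiset (Sym2 H)) :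
    gr l (E.map (Sym2.map p)) = gr (l ∘ p) E := by
  simp [gr, Multiset.map_map, Sym2.map_map]

lemma kappa_nonneg {f : Multigraph → ℝ} {κ : ℝ} (hlip : GraphParam.Lipschitz f κ) : 0 ≤ κ := by
  have := hlip { V := Unit, edges := 0 } () ()
  exact le_trans (abs_nonneg _) this

lemma conc_pull {f : Multigraph → ℝ} (hconc : GraphParam.Concave f) {H V : Type} [Fintype V]
    [Fintype H] (l : H → V) (E : Multiset (Sym2 H)) (y : H → ℝ) (hy : ∑ h, y h = 0) :
    ∑ h, ∑ h', (f (gr l (s(h, h') ::ₘ E)) - f (gr l E)) * y h * y h' ≤ 0 := by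
  have h1 := hconc (gr l E) (fun v => ∑ h with l h = v, y h) (by
    have := Finset.sum_fiberwise (s := (Finset.univ : Finset H)) (g := l) (f := y)
    rw [← hy, ← this]
    rfl)
  refine le_trans (le_of_eq ?_) h1
  simp only [gr_cons]
  have key : ∀ D : V → V → ℝ, ∑ h, ∑ h', D (l h) (l h') * y h * y h' =
      ∑ v : V, ∑ v' : V, D v v' * (∑ h with l h = v, y h) * (∑ h with l h = v', y h) := by
    intro D
    rw [← Finset.sum_fiberwise (s := (Finset.univ : Finset H)) (g := l)]
    refine Finset.sum_congr rfl fun v _ => ?_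
    simp_rw [Finset.mul_sum, Finset.sum_mul]
    rw [Finset.sum_comm]
    rw [← Finset.sum_fiberwise (s := (Finset.univ : Finset H)) (g := l)]
    refine Finset.sum_congr rfl fun v' _ => ?_
    refine Finset.sum_congr rfl fun h' hh' => ?_
    refine Finset.sum_congr rfl fun h hh => ?_
    simp only [Finset.mem_filter] at hh hh'
    rw [hh.2, hh'.2]
  exact key (fun v v' => f ((gr l E).addEdge v v') - f (gr l E))

lemma dbl_swap {α : Type} {a b c d : α} (hab : a ≠ b) (hcd : c ≠ d) :
    ∃ π : Equiv.Perm α, π a = c ∧ π b = d ∧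
      ∀ x, x ≠ a → x ≠ b → x ≠ c → x ≠ d → π x = x := by
  refine ⟨Equiv.swap (Equiv.swap a c b) d * Equiv.swap a c, ?_, ?_, ?_⟩
  · have : c ≠ Equiv.swap a c b := by
      intro h
      have := congrArg (Equiv.swap a c) h
      simp at this
      exact hab this
    simp [Equiv.swap_apply_of_ne_of_ne this hcd]
  · simp
  · intro x h1 h2 h3 h4
    have hx : Equiv.swap a c x = x := Equiv.swap_apply_of_ne_of_ne h1 h3
    have : x ≠ Equiv.swap a c b := by
      intro h
      have := congrArg (Equiv.swap a c) h
      rw [hx] at this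
      simp at this
      exact h2 this
    simp [hx, Equiv.swap_apply_of_ne_of_ne this h4]

lemma map_fix {α : Type} (π : α → α) (e : Sym2 α) (h : ∀ x ∈ e, π x = x) :
    Sym2.map π e = e := by
  induction e with
  | _ x y =>
    simp at h
    simp [h.1, h.2]

lemma mmap_fix {α : Type} (π : α → α) (E : Multiset (Sym2 α)) (h : ∀ e ∈ E, ∀ x ∈ e, π x = x) :
    E.map (Sym2.map π) = E := by
  conv_rhs => rw [← Multiset.map_id E]
  exact Multiset.map_congr rfl fun e he => map_fix π e (h e he)

/-! ### Matchings -/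

lemma pm_mono {α : Type} {m m' : Finset (Sym2 α)} (h : IsPairMatching m)
    (hs : m' ⊆ m) : IsPairMatching m' :=
  ⟨fun p hp => h.1 p (hs hp), fun p hp q hq => h.2 p (hs hp) q (hs hq)⟩

/-- free elements of a matching -/
def IsFree {α : Type} (m : Finset (Sym2 α)) (x : α) : Prop := ∀ e ∈ m, x ∉ e

lemma matching_insert {α : Type} [DecidableEq α] {m : Finset (Sym2 α)} (hm : IsPairMatching m) {x y : α}
    (hxy : x ≠ y) (hx : IsFree m x) (hy : IsFree m y) : IsPairMatching (insert s(x, y) m) := by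
  refine ⟨?_, ?_⟩
  · intro p hp
    rcases Finset.mem_insert.1 hp with rfl | hp
    · simpa using hxy
    · exact hm.1 p hp
  · intro p hp q hq hpq z hzp hzq
    rcases Finset.mem_insert.1 hp with rfl | hp1 <;> rcases Finset.mem_insert.1 hq with rfl | hq1
    · exact hpq rfl
    · rcases Sym2.mem_iff.1 hzp with rfl | rfl
      · exact hx q hq1 hzq
      · exact hy q hq1 hzq
    · rcases Sym2.mem_iff.1 hzq with rfl | rfl
      · exact hx p hp1 hzp
      · exact hy p hp1 hzp
    · exact hm.2 p hp1 q hq1 hpq z hzp hzq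

lemma not_mem_of_free {α : Type} {m : Finset (Sym2 α)} {x y : α} (hx : IsFree m x) :
    s(x, y) ∉ m := fun h => hx _ h (by simp)

lemma free_of_insert {α : Type} [DecidableEq α] {m : Finset (Sym2 α)} {x y : α}
    (hm : IsPairMatching (insert s(x, y) m)) (hn : s(x, y) ∉ m) :
    x ≠ y ∧ IsFree m x ∧ IsFree m y := by
  refine ⟨by simpa using hm.1 s(x, y) (by simp), ?_, ?_⟩ <;>
  · intro e he hz
    exact hm.2 s(x, y) (by simp) e (by simp [he]) (by rintro rfl; exact hn he) _ (by simp) hz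

noncomputable def freeSet {α : Type} [Fintype α] (m : Finset (Sym2 α)) : Finset α :=
  Finset.univ.filter fun x => IsFree m x

lemma mem_freeSet {α : Type} [Fintype α] {m : Finset (Sym2 α)} {x : α} :
    x ∈ freeSet m ↔ IsFree m x := by simp [freeSet]

lemma isFree_insert {α : Type} [DecidableEq α] {m : Finset (Sym2 α)} {x y z : α} :
    IsFree (insert s(x, y) m) z ↔ z ≠ x ∧ z ≠ y ∧ IsFree m z := by
  simp [IsFree, and_assoc]

lemma freeSet_card {α : Type} [Fintype α] (m : Finset (Sym2 α)) (hm : IsPairMatching m) :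
    (freeSet m).card + 2 * m.card = Fintype.card α := by
  induction m using Finset.induction_on with
  | empty => simp [freeSet, IsFree]
  | insert e m he ih =>
    induction e with
    | _ x y =>
      obtain ⟨hxy, hx, hy⟩ := free_of_insert hm he
      have := ih (pm_mono hm (Finset.subset_insert _ _))
      have h2 : freeSet (insert s(x, y) m) = ((freeSet m).erase x).erase y := by
        ext z
        simp only [mem_freeSet, isFree_insert, Finset.mem_erase]
        tauto
      rw [h2, Finset.card_erase_of_mem, Finset.card_erase_of_mem, Finset.card_insert_of_notMem he]
      · have h3 : 2 ≤ (freeSet m).card := by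
          have : ({x, y} : Finset α) ⊆ freeSet m := by
            intro z; simp only [Finset.mem_insert, Finset.mem_singleton, mem_freeSet]
            rintro (rfl | rfl) <;> assumption
          simpa [Finset.card_pair hxy] using Finset.card_le_card this
        omega
      · exact mem_freeSet.2 hx
      · exact Finset.mem_erase.2 ⟨hxy.symm, mem_freeSet.2 hy⟩

lemma maximal_free {α : Type} [Fintype α] {m : Finset (Sym2 α)} (hm : IsMaximalMatching m) :
    (freeSet m).card ≤ 1 := by
  rw [Finset.card_le_one]
  intro x hx y hy
  by_contra hxy
  rw [mem_freeSet] at hx hy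
  have := hm.2 _ (matching_insert hm.1 hxy hx hy) (Finset.subset_insert _ _)
  exact not_mem_of_free (y := y) hx (this ▸ Finset.mem_insert_self _ _)

lemma maximal_of_free {α : Type} [Fintype α] {m : Finset (Sym2 α)} (hm : IsPairMatching m)
    (h : (freeSet m).card ≤ 1) : IsMaximalMatching m := by
  refine ⟨hm, fun m' hm' hs => ?_⟩
  have h1 := freeSet_card m hm
  have h2 := freeSet_card m' hm'
  exact (Finset.eq_of_subset_of_card_le hs (by omega)).symm

lemma trans_matching {α : Type} (m : Finset (Sym2 α)) : ∀ (m' : Finset (Sym2 α)),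
    IsPairMatching m → IsPairMatching m' → m.card = m'.card →
    ∃ σ : Equiv.Perm α, m'.val = m.val.map (Sym2.map σ) := by
  induction m using Finset.induction_on with
  | empty =>
    intro m' _ _ h
    refine ⟨1, ?_⟩
    have : m' = ∅ := Finset.card_eq_zero.1 (by simpa using h.symm)
    simp [this]
  | insert e m he ih =>
    intro m' hm hm' hc
    rw [Finset.card_insert_of_notMem he] at hc
    obtain ⟨e', he'⟩ : m'.Nonempty := Finset.card_pos.1 (by omega)
    obtain ⟨σ, hσ⟩ := ih (m'.erase e') (pm_mono hm (Finset.subset_insert _ _))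
      (pm_mono hm' (Finset.erase_subset _ _)) (by rw [Finset.card_erase_of_mem he']; omega)
    rw [← Finset.insert_erase he'] at hm'
    induction e with
    | _ x y =>
    induction e' with
    | _ x' y' =>
      obtain ⟨hxy, hx, hy⟩ := free_of_insert hm he
      obtain ⟨hxy', hx', hy'⟩ := free_of_insert hm' (Finset.notMem_erase _ _)
      obtain ⟨π, h1, h2, h3⟩ := dbl_swap (a := σ x) (b := σ y) (c := x') (d := y')
        (by simpa using hxy) hxy'
      refine ⟨π * σ, ?_⟩
      have hmem : ∀ z, IsFree m z → ∀ e ∈ (m'.erase s(x', y')).val, σ z ∉ e := by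
        intro z hz e hhe
        rw [hσ, Multiset.mem_map] at hhe
        obtain ⟨e0, he0, rfl⟩ := hhe
        intro hmem
        rw [Sym2.mem_map] at hmem
        obtain ⟨z', hz', hh⟩ := hmem
        rw [σ.injective hh] at hz'
        exact hz _ he0 hz'
      have hfix : (m'.erase s(x', y')).val.map (Sym2.map π) = (m'.erase s(x', y')).val := by
        apply mmap_fix
        intro e hhe z hz
        apply h3
        · rintro rfl; exact hmem x hx e hhe hz
        · rintro rfl; exact hmem y hy e hhe hz
        · rintro rfl; exact hx' e hhe hz
        · rintro rfl; exact hy' e hhe hz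
      have hv : m'.val = s(x', y') ::ₘ (m'.erase s(x', y')).val := by
        conv_lhs => rw [← Finset.insert_erase he']
        exact Finset.insert_val_of_notMem (Finset.notMem_erase _ _)
      rw [hv, Finset.insert_val_of_notMem he, Multiset.map_cons, ← hfix, hσ, Multiset.map_map]
      congr 1
      · simp [h1, h2]
      · refine Multiset.map_congr rfl fun e _ => ?_
        simp [Sym2.map_map, Function.comp_def]

noncomputable def MM (H : Type) [Fintype H] : Finset (Finset (Sym2 H)) :=
  Finset.univ.filter fun m => IsMaximalMatching m

lemma MM_mem {H : Type} [Fintype H] {m : Finset (Sym2 H)} : m ∈ MM H ↔ IsMaximalMatching m := by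
  simp [MM]

lemma exists_maximal {H : Type} [Fintype H] (m : Finset (Sym2 H)) (hm : IsPairMatching m) :
    ∃ m' : Finset (Sym2 H), IsMaximalMatching m' := by
  induction hk : (freeSet m).card using Nat.strong_induction_on generalizing m with
  | _ k ih =>
    by_cases h : (freeSet m).card ≤ 1
    · exact ⟨m, maximal_of_free hm h⟩
    · obtain ⟨x, hx, y, hy, hxy⟩ := Finset.one_lt_card.1 (not_le.1 h)
      rw [mem_freeSet] at hx hy
      have h2 := matching_insert hm hxy hx hy
      have h3 := freeSet_card _ h2
      have h4 := freeSet_card _ hm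
      rw [Finset.card_insert_of_notMem (not_mem_of_free hx)] at h3
      exact ih _ (by omega) _ h2 rfl

lemma MM_card_pos (H : Type) [Fintype H] : 0 < (MM H).card := by
  obtain ⟨m, hm⟩ := exists_maximal (∅ : Finset (Sym2 H)) ⟨by simp, by simp⟩
  exact Finset.card_pos.2 ⟨m, MM_mem.2 hm⟩

/-- Average of `f` over the maximal matchings. -/
noncomputable def mE {H V : Type} [Fintype H] [Fintype V] (l : H → V) (f : Multigraph → ℝ) : ℝ :=
  (∑ m ∈ MM H, f (gr l m.val)) / ((MM H).card : ℝ)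

lemma configExpect_eq (n : ℕ) (d : Fin n → ℕ) (f : Multigraph → ℝ) :
    configExpect (Fin n) d f = mE (H := HalfEdge (Fin n) d) Sigma.fst f := by
  have : maximalMatchings (Fin n) d = MM (HalfEdge (Fin n) d) := by
    ext m
    simp [maximalMatchings, MM]
  unfold configExpect mE
  rw [this]
  rfl

/-- transport of a matching along an equivalence -/
def mapM {H H' : Type} (e : H ≃ H') (m : Finset (Sym2 H)) : Finset (Sym2 H') :=
  m.map ⟨Sym2.map e, Sym2.map.injective e.injective⟩

lemma mapM_val {H H' : Type} (e : H ≃ H') (m : Finset (Sym2 H)) :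
    (mapM e m).val = m.val.map (Sym2.map e) := rfl

lemma mem_mapM {H H' : Type} (e : H ≃ H') (m : Finset (Sym2 H)) (p : Sym2 H) :
    Sym2.map e p ∈ mapM e m ↔ p ∈ m := by
  rw [← Finset.mem_val, mapM_val, Multiset.mem_map]
  constructor
  · rintro ⟨q, hq, h⟩
    rwa [← Sym2.map.injective e.injective h]
  · intro h; exact ⟨p, h, rfl⟩

lemma mapM_matching {H H' : Type} (e : H ≃ H') (m : Finset (Sym2 H)) (hm : IsPairMatching m) :
    IsPairMatching (mapM e m) := by
  have hs : ∀ p ∈ mapM e m, ∃ q ∈ m, Sym2.map e q = p := by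
    intro p hp
    rw [← Finset.mem_val, mapM_val, Multiset.mem_map] at hp
    exact hp
  constructor
  · intro p hp
    obtain ⟨q, hq, rfl⟩ := hs p hp
    have := hm.1 q hq
    induction q with
    | _ x y => simpa using this
  · intro p hp p' hp' hne z hz hz'
    obtain ⟨q, hq, rfl⟩ := hs p hp
    obtain ⟨q', hq', rfl⟩ := hs p' hp'
    rw [Sym2.mem_map] at hz hz'
    obtain ⟨a, ha, rfl⟩ := hz
    obtain ⟨b, hb, hab⟩ := hz'
    rw [e.injective hab] at hb
    exact hm.2 q hq q' hq' (by rintro rfl; exact hne rfl) a ha hb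

lemma mapM_maximal {H H' : Type} [Fintype H] [Fintype H'] (e : H ≃ H') (m : Finset (Sym2 H))
    (hm : IsMaximalMatching m) : IsMaximalMatching (mapM e m) := by
  have h := mapM_matching e m hm.1
  apply maximal_of_free h
  have h1 := freeSet_card _ h
  have h2 := freeSet_card _ hm.1
  have h3 := maximal_free hm
  have h4 : (mapM e m).card = m.card := by
    rw [← Finset.card_val, mapM_val, Multiset.card_map, Finset.card_val]
  have h5 := Fintype.card_congr e
  omega

lemma sum_MM_equiv {H H' : Type} [Fintype H] [Fintype H'] (e : H ≃ H')
    (φ : Finset (Sym2 H') → ℝ) : ∑ m ∈ MM H, φ (mapM e m) = ∑ m ∈ MM H', φ m := by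
  refine Finset.sum_bij (fun m _ => mapM e m) ?_ ?_ ?_ ?_
  · intro m hm; exact MM_mem.2 (mapM_maximal e m (MM_mem.1 hm))
  · intro m _ m' _ h; exact Finset.map_injective _ h
  · intro m hm
    refine ⟨mapM e.symm m, MM_mem.2 (mapM_maximal _ _ (MM_mem.1 hm)), ?_⟩
    apply Finset.val_injective
    simp [mapM_val, Multiset.map_map, Sym2.map_map]
  · intros; rfl

lemma mE_equiv {f : Multigraph → ℝ} (hinv : GraphParam.Invariant f) {H V H' V' : Type}
    [Fintype H] [Fintype V] [Fintype H'] [Fintype V'] (l : H → V) (l' : H' → V')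
    (e : H ≃ H') (e' : V ≃ V') (he : ∀ h, l' (e h) = e' (l h)) : mE l f = mE l' f := by
  have h1 : ∑ m ∈ MM H, f (gr l m.val) = ∑ m ∈ MM H', f (gr l' m.val) := by
    rw [← sum_MM_equiv e]
    refine Finset.sum_congr rfl fun m _ => ?_
    refine hinv _ _ e' ?_
    simp only [gr, mapM_val, Multiset.map_map]
    refine Multiset.map_congr rfl fun p _ => ?_
    simp [Sym2.map_map, he]
    rfl
  have h2 : ((MM H).card : ℝ) = ((MM H').card : ℝ) := by
    have := sum_MM_equiv e (fun _ => (1 : ℝ))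
    simpa using this
  unfold mE
  rw [h1, h2]

lemma mE_eq_perm (f : Multigraph → ℝ) {H V : Type} [Fintype H] [Fintype V] (l : H → V)
    (m0 : Finset (Sym2 H)) (hm0 : IsMaximalMatching m0) :
    mE l f = (∑ σ : Equiv.Perm H, f (gr (l ∘ σ) m0.val)) / (Fintype.card (Equiv.Perm H) : ℝ) := by
  have h1 : ∀ σ : Equiv.Perm H, ∑ m ∈ MM H, f (gr (l ∘ σ) m.val) = ∑ m ∈ MM H, f (gr l m.val) := by
    intro σ
    rw [← sum_MM_equiv σ (fun m => f (gr l m.val))]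
    refine Finset.sum_congr rfl fun m _ => ?_
    rw [mapM_val, gr_map]
  have h2 : ∀ m ∈ MM H, ∑ σ : Equiv.Perm H, f (gr (l ∘ σ) m.val) =
      ∑ σ : Equiv.Perm H, f (gr (l ∘ σ) m0.val) := by
    intro m hm
    rw [MM_mem] at hm
    have hc : m0.card = m.card := by
      have a1 := freeSet_card _ hm.1
      have a2 := freeSet_card _ hm0.1
      have a3 := maximal_free hm
      have a4 := maximal_free hm0
      omega
    obtain ⟨π, hπ⟩ := trans_matching m0 m hm0.1 hm.1 hc
    simp_rw [hπ, gr_map]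
    exact Fintype.sum_equiv (Equiv.mulRight π) _ _ (fun σ => by simp [Function.comp_assoc])
  have h3 : (Fintype.card (Equiv.Perm H) : ℝ) * ∑ m ∈ MM H, f (gr l m.val) =
      ((MM H).card : ℝ) * ∑ σ : Equiv.Perm H, f (gr (l ∘ σ) m0.val) := by
    calc _ = ∑ σ : Equiv.Perm H, ∑ m ∈ MM H, f (gr (l ∘ σ) m.val) := by
          simp [h1]
      _ = ∑ m ∈ MM H, ∑ σ : Equiv.Perm H, f (gr (l ∘ σ) m.val) := Finset.sum_comm
      _ = _ := by rw [Finset.sum_congr rfl h2]; simp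
  have h4 : (0 : ℝ) < (MM H).card := by exact_mod_cast MM_card_pos H
  have h5 : (0 : ℝ) < Fintype.card (Equiv.Perm H) := by exact_mod_cast Fintype.card_pos
  unfold mE
  rw [div_eq_div_iff h4.ne' h5.ne']
  linarith

/-! ### Two-sided averages -/

/-- Average over side-preserving permutations of the half-edges. -/
noncomputable def FF {P Q V : Type} [Fintype P] [Fintype Q] [Fintype V] (l : P ⊕ Q → V)
    (f : Multigraph → ℝ) (E : Multiset (Sym2 (P ⊕ Q))) : ℝ :=
  (∑ g : Equiv.Perm P × Equiv.Perm Q, f (gr (l ∘ Sum.map g.1 g.2) E)) /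
    (Fintype.card (Equiv.Perm P × Equiv.Perm Q) : ℝ)

lemma card_pos' (P Q : Type) [Fintype P] [Fintype Q] :
    (0 : ℝ) < Fintype.card (Equiv.Perm P × Equiv.Perm Q) := by
  exact_mod_cast Fintype.card_pos

section two
set_option linter.unusedSectionVars false
variable {P Q V : Type} [Fintype P] [Fintype Q] [Fintype V] (l : P ⊕ Q → V) {f : Multigraph → ℝ}

lemma FF_reindex (π : Equiv.Perm P × Equiv.Perm Q) (E : Multiset (Sym2 (P ⊕ Q))) :
    FF l f (E.map (Sym2.map (Sum.map π.1 π.2))) = FF l f E := by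
  unfold FF
  congr 1
  simp_rw [gr_map]
  refine Fintype.sum_equiv (Equiv.mulRight π) _ _ (fun g => ?_)
  congr 2
  funext x
  rcases x with x | x <;> simp

lemma FF_lip {κ : ℝ} (hlip : GraphParam.Lipschitz f κ) (E : Multiset (Sym2 (P ⊕ Q)))
    (e : Sym2 (P ⊕ Q)) : |FF l f (e ::ₘ E) - FF l f E| ≤ κ := by
  induction e with
  | _ x y =>
  unfold FF
  rw [← sub_div, abs_div, abs_of_pos (card_pos' P Q), div_le_iff₀ (card_pos' P Q),
    ← Finset.sum_sub_distrib]
  refine (Finset.abs_sum_le_sum_abs _ _).trans ?_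
  refine (Finset.sum_le_card_nsmul _ _ κ fun g _ => ?_).trans ?_
  · rw [gr_cons]; exact hlip _ _ _
  · simp [mul_comm]

lemma FF_conc (hconc : GraphParam.Concave f) (E : Multiset (Sym2 (P ⊕ Q))) (y : P ⊕ Q → ℝ)
    (hy : ∑ h, y h = 0) :
    ∑ h, ∑ h', (FF l f (s(h, h') ::ₘ E) - FF l f E) * y h * y h' ≤ 0 := by
  have h1 : ∑ g : Equiv.Perm P × Equiv.Perm Q, ∑ h, ∑ h',
      (f (gr (l ∘ Sum.map g.1 g.2) (s(h, h') ::ₘ E)) - f (gr (l ∘ Sum.map g.1 g.2) E)) *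
        y h * y h' ≤ 0 :=
    Finset.sum_nonpos fun g _ => conc_pull hconc _ _ _ hy
  have h2 : ∑ h, ∑ h', (FF l f (s(h, h') ::ₘ E) - FF l f E) * y h * y h' =
    (∑ g : Equiv.Perm P × Equiv.Perm Q, ∑ h, ∑ h',
      (f (gr (l ∘ Sum.map g.1 g.2) (s(h, h') ::ₘ E)) - f (gr (l ∘ Sum.map g.1 g.2) E)) *
        y h * y h') / (Fintype.card (Equiv.Perm P × Equiv.Perm Q) : ℝ) := by
    have hsw : ∀ G : Equiv.Perm P × Equiv.Perm Q → P ⊕ Q → P ⊕ Q → ℝ,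
        ∑ g, ∑ h, ∑ h', G g h h' = ∑ h, ∑ h', ∑ g, G g h h' := by
      intro G
      rw [Finset.sum_comm]
      exact Finset.sum_congr rfl fun h _ => Finset.sum_comm
    rw [hsw, Finset.sum_div]
    refine Finset.sum_congr rfl fun h _ => ?_
    rw [Finset.sum_div]
    refine Finset.sum_congr rfl fun h' _ => ?_
    unfold FF
    rw [← sub_div, ← Finset.sum_sub_distrib, ← Finset.sum_mul, ← Finset.sum_mul]
    ring
  rw [h2]
  exact div_nonpos_of_nonpos_of_nonneg h1 (card_pos' P Q).le

/-- free elements on each side -/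
noncomputable def pf (m : Finset (Sym2 (P ⊕ Q))) : Finset P :=
  Finset.univ.filter fun h => IsFree m (Sum.inl h)

noncomputable def qf (m : Finset (Sym2 (P ⊕ Q))) : Finset Q :=
  Finset.univ.filter fun h => IsFree m (Sum.inr h)

lemma mem_pf {m : Finset (Sym2 (P ⊕ Q))} {h : P} : h ∈ pf m ↔ IsFree m (Sum.inl h) := by
  simp [pf]

lemma mem_qf {m : Finset (Sym2 (P ⊕ Q))} {h : Q} : h ∈ qf m ↔ IsFree m (Sum.inr h) := by
  simp [qf]

lemma FF_symP (m : Finset (Sym2 (P ⊕ Q))) {a b c d : P} (ha : a ∈ pf m) (hb : b ∈ pf m)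
    (hc : c ∈ pf m) (hd : d ∈ pf m) (hab : a ≠ b) (hcd : c ≠ d) :
    FF l f (s(Sum.inl a, Sum.inl b) ::ₘ m.val) = FF l f (s(Sum.inl c, Sum.inl d) ::ₘ m.val) := by
  obtain ⟨π, h1, h2, h3⟩ := dbl_swap hab hcd
  rw [← FF_reindex l (π, 1) (s(Sum.inl a, Sum.inl b) ::ₘ m.val)]
  congr 1
  rw [Multiset.map_cons, mmap_fix]
  · simp [h1, h2]
  · intro e he x hx
    rcases x with x | x
    · simp only [Sum.map_inl, Sum.inl.injEq]
      rw [mem_pf] at ha hb hc hd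
      apply h3
      · rintro rfl; exact ha e he hx
      · rintro rfl; exact hb e he hx
      · rintro rfl; exact hc e he hx
      · rintro rfl; exact hd e he hx
    · simp

lemma FF_symQ (m : Finset (Sym2 (P ⊕ Q))) {a b c d : Q} (ha : a ∈ qf m) (hb : b ∈ qf m)
    (hc : c ∈ qf m) (hd : d ∈ qf m) (hab : a ≠ b) (hcd : c ≠ d) :
    FF l f (s(Sum.inr a, Sum.inr b) ::ₘ m.val) = FF l f (s(Sum.inr c, Sum.inr d) ::ₘ m.val) := by
  obtain ⟨π, h1, h2, h3⟩ := dbl_swap hab hcd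
  rw [← FF_reindex l (1, π) (s(Sum.inr a, Sum.inr b) ::ₘ m.val)]
  congr 1
  rw [Multiset.map_cons, mmap_fix]
  · simp [h1, h2]
  · intro e he x hx
    rcases x with x | x
    · simp
    · simp only [Sum.map_inr, Sum.inr.injEq]
      rw [mem_qf] at ha hb hc hd
      apply h3
      · rintro rfl; exact ha e he hx
      · rintro rfl; exact hb e he hx
      · rintro rfl; exact hc e he hx
      · rintro rfl; exact hd e he hx

lemma FF_symX (m : Finset (Sym2 (P ⊕ Q))) {a c : P} {b d : Q} (ha : a ∈ pf m) (hb : b ∈ qf m)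
    (hc : c ∈ pf m) (hd : d ∈ qf m) :
    FF l f (s(Sum.inl a, Sum.inr b) ::ₘ m.val) = FF l f (s(Sum.inl c, Sum.inr d) ::ₘ m.val) := by
  rw [← FF_reindex l (Equiv.swap a c, Equiv.swap b d) (s(Sum.inl a, Sum.inr b) ::ₘ m.val)]
  congr 1
  rw [Multiset.map_cons, mmap_fix]
  · simp
  · intro e he x hx
    rw [mem_pf] at ha hc
    rw [mem_qf] at hb hd
    rcases x with x | x
    · simp only [Sum.map_inl, Sum.inl.injEq]
      apply Equiv.swap_apply_of_ne_of_ne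
      · rintro rfl; exact ha e he hx
      · rintro rfl; exact hc e he hx
    · simp only [Sum.map_inr, Sum.inr.injEq]
      apply Equiv.swap_apply_of_ne_of_ne
      · rintro rfl; exact hb e he hx
      · rintro rfl; exact hd e he hx

lemma sum_offdiag {α : Type} (S : Finset α) (D : α → α → ℝ) (X κ : ℝ)
    (h1 : ∀ a ∈ S, ∀ b ∈ S, a ≠ b → D a b = X) (h2 : ∀ a ∈ S, -κ ≤ D a a) (hX : X ≤ κ) :
    (S.card : ℝ) ^ 2 * X - 2 * κ * S.card ≤ ∑ a ∈ S, ∑ b ∈ S, D a b := by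
  have : ∀ a ∈ S, (S.card : ℝ) * X - 2 * κ ≤ ∑ b ∈ S, D a b := by
    intro a ha
    have h3 : ∑ b ∈ S, (X + if a = b then -2 * κ else 0) ≤ ∑ b ∈ S, D a b := by
      apply Finset.sum_le_sum
      intro b hb
      split_ifs with h
      · subst h; linarith [h2 a ha]
      · rw [h1 a ha b hb h]; simp
    rw [Finset.sum_add_distrib, Finset.sum_ite_eq, if_pos ha] at h3
    simp at h3
    linarith
  have h4 := Finset.card_nsmul_le_sum S _ _ this
  rw [nsmul_eq_mul] at h4
  nlinarith

lemma FF_step {κ : ℝ} (hlip : GraphParam.Lipschitz f κ) (hconc : GraphParam.Concave f)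
    (m : Finset (Sym2 (P ⊕ Q))) {a b : P} {c d : Q} (ha : a ∈ pf m) (hb : b ∈ pf m)
    (hc : c ∈ qf m) (hd : d ∈ qf m) (hab : a ≠ b) (hcd : c ≠ d) :
    FF l f (s(Sum.inl a, Sum.inl b) ::ₘ m.val) + FF l f (s(Sum.inr c, Sum.inr d) ::ₘ m.val) ≤
      2 * FF l f (s(Sum.inl a, Sum.inr c) ::ₘ m.val) +
        2 * κ * (1 / ((pf m).card : ℝ) + 1 / ((qf m).card : ℝ)) := by
  set p : ℝ := ((pf m).card : ℝ) with hp
  set q : ℝ := ((qf m).card : ℝ) with hq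
  have hp0 : 0 < p := by rw [hp]; exact_mod_cast Finset.card_pos.2 ⟨a, ha⟩
  have hq0 : 0 < q := by rw [hq]; exact_mod_cast Finset.card_pos.2 ⟨c, hc⟩
  let D : P ⊕ Q → P ⊕ Q → ℝ := fun h h' => FF l f (s(h, h') ::ₘ m.val) - FF l f m.val
  have hD : ∀ h h', |D h h'| ≤ κ := fun h h' => FF_lip l hlip m.val s(h, h')
  let y : P ⊕ Q → ℝ := Sum.elim (fun h => if h ∈ pf m then 1 / p else 0)
    (fun h => if h ∈ qf m then - (1 / q) else 0)
  have hy : ∑ h, y h = 0 := by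
    simp [y, Fintype.sum_sum_type, ← hp, ← hq, hp0.ne', hq0.ne']
  have h0 := FF_conc l hconc m.val y hy
  change ∑ h, ∑ h', D h h' * y h * y h' ≤ 0 at h0
  have hexp : ∑ h, ∑ h', D h h' * y h * y h' =
      (∑ h ∈ pf m, ∑ h' ∈ pf m, D (Sum.inl h) (Sum.inl h')) / p ^ 2
      + (∑ h ∈ qf m, ∑ h' ∈ qf m, D (Sum.inr h) (Sum.inr h')) / q ^ 2
      - 2 * (∑ h ∈ pf m, ∑ h' ∈ qf m, D (Sum.inl h) (Sum.inr h')) / (p * q) := by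
    have hsym : ∑ h ∈ qf m, ∑ h' ∈ pf m, D (Sum.inr h) (Sum.inl h') =
        ∑ h ∈ pf m, ∑ h' ∈ qf m, D (Sum.inl h) (Sum.inr h') := by
      rw [Finset.sum_comm]
      refine Finset.sum_congr rfl fun h _ => Finset.sum_congr rfl fun h' _ => ?_
      simp only [D, Sym2.eq_swap]
    have hs : ∀ F : P ⊕ Q → ℝ, ∑ h, F h * y h =
        (∑ h ∈ pf m, F (Sum.inl h)) / p - (∑ h ∈ qf m, F (Sum.inr h)) / q := by
      intro F
      simp only [Fintype.sum_sum_type, y, Sum.elim_inl, Sum.elim_inr, mul_ite, mul_zero,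
        Finset.sum_ite_mem, Finset.univ_inter]
      rw [Finset.sum_div, Finset.sum_div, sub_eq_add_neg, ← Finset.sum_neg_distrib]
      congr 1
      · exact Finset.sum_congr rfl fun h _ => by ring
      · exact Finset.sum_congr rfl fun h _ => by ring
    have h5 : ∀ h, ∑ h', D h h' * y h * y h' = (∑ h', D h h' * y h') * y h := by
      intro h
      rw [Finset.sum_mul]
      exact Finset.sum_congr rfl fun h _ => by ring
    simp_rw [h5]
    rw [hs (fun h => ∑ h', D h h' * y h')]
    simp_rw [hs]
    simp_rw [Finset.sum_sub_distrib, ← Finset.sum_div]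
    rw [hsym]
    field_simp
    ring
  set X := D (Sum.inl a) (Sum.inl b) with hX
  set Y := D (Sum.inr c) (Sum.inr d) with hY
  set Z := D (Sum.inl a) (Sum.inr c) with hZ
  have e1 := sum_offdiag (pf m) (fun h h' => D (Sum.inl h) (Sum.inl h')) X κ
    (fun h hh h' hh' hne => by
      simp only [D, hX]; rw [FF_symP l m hh hh' ha hb hne hab])
    (fun h _ => (abs_le.1 (hD _ _)).1) (abs_le.1 (hD _ _)).2
  have e2 := sum_offdiag (qf m) (fun h h' => D (Sum.inr h) (Sum.inr h')) Y κ
    (fun h hh h' hh' hne => by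
      simp only [D, hY]; rw [FF_symQ l m hh hh' hc hd hne hcd])
    (fun h _ => (abs_le.1 (hD _ _)).1) (abs_le.1 (hD _ _)).2
  have e3 : ∑ h ∈ pf m, ∑ h' ∈ qf m, D (Sum.inl h) (Sum.inr h') = p * q * Z := by
    have : ∀ h ∈ pf m, ∑ h' ∈ qf m, D (Sum.inl h) (Sum.inr h') = q * Z := by
      intro h hh
      rw [Finset.sum_congr rfl (g := fun _ => Z)]
      · simp [hq]
      · intro h' hh'
        simp only [D, hZ]; rw [FF_symX l m hh hh' ha hc]
    rw [Finset.sum_congr rfl this]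
    simp [hp, mul_assoc]
  rw [hexp, e3] at h0
  rw [← hp] at e1
  rw [← hq] at e2
  have e1' : X - 2 * κ / p ≤
      (∑ h ∈ pf m, ∑ h' ∈ pf m, D (Sum.inl h) (Sum.inl h')) / p ^ 2 := by
    rw [le_div_iff₀ (by positivity)]
    refine le_trans (le_of_eq ?_) e1
    field_simp
  have e2' : Y - 2 * κ / q ≤
      (∑ h ∈ qf m, ∑ h' ∈ qf m, D (Sum.inr h) (Sum.inr h')) / q ^ 2 := by
    rw [le_div_iff₀ (by positivity)]
    refine le_trans (le_of_eq ?_) e2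
    field_simp
  have e3' : 2 * (p * q * Z) / (p * q) = 2 * Z := by field_simp
  rw [e3'] at h0
  have : X + Y ≤ 2 * Z + 2 * κ * (1 / p + 1 / q) := by
    have : 2 * κ * (1 / p + 1 / q) = 2 * κ / p + 2 * κ / q := by ring
    linarith
  simp only [hX, hY, hZ, D] at this
  linarith

end two

section three
variable {P Q : Type} [Fintype P] [Fintype Q]
set_option linter.unusedSectionVars false

/-- cross edges -/
def IsX (e : Sym2 (P ⊕ Q)) : Prop := ∃ (a : P) (b : Q), e = s(Sum.inl a, Sum.inr b)

noncomputable def cr (m : Finset (Sym2 (P ⊕ Q))) : Finset (Sym2 (P ⊕ Q)) := m.filter IsX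

lemma card_pq (m : Finset (Sym2 (P ⊕ Q))) (hm : IsPairMatching m) :
    (pf m).card + (qf m).card + 2 * m.card = Fintype.card P + Fintype.card Q := by
  have h := freeSet_card m hm
  have h2 : freeSet m = (pf m).disjSum (qf m) := by
    ext x
    rcases x with x | x <;> simp [mem_freeSet, mem_pf, mem_qf]
  rw [h2, Finset.card_disjSum, Fintype.card_sum] at h
  exact h

lemma not_isX_inl (a b : P) : ¬ IsX (s(Sum.inl a, Sum.inl b) : Sym2 (P ⊕ Q)) := by
  rintro ⟨c, d, h⟩
  simp at h

lemma not_isX_inr (a b : Q) : ¬ IsX (s(Sum.inr a, Sum.inr b) : Sym2 (P ⊕ Q)) := by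
  rintro ⟨c, d, h⟩
  simp at h

lemma insP (m : Finset (Sym2 (P ⊕ Q))) {a b : P} (ha : a ∈ pf m) (hb : b ∈ pf m) (hab : a ≠ b) :
    (pf (insert s(Sum.inl a, Sum.inl b) m)).card + 2 = (pf m).card ∧
    (qf (insert s(Sum.inl a, Sum.inl b) m)) = qf m ∧
    cr (insert s(Sum.inl a, Sum.inl b) m) = cr m := by
  refine ⟨?_, ?_, ?_⟩
  · have : pf (insert s(Sum.inl a, Sum.inl b) m) = ((pf m).erase a).erase b := by
      ext z
      simp only [mem_pf, isFree_insert, Finset.mem_erase, ne_eq, Sum.inl.injEq]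
      tauto
    have hb' : b ∈ (pf m).erase a := Finset.mem_erase.2 ⟨hab.symm, hb⟩
    have h1 := Finset.card_erase_add_one hb'
    have h2 := Finset.card_erase_add_one ha
    rw [this]; omega
  · ext z
    simp [mem_qf, isFree_insert]
  · simp [cr, Finset.filter_insert, not_isX_inl]

lemma insQ (m : Finset (Sym2 (P ⊕ Q))) {a b : Q} (ha : a ∈ qf m) (hb : b ∈ qf m) (hab : a ≠ b) :
    (qf (insert s(Sum.inr a, Sum.inr b) m)).card + 2 = (qf m).card ∧
    (pf (insert s(Sum.inr a, Sum.inr b) m)) = pf m ∧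
    cr (insert s(Sum.inr a, Sum.inr b) m) = cr m := by
  refine ⟨?_, ?_, ?_⟩
  · have : qf (insert s(Sum.inr a, Sum.inr b) m) = ((qf m).erase a).erase b := by
      ext z
      simp only [mem_qf, isFree_insert, Finset.mem_erase, ne_eq, Sum.inr.injEq]
      tauto
    have hb' : b ∈ (qf m).erase a := Finset.mem_erase.2 ⟨hab.symm, hb⟩
    have h1 := Finset.card_erase_add_one hb'
    have h2 := Finset.card_erase_add_one ha
    rw [this]; omega
  · ext z
    simp [mem_pf, isFree_insert]
  · simp [cr, Finset.filter_insert, not_isX_inr]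

/-- removing a cross edge -/
lemma remX (m : Finset (Sym2 (P ⊕ Q))) (hm : IsPairMatching m) (hk : 0 < (cr m).card) :
    ∃ (m0 : Finset (Sym2 (P ⊕ Q))) (a : P) (b : Q), IsPairMatching m0 ∧
      a ∈ pf m0 ∧ b ∈ qf m0 ∧ m.val = s(Sum.inl a, Sum.inr b) ::ₘ m0.val ∧
      m.card = m0.card + 1 ∧ (cr m).card = (cr m0).card + 1 ∧
      (pf m).card + 1 = (pf m0).card ∧ (qf m).card + 1 = (qf m0).card := by
  obtain ⟨e, he⟩ := Finset.card_pos.1 hk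
  obtain ⟨hem, a, b, rfl⟩ := Finset.mem_filter.1 he
  have hins := Finset.insert_erase hem
  have hne := Finset.notMem_erase s(Sum.inl a, Sum.inr b) m
  have hm' := hm
  rw [← hins] at hm'
  obtain ⟨-, ha, hb⟩ := free_of_insert hm' hne
  refine ⟨m.erase s(Sum.inl a, Sum.inr b), a, b, pm_mono hm (Finset.erase_subset _ _),
    mem_pf.2 ha, mem_qf.2 hb, ?_, ?_, ?_, ?_, ?_⟩
  · conv_lhs => rw [← hins]
    exact Finset.insert_val_of_notMem hne
  · exact (Finset.card_erase_add_one hem).symm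
  · have : cr (m.erase s(Sum.inl a, Sum.inr b)) = (cr m).erase s(Sum.inl a, Sum.inr b) := by
      simp [cr, Finset.filter_erase]
    rw [this]
    exact (Finset.card_erase_add_one he).symm
  · have : pf m = (pf (m.erase s(Sum.inl a, Sum.inr b))).erase a := by
      conv_lhs => rw [← hins]
      ext z
      simp [mem_pf, isFree_insert]
    rw [this]
    exact Finset.card_erase_add_one (mem_pf.2 ha)
  · have : qf m = (qf (m.erase s(Sum.inl a, Sum.inr b))).erase b := by
      conv_lhs => rw [← hins]
      ext z
      simp [mem_qf, isFree_insert]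
    rw [this]
    exact Finset.card_erase_add_one (mem_qf.2 hb)

variable {VA VB : Type} [Fintype VA] [Fintype VB] (lA : P → VA) (lB : Q → VB)
  {f : Multigraph → ℝ}

lemma FF_sep (hadd : GraphParam.Additive f) (m : Finset (Sym2 (P ⊕ Q))) (hm : IsPairMatching m)
    (hk : (cr m).card = 0) (hp : (pf m).card ≤ 1) (hq : (qf m).card ≤ 1) :
    FF (Sum.map lA lB) f m.val = mE lA f + mE lB f := by
  let iA : Sym2 P ↪ Sym2 (P ⊕ Q) := ⟨Sym2.map Sum.inl, Sym2.map.injective Sum.inl_injective⟩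
  let iB : Sym2 Q ↪ Sym2 (P ⊕ Q) := ⟨Sym2.map Sum.inr, Sym2.map.injective Sum.inr_injective⟩
  let mA : Finset (Sym2 P) := Finset.univ.filter fun e => iA e ∈ m
  let mB : Finset (Sym2 Q) := Finset.univ.filter fun e => iB e ∈ m
  have hmA : ∀ e, e ∈ mA ↔ iA e ∈ m := fun e => by simp [mA]
  have hmB : ∀ e, e ∈ mB ↔ iB e ∈ m := fun e => by simp [mB]
  have hcase : ∀ e ∈ m, (∃ e' ∈ mA, iA e' = e) ∨ (∃ e' ∈ mB, iB e' = e) := by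
    intro e he
    have hx : ¬ IsX e := fun hx => by
      have : e ∈ cr m := Finset.mem_filter.2 ⟨he, hx⟩
      rw [Finset.card_eq_zero] at hk
      rw [hk] at this
      simp at this
    induction e with
    | _ x y =>
      rcases x with x | x <;> rcases y with y | y
      · exact Or.inl ⟨s(x, y), (hmA _).2 he, rfl⟩
      · exact absurd ⟨x, y, rfl⟩ hx
      · exact absurd ⟨y, x, Sym2.eq_swap⟩ hx
      · exact Or.inr ⟨s(x, y), (hmB _).2 he, rfl⟩
  have hAm : IsPairMatching mA := by
    constructor
    · intro e he
      have := hm.1 _ ((hmA e).1 he)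
      induction e with
      | _ x y => simpa [iA] using this
    · intro e he e' he' hne h hh hh'
      refine hm.2 _ ((hmA e).1 he) _ ((hmA e').1 he') (fun h => hne (iA.injective h)) (Sum.inl h)
        (Sym2.mem_map.2 ⟨h, hh, rfl⟩) (Sym2.mem_map.2 ⟨h, hh', rfl⟩)
  have hBm : IsPairMatching mB := by
    constructor
    · intro e he
      have := hm.1 _ ((hmB e).1 he)
      induction e with
      | _ x y => simpa [iB] using this
    · intro e he e' he' hne h hh hh'
      refine hm.2 _ ((hmB e).1 he) _ ((hmB e').1 he') (fun h => hne (iB.injective h)) (Sum.inr h)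
        (Sym2.mem_map.2 ⟨h, hh, rfl⟩) (Sym2.mem_map.2 ⟨h, hh', rfl⟩)
  have hdisj : Disjoint (mA.map iA) (mB.map iB) := by
    rw [Finset.disjoint_left]
    intro e h1 h2
    obtain ⟨e1, -, rfl⟩ := Finset.mem_map.1 h1
    obtain ⟨e2, -, h⟩ := Finset.mem_map.1 h2
    induction e1 with
    | _ x y =>
    induction e2 with
    | _ x' y' => simp [iA, iB] at h
  have hmeq : m = (mA.map iA).disjUnion (mB.map iB) hdisj := by
    ext e
    simp only [Finset.mem_disjUnion, Finset.mem_map]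
    constructor
    · exact hcase e
    · rintro (⟨e', h, rfl⟩ | ⟨e', h, rfl⟩)
      · exact (hmA _).1 h
      · exact (hmB _).1 h
  have hval : m.val = mA.val.map (Sym2.map Sum.inl) + mB.val.map (Sym2.map Sum.inr) :=
    congrArg Finset.val hmeq
  have hfA : freeSet mA ⊆ pf m := by
    intro h hh
    rw [mem_freeSet] at hh
    rw [mem_pf]
    intro e he hhe
    rcases hcase e he with ⟨e', h', rfl⟩ | ⟨e', h', rfl⟩
    · obtain ⟨z, hz, hzz⟩ := Sym2.mem_map.1 hhe
      rw [Sum.inl_injective hzz] at hz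
      exact hh e' h' hz
    · obtain ⟨z, hz, hzz⟩ := Sym2.mem_map.1 hhe
      simp at hzz
  have hfB : freeSet mB ⊆ qf m := by
    intro h hh
    rw [mem_freeSet] at hh
    rw [mem_qf]
    intro e he hhe
    rcases hcase e he with ⟨e', h', rfl⟩ | ⟨e', h', rfl⟩
    · obtain ⟨z, hz, hzz⟩ := Sym2.mem_map.1 hhe
      simp at hzz
    · obtain ⟨z, hz, hzz⟩ := Sym2.mem_map.1 hhe
      rw [Sum.inr_injective hzz] at hz
      exact hh e' h' hz
  have hAx := maximal_of_free hAm ((Finset.card_le_card hfA).trans hp)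
  have hBx := maximal_of_free hBm ((Finset.card_le_card hfB).trans hq)
  have hgr : ∀ g : Equiv.Perm P × Equiv.Perm Q, f (gr (Sum.map lA lB ∘ Sum.map g.1 g.2) m.val) =
      f (gr (lA ∘ g.1) mA.val) + f (gr (lB ∘ g.2) mB.val) := by
    intro g
    rw [← hadd]
    congr 1
    simp only [gr, Multigraph.disjUnion, hval, Multiset.map_add, Multiset.map_map]
    congr 2
    · refine Multiset.map_congr rfl fun e _ => ?_
      simp only [Function.comp_apply, Sym2.map_map]
      rfl
    · refine Multiset.map_congr rfl fun e _ => ?_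
      simp only [Function.comp_apply, Sym2.map_map]
      rfl
  rw [mE_eq_perm f lA mA hAx, mE_eq_perm f lB mB hBx]
  unfold FF
  simp_rw [hgr]
  rw [Fintype.sum_prod_type]
  simp only [Finset.sum_add_distrib, Finset.sum_const, Fintype.card_prod, nsmul_eq_mul,
    Finset.card_univ, ← Finset.mul_sum]
  have h4 : (0 : ℝ) < Fintype.card (Equiv.Perm P) := by exact_mod_cast Fintype.card_pos
  have h5 : (0 : ℝ) < Fintype.card (Equiv.Perm Q) := by exact_mod_cast Fintype.card_pos
  push_cast
  field_simp

lemma triv0 (hadd : GraphParam.Additive f) {κ : ℝ} (hlip : GraphParam.Lipschitz f κ) (N : ℕ)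
    (hN : Fintype.card P + Fintype.card Q ≤ 2 * N + 1) (m : Finset (Sym2 (P ⊕ Q)))
    (hm : IsPairMatching m) (hk : (cr m).card = 0) :
    mE lA f + mE lB f ≤ FF (Sum.map lA lB) f m.val + κ * ((N : ℝ) - m.card) := by
  have hκ := kappa_nonneg hlip
  induction hn : (pf m).card + (qf m).card using Nat.strong_induction_on generalizing m with
  | _ n ih =>
    have hpq := card_pq m hm
    by_cases hp : (pf m).card ≤ 1
    · by_cases hq : (qf m).card ≤ 1
      · rw [FF_sep lA lB hadd m hm hk hp hq]
        have : m.card ≤ N := by omega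
        have : (m.card : ℝ) ≤ N := by exact_mod_cast this
        have := mul_nonneg hκ (sub_nonneg.2 this)
        linarith
      · obtain ⟨a, ha, b, hb, hab⟩ := Finset.one_lt_card.1 (not_le.1 hq)
        obtain ⟨h1, h2, h3⟩ := insQ m ha hb hab
        have ha' := mem_qf.1 ha
        have hne := not_mem_of_free (y := Sum.inr b) ha'
        have := ih _ (by rw [h2]; omega) (insert s(Sum.inr a, Sum.inr b) m)
          (matching_insert hm (by simpa using hab) ha' (mem_qf.1 hb)) (by rw [h3]; exact hk) rfl
        rw [Finset.card_insert_of_notMem hne, Finset.insert_val_of_notMem hne] at this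
        have h4 := (abs_le.1 (FF_lip (Sum.map lA lB) hlip m.val s(Sum.inr a, Sum.inr b))).2
        push_cast at this
        linarith
    · obtain ⟨a, ha, b, hb, hab⟩ := Finset.one_lt_card.1 (not_le.1 hp)
      obtain ⟨h1, h2, h3⟩ := insP m ha hb hab
      have ha' := mem_pf.1 ha
      have hne := not_mem_of_free (y := Sum.inl b) ha'
      have := ih _ (by rw [h2]; omega) (insert s(Sum.inl a, Sum.inl b) m)
        (matching_insert hm (by simpa using hab) ha' (mem_pf.1 hb)) (by rw [h3]; exact hk) rfl
      rw [Finset.card_insert_of_notMem hne, Finset.insert_val_of_notMem hne] at this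
      have h4 := (abs_le.1 (FF_lip (Sum.map lA lB) hlip m.val s(Sum.inl a, Sum.inl b))).2
      push_cast at this
      linarith

lemma triv (hadd : GraphParam.Additive f) {κ : ℝ} (hlip : GraphParam.Lipschitz f κ) (N : ℕ)
    (hN : Fintype.card P + Fintype.card Q ≤ 2 * N + 1) (k : ℕ) : ∀ (m : Finset (Sym2 (P ⊕ Q))),
    IsPairMatching m → (cr m).card = k →
    mE lA f + mE lB f ≤ FF (Sum.map lA lB) f m.val + κ * (2 * k + ((N : ℝ) - m.card)) := by
  induction k with
  | zero =>
    intro m hm hk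
    simpa using triv0 lA lB hadd hlip N hN m hm hk
  | succ k ih =>
    intro m hm hk
    obtain ⟨m0, a, b, hm0, ha, hb, hv, hc, hx, -, -⟩ := remX m hm (by omega)
    have h1 := ih m0 hm0 (by omega)
    have h4 := (abs_le.1 (FF_lip (Sum.map lA lB) hlip m0.val s(Sum.inl a, Sum.inr b))).1
    rw [hv, hc]
    push_cast
    linarith

/-- removing `w` cross edges -/
lemma remW {κ : ℝ} (hlip : GraphParam.Lipschitz f κ) (w : ℕ) : ∀ (m : Finset (Sym2 (P ⊕ Q))),
    IsPairMatching m → w ≤ (cr m).card → ∃ m0 : Finset (Sym2 (P ⊕ Q)), IsPairMatching m0 ∧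
      m.card = m0.card + w ∧ (cr m).card = (cr m0).card + w ∧
      (pf m).card + w = (pf m0).card ∧ (qf m).card + w = (qf m0).card ∧
      FF (Sum.map lA lB) f m0.val ≤ FF (Sum.map lA lB) f m.val + κ * w := by
  induction w with
  | zero => intro m hm _; exact ⟨m, hm, by simp⟩
  | succ w ih =>
    intro m hm hk
    obtain ⟨m1, a, b, hm1, ha, hb, hv, hc, hx, hp, hq⟩ := remX m hm (by omega)
    obtain ⟨m0, hm0, h1, h2, h3, h4, h5⟩ := ih m1 hm1 (by omega)
    refine ⟨m0, hm0, by omega, by omega, by omega, by omega, ?_⟩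
    have h4 := (abs_le.1 (FF_lip (Sum.map lA lB) hlip m1.val s(Sum.inl a, Sum.inr b))).1
    rw [hv]
    push_cast
    linarith

/-- The interpolation, written as a maximum principle. -/
lemma walk (hadd : GraphParam.Additive f) {κ : ℝ} (hlip : GraphParam.Lipschitz f κ)
    (hconc : GraphParam.Concave f) (N n w : ℕ)
    (hN : Fintype.card P + Fintype.card Q ≤ 2 * N + 1)
    (hN' : 2 * N ≤ Fintype.card P + Fintype.card Q) (r lam C : ℝ) (hr : 1 ≤ r)
    (hw : 2 * r ≤ w) (hlam : 0 ≤ lam) (hC : 0 ≤ C) (hCn : 2 * n ≤ C * Real.exp (lam * r)) (k : ℕ) :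
    ∀ (m : Finset (Sym2 (P ⊕ Q))), k ≤ n →
    IsPairMatching m → (cr m).card = k → m.card + w = N →
    mE lA f + mE lB f ≤ FF (Sum.map lA lB) f m.val + κ * (w + 2 / r * k +
      2 * C * Real.cosh (lam * ((((pf m).card : ℝ) - (qf m).card) / 2)) * Real.cosh lam ^ k) := by
  have hκ := kappa_nonneg hlip
  induction k with
  | zero =>
    intro m hn hm hk hmw
    have h1 := triv lA lB hadd hlip N hN 0 m hm hk
    have h2 : (N : ℝ) = m.card + w := by exact_mod_cast hmw.symm
    refine h1.trans ?_
    rw [h2]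
    have := mul_nonneg (mul_nonneg zero_le_two hC)
      (Real.cosh_pos (lam * ((((pf m).card : ℝ) - (qf m).card) / 2))).le
    have := mul_nonneg hκ this
    simp only [Nat.cast_zero, pow_zero, mul_zero, mul_one]
    linarith
  | succ k ih =>
    intro m hn hm hk hmw
    set x : ℝ := (((pf m).card : ℝ) - (qf m).card) / 2 with hx
    have hNr : (N : ℝ) = m.card + w := by exact_mod_cast hmw.symm
    by_cases hxr : r ≤ |x|
    · have h1 := triv lA lB hadd hlip N hN (k + 1) m hm hk
      refine h1.trans ?_
      have h3 : (1 : ℝ) ≤ Real.cosh lam ^ (k + 1) := one_le_pow₀ (Real.one_le_cosh _)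
      have h4 : Real.exp (lam * r) ≤ 2 * Real.cosh (lam * x) := by
        rw [← Real.cosh_abs, abs_mul, abs_of_nonneg hlam, Real.cosh_eq]
        have : Real.exp (lam * r) ≤ Real.exp (lam * |x|) :=
          Real.exp_le_exp.2 (mul_le_mul_of_nonneg_left hxr hlam)
        have := Real.exp_pos (-(lam * |x|))
        linarith
      have h5 : 2 * (n : ℝ) ≤ 2 * C * Real.cosh (lam * x) * Real.cosh lam ^ (k + 1) := by
        have h6 : C * Real.exp (lam * r) ≤ C * (2 * Real.cosh (lam * x)) :=
          mul_le_mul_of_nonneg_left h4 hC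
        have h7 : C * (2 * Real.cosh (lam * x)) * 1 ≤
            C * (2 * Real.cosh (lam * x)) * Real.cosh lam ^ (k + 1) :=
          mul_le_mul_of_nonneg_left h3 (by have := Real.cosh_pos (lam * x); positivity)
        linarith
      have h8 : ((k + 1 : ℕ) : ℝ) ≤ n := by exact_mod_cast hn
      have h9 : 0 ≤ 2 / r * ((k + 1 : ℕ) : ℝ) := by positivity
      have := mul_le_mul_of_nonneg_left (show 2 * ((k + 1 : ℕ) : ℝ) + (N - (m.card : ℝ)) ≤
        w + 2 / r * ((k + 1 : ℕ) : ℝ) +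
          2 * C * Real.cosh (lam * x) * Real.cosh lam ^ (k + 1) by linarith) hκ
      linarith
    · rw [not_le] at hxr
      obtain ⟨m0, a, c, hm0, ha, hc, hv, hcard, hcr, hp, hq⟩ := remX m hm (by omega)
      have hpq := card_pq m hm
      have hp' : ((pf m0).card : ℝ) = (pf m).card + 1 := by exact_mod_cast hp.symm
      have hq' : ((qf m0).card : ℝ) = (qf m).card + 1 := by exact_mod_cast hq.symm
      have hsum : 2 * (w : ℝ) ≤ (pf m).card + (qf m).card := by
        have : 2 * w ≤ (pf m).card + (qf m).card := by omega
        exact_mod_cast this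
      obtain ⟨hx1, hx2⟩ := abs_lt.1 hxr
      have hpr : r + 1 ≤ (pf m0).card := by rw [hp']; linarith
      have hqr : r + 1 ≤ (qf m0).card := by rw [hq']; linarith
      have hp2 : 1 < (pf m0).card := by
        have : (1 : ℝ) < (pf m0).card := by linarith
        exact_mod_cast this
      have hq2 : 1 < (qf m0).card := by
        have : (1 : ℝ) < (qf m0).card := by linarith
        exact_mod_cast this
      obtain ⟨b, hb, hba⟩ := Finset.exists_mem_ne hp2 a
      obtain ⟨d, hd, hdc⟩ := Finset.exists_mem_ne hq2 c
      have hstep := FF_step (Sum.map lA lB) hlip hconc m0 ha hb hc hd hba.symm hdc.symm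
      obtain ⟨p1, p2, p3⟩ := insP m0 ha hb hba.symm
      obtain ⟨q1, q2, q3⟩ := insQ m0 hc hd hdc.symm
      have nA := not_mem_of_free (y := Sum.inl b) (mem_pf.1 ha)
      have nB := not_mem_of_free (y := Sum.inr d) (mem_qf.1 hc)
      have iA := ih (insert s(Sum.inl a, Sum.inl b) m0) (by omega)
        (matching_insert hm0 (by simpa using hba.symm) (mem_pf.1 ha) (mem_pf.1 hb))
        (by rw [p3]; omega) (by rw [Finset.card_insert_of_notMem nA]; omega)
      have iB := ih (insert s(Sum.inr c, Sum.inr d) m0) (by omega)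
        (matching_insert hm0 (by simpa using hdc.symm) (mem_qf.1 hc) (mem_qf.1 hd))
        (by rw [q3]; omega) (by rw [Finset.card_insert_of_notMem nB]; omega)
      rw [Finset.insert_val_of_notMem nA, p2] at iA
      rw [Finset.insert_val_of_notMem nB, q2] at iB
      have p1' : ((pf (insert s(Sum.inl a, Sum.inl b) m0)).card : ℝ) = (pf m).card - 1 := by
        have : ((pf (insert s(Sum.inl a, Sum.inl b) m0)).card : ℝ) + 2 = (pf m0).card := by
          exact_mod_cast p1
        linarith
      have q1' : ((qf (insert s(Sum.inr c, Sum.inr d) m0)).card : ℝ) = (qf m).card - 1 := by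
        have : ((qf (insert s(Sum.inr c, Sum.inr d) m0)).card : ℝ) + 2 = (qf m0).card := by
          exact_mod_cast q1
        linarith
      have xA : (((pf (insert s(Sum.inl a, Sum.inl b) m0)).card : ℝ) - (qf m0).card) / 2 = x - 1 := by
        rw [p1', hq', hx]; ring
      have xB : ((pf m0).card - ((qf (insert s(Sum.inr c, Sum.inr d) m0)).card : ℝ)) / 2 = x + 1 := by
        rw [q1', hp', hx]; ring
      rw [xA] at iA
      rw [xB] at iB
      rw [← hv] at hstep
      have herr : 1 / ((pf m0).card : ℝ) + 1 / ((qf m0).card : ℝ) ≤ 2 / r := by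
        have t1 : 1 / ((pf m0).card : ℝ) ≤ 1 / r :=
          one_div_le_one_div_of_le (by linarith) (by linarith)
        have t2 : 1 / ((qf m0).card : ℝ) ≤ 1 / r :=
          one_div_le_one_div_of_le (by linarith) (by linarith)
        have : 2 / r = 1 / r + 1 / r := by ring
        linarith
      have herr' := mul_le_mul_of_nonneg_left herr hκ
      have hcosh : Real.cosh (lam * (x - 1)) + Real.cosh (lam * (x + 1)) =
          2 * Real.cosh (lam * x) * Real.cosh lam := by
        rw [mul_sub, mul_add, mul_one, Real.cosh_sub, Real.cosh_add]; ring
      have hfin : 2 * C * Real.cosh (lam * (x - 1)) * Real.cosh lam ^ k +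
          2 * C * Real.cosh (lam * (x + 1)) * Real.cosh lam ^ k =
          2 * (2 * C * Real.cosh (lam * x) * Real.cosh lam ^ (k + 1)) := by
        rw [pow_succ]
        linear_combination (2 * C * Real.cosh lam ^ k) * hcosh
      have hfin' := congrArg (κ * ·) hfin
      push_cast
      linarith

lemma walk_main (hadd : GraphParam.Additive f) {κ : ℝ} (hlip : GraphParam.Lipschitz f κ)
    (hconc : GraphParam.Concave f) (w : ℕ) (m : Finset (Sym2 (P ⊕ Q))) (hm : IsMaximalMatching m)
    (hwn : w ≤ (cr m).card) (r lam C : ℝ) (hr : 1 ≤ r)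
    (hw : 2 * r ≤ w) (hlam : 0 ≤ lam) (hC : 0 ≤ C)
    (hCn : 2 * ((cr m).card : ℝ) ≤ C * Real.exp (lam * r)) :
    mE lA f + mE lB f ≤ FF (Sum.map lA lB) f m.val + κ * (2 * w + 2 / r * (cr m).card +
      2 * C * Real.exp (lam ^ 2 * (cr m).card / 2)) := by
  have hκ := kappa_nonneg hlip
  have h1 := maximal_free hm
  have h2 := freeSet_card m hm.1
  have hpq := card_pq m hm.1
  rw [Fintype.card_sum] at h2
  obtain ⟨m0, hm0, g1, g2, g3, g4, g5⟩ := remW lA lB hlip w m hm.1 hwn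
  have hW := walk lA lB hadd hlip hconc m.card (cr m).card w (by omega) (by omega) r lam C hr hw hlam
    hC hCn ((cr m).card - w) m0 (by omega) hm0 (by omega) (by omega)
  have hle : (pf m).card + (qf m).card ≤ 1 := by omega
  have hwpos : 1 ≤ w := by
    have : (1 : ℝ) ≤ w := by linarith
    exact_mod_cast this
  set x : ℝ := (((pf m0).card : ℝ) - (qf m0).card) / 2 with hx
  have hx2 : x ^ 2 ≤ 1 := by
    have e3 : ((pf m0).card : ℝ) = (pf m).card + w := by exact_mod_cast g3.symm
    have e4 : ((qf m0).card : ℝ) = (qf m).card + w := by exact_mod_cast g4.symm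
    have e5 : ((pf m).card : ℝ) + (qf m).card ≤ 1 := by exact_mod_cast hle
    have e6 : (0 : ℝ) ≤ (pf m).card := by positivity
    have e7 : (0 : ℝ) ≤ (qf m).card := by positivity
    rw [hx, e3, e4]
    rw [sq_le_one_iff_abs_le_one, abs_le]
    constructor <;> linarith
  have hc1 : Real.cosh (lam * x) ≤ Real.exp (lam ^ 2 / 2) := by
    refine (Real.cosh_le_exp_half_sq _).trans (Real.exp_le_exp.2 ?_)
    rw [mul_pow]
    nlinarith [sq_nonneg lam]
  have hc2 : Real.cosh lam ^ ((cr m).card - w) ≤ Real.exp (lam ^ 2 / 2) ^ ((cr m).card - w) :=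
    pow_le_pow_left₀ (Real.cosh_pos _).le (Real.cosh_le_exp_half_sq _) _
  have hc3 : Real.cosh (lam * x) * Real.cosh lam ^ ((cr m).card - w) ≤
      Real.exp (lam ^ 2 * (cr m).card / 2) := by
    calc _ ≤ Real.exp (lam ^ 2 / 2) * Real.exp (lam ^ 2 / 2) ^ ((cr m).card - w) :=
          mul_le_mul hc1 hc2 (pow_nonneg (Real.cosh_pos _).le _) (Real.exp_pos _).le
      _ = Real.exp (lam ^ 2 / 2) ^ ((cr m).card - w + 1) := by rw [pow_succ]; ring
      _ ≤ Real.exp (lam ^ 2 / 2) ^ ((cr m).card) :=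
          pow_le_pow_right₀ (Real.one_le_exp (by positivity)) (by omega)
      _ = _ := by rw [← Real.exp_nat_mul]; ring_nf
  have hc4 : ((((cr m).card - w : ℕ)) : ℝ) ≤ (cr m).card := by exact_mod_cast Nat.sub_le _ _
  have hc5 : 2 / r * ((((cr m).card - w : ℕ)) : ℝ) ≤ 2 / r * (cr m).card :=
    mul_le_mul_of_nonneg_left hc4 (by positivity)
  have hc6 := mul_le_mul_of_nonneg_left hc3 (show 0 ≤ 2 * C by positivity)
  have := mul_le_mul_of_nonneg_left (show (w : ℝ) + 2 / r * ((((cr m).card - w : ℕ)) : ℝ) +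
      2 * C * Real.cosh (lam * x) * Real.cosh lam ^ ((cr m).card - w) ≤
      w + 2 / r * (cr m).card + 2 * C * Real.exp (lam ^ 2 * (cr m).card / 2) by
    rw [mul_assoc (2 * C)]; linarith) hκ
  linarith

end three

/-! ### Numerical estimates -/

/-- The error function without its prefactor. -/
noncomputable def ph (x : ℝ) : ℝ := Real.sqrt (x * Real.log (1 + x))

lemma ph_mono {x y : ℝ} (hx : 0 ≤ x) (hxy : x ≤ y) : ph x ≤ ph y := by
  unfold ph
  apply Real.sqrt_le_sqrt
  have h1 : 0 ≤ Real.log (1 + x) := Real.log_nonneg (by linarith)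
  have h2 : Real.log (1 + x) ≤ Real.log (1 + y) := Real.log_le_log (by linarith) (by linarith)
  exact mul_le_mul hxy h2 h1 (hx.trans hxy)

lemma ph_small (n : ℕ) (hn : n < 32) : 2 * (n : ℝ) ≤ 7 * ph n := by
  have hn0 : (0 : ℝ) ≤ n := by positivity
  have hkey : 4 * (n : ℝ) ≤ 49 * Real.log (1 + n) := by
    by_cases h : n ≤ 22
    · have h1 : 2 * (n : ℝ) / (n + 2) ≤ Real.log (1 + n) := Real.le_log_one_add_of_nonneg hn0
      have h2 : (n : ℝ) ≤ 22 := by exact_mod_cast h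
      have h3 : 4 * (n : ℝ) ≤ 49 * (2 * n / (n + 2)) := by
        rw [← mul_div_assoc, le_div_iff₀ (by positivity)]
        nlinarith
      linarith
    · have h1 : (16 : ℝ) ≤ 1 + n := by
        have : 22 < n := not_le.1 h
        have : (22 : ℝ) < n := by exact_mod_cast this
        linarith
      have h2 : Real.log 16 ≤ Real.log (1 + n) := Real.log_le_log (by norm_num) h1
      have h3 : Real.log 16 = 4 * Real.log 2 := by
        rw [show (16 : ℝ) = 2 ^ (4 : ℕ) by norm_num, Real.log_pow]; norm_num
      have h4 := Real.log_two_gt_d9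
      have h5 : (n : ℝ) < 32 := by exact_mod_cast hn
      linarith
  have : 2 * (n : ℝ) / 7 ≤ ph n := by
    apply Real.le_sqrt_of_sq_le
    nlinarith
  linarith

lemma num_big (n : ℕ) (hn : 32 ≤ n) : ∃ (w : ℕ) (r lam C : ℝ), w ≤ n ∧ 1 ≤ r ∧ 2 * r ≤ w ∧
    0 ≤ lam ∧ 0 ≤ C ∧ 2 * (n : ℝ) ≤ C * Real.exp (lam * r) ∧
    2 * w + 2 / r * n + 2 * C * Real.exp (lam ^ 2 * n / 2) ≤ 7 * ph n := by
  have hnr : (32 : ℝ) ≤ n := by exact_mod_cast hn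
  have hn0 : (0 : ℝ) < n := by linarith
  set L := Real.log (1 + n) with hL
  have hl2 := Real.log_two_gt_d9
  have hl2' := Real.log_two_lt_d9
  have h32 : Real.log 32 = 5 * Real.log 2 := by
    rw [show (32 : ℝ) = 2 ^ (5 : ℕ) by norm_num, Real.log_pow]; norm_num
  have hLlow : 3.465 ≤ L := by
    have h2 : Real.log 32 ≤ L := Real.log_le_log (by norm_num) (by linarith)
    linarith
  have hLup : L ≤ 3.4658 + (n - 31) / 32 := by
    have h1 : Real.log ((1 + n) / 32) ≤ (1 + n) / 32 - 1 := Real.log_le_sub_one_of_pos (by positivity)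
    rw [Real.log_div (by positivity) (by norm_num)] at h1
    linarith
  set s := Real.sqrt n with hs
  set t := Real.sqrt L with ht
  have hs2 : s ^ 2 = n := Real.sq_sqrt hn0.le
  have ht2 : t ^ 2 = L := Real.sq_sqrt (by linarith)
  have hs5 : 5.6 ≤ s := Real.le_sqrt_of_sq_le (by linarith)
  have ht1 : 1.86 ≤ t := Real.le_sqrt_of_sq_le (by linarith)
  have hr : ph n = s * t := by unfold ph; rw [Real.sqrt_mul hn0.le]
  set r := s * t with hrdef
  have hr1 : 1 ≤ r := by rw [hrdef]; nlinarith
  have hr2 : r ^ 2 = n * L := by rw [hrdef, mul_pow, hs2, ht2]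
  have hexpL : Real.exp L = 1 + n := Real.exp_log (by linarith)
  refine ⟨⌈2 * r⌉₊, r, r / n, 2 * n / (1 + n), ?_, hr1, Nat.le_ceil _, by positivity,
    by positivity, ?_, ?_⟩
  · rw [Nat.ceil_le]
    have : (2 * r) ^ 2 ≤ (n : ℝ) ^ 2 := by
      rw [mul_pow, hr2]
      nlinarith
    exact le_of_sq_le_sq this hn0.le
  · have : r / n * r = L := by
      field_simp
      rw [hr2]
    rw [this, hexpL]
    apply le_of_eq
    field_simp
  · have hw : ((⌈2 * r⌉₊ : ℕ) : ℝ) ≤ 2 * r + 1 := (Nat.ceil_lt_add_one (by positivity)).le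
    have e1 : 2 / r * n = 2 * s / t := by
      rw [← hs2, hrdef]
      field_simp
    have e2 : 2 * s / t ≤ 2 * s / 1.86 := by
      apply div_le_div_of_nonneg_left (by positivity) (by norm_num) ht1
    have e3 : (r / n) ^ 2 * n / 2 = L / 2 := by
      rw [div_pow, hr2]
      field_simp
    have e4 : Real.exp (L / 2) ^ 2 = 1 + n := by
      rw [← Real.exp_nat_mul, ← hexpL]
      congr 1
      push_cast
      ring
    set u := Real.exp (L / 2) with hu
    have hu0 : 0 < u := Real.exp_pos _
    have hsu : s ≤ u := by
      apply le_of_sq_le_sq _ hu0.le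
      rw [hs2, e4]; linarith
    have e5 : 2 * (2 * n / (1 + n)) * u ≤ 4 * s := by
      rw [← e4, ← hs2]
      have : 2 * (2 * s ^ 2 / u ^ 2) * u = 4 * s * (s / u) := by
        field_simp
        ring
      rw [this]
      have : s / u ≤ 1 := (div_le_one hu0).2 hsu
      have h0 : 0 ≤ 4 * s := by positivity
      nlinarith
    rw [e1, e3, hr]
    have e6 : 1.86 * s ≤ r := by rw [hrdef]; nlinarith
    have e7 : 2 * s / 1.86 ≤ 1.0755 * s := by
      rw [div_le_iff₀ (by norm_num)]; linarith
    linarith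

lemma ph_tangent (M : ℝ) (hM : 0 ≤ M) : ∃ c0 c1 : ℝ, (∀ x, 0 ≤ x → ph x ≤ c0 + c1 * x) ∧
    c0 + c1 * M = ph M := by
  rcases hM.eq_or_lt with rfl | hM
  · refine ⟨0, 1, fun x hx => ?_, by simp [ph]⟩
    have h1 : Real.log (1 + x) ≤ x := by
      have := Real.log_le_sub_one_of_pos (show 0 < 1 + x by linarith)
      linarith
    unfold ph
    rw [Real.sqrt_le_left (by linarith)]
    nlinarith
  · have hL : 0 < Real.log (1 + M) := Real.log_pos (by linarith)
    set s := Real.sqrt M with hs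
    set l := Real.sqrt (Real.log (1 + M)) with hl
    have hs0 : 0 < s := Real.sqrt_pos.2 hM
    have hl0 : 0 < l := Real.sqrt_pos.2 hL
    have hs2 : s ^ 2 = M := Real.sq_sqrt hM.le
    have hl2 : l ^ 2 = Real.log (1 + M) := Real.sq_sqrt hL.le
    have hph : ph M = s * l := by unfold ph; rw [Real.sqrt_mul hM.le]
    refine ⟨(l ^ 2 - M / (1 + M)) * s / (2 * l), l / (2 * s) + s / (2 * l * (1 + M)), ?_, ?_⟩
    · intro x hx
      have h1 : Real.log (1 + x) ≤ l ^ 2 + (x - M) / (1 + M) := by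
        have := Real.log_le_sub_one_of_pos (show 0 < (1 + x) / (1 + M) by positivity)
        rw [Real.log_div (by positivity) (by positivity)] at this
        have h3 : (1 + x) / (1 + M) - 1 = (x - M) / (1 + M) := by field_simp; ring
        rw [hl2]; linarith
      set Y := Real.log (1 + x) with hY
      have hY0 : 0 ≤ Y := Real.log_nonneg (by linarith)
      have h2 : ph x ≤ x * l / (2 * s) + Y * s / (2 * l) := by
        unfold ph
        rw [Real.sqrt_le_left (by positivity)]
        have : (x * l / (2 * s) + Y * s / (2 * l)) ^ 2 - x * Y =
            (x * l / (2 * s) - Y * s / (2 * l)) ^ 2 := by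
          field_simp
          ring
        nlinarith [sq_nonneg (x * l / (2 * s) - Y * s / (2 * l))]
      have h3 : Y * s / (2 * l) ≤ (l ^ 2 + (x - M) / (1 + M)) * s / (2 * l) := by gcongr
      refine (h2.trans (add_le_add_right h3 _)).trans (le_of_eq ?_)
      field_simp
      ring
    · rw [hph]
      have : (0 : ℝ) < 1 + M := by linarith
      rw [← hs2] at this ⊢
      field_simp
      ring

section four
variable {P Q : Type} [Fintype P] [Fintype Q]
variable {VA VB : Type} [Fintype VA] [Fintype VB] (lA : P → VA) (lB : Q → VB)
  {f : Multigraph → ℝ}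

lemma core_m (hadd : GraphParam.Additive f) {κ : ℝ} (hlip : GraphParam.Lipschitz f κ)
    (hconc : GraphParam.Concave f) (m : Finset (Sym2 (P ⊕ Q))) (hm : IsMaximalMatching m) :
    mE lA f + mE lB f ≤ FF (Sum.map lA lB) f m.val +
      7 * κ * ph (((Fintype.card P : ℝ) + Fintype.card Q) / 2) := by
  have hκ := kappa_nonneg hlip
  have hfree := maximal_free hm
  have hfc := freeSet_card m hm.1
  rw [Fintype.card_sum] at hfc
  have hcm : (cr m).card ≤ m.card := Finset.card_le_card (Finset.filter_subset _ _)
  have hle : ((cr m).card : ℝ) ≤ ((Fintype.card P : ℝ) + Fintype.card Q) / 2 := by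
    have : 2 * (cr m).card ≤ Fintype.card P + Fintype.card Q := by omega
    have : 2 * ((cr m).card : ℝ) ≤ Fintype.card P + Fintype.card Q := by exact_mod_cast this
    linarith
  have hmono := mul_le_mul_of_nonneg_left (ph_mono (by positivity) hle)
    (show 0 ≤ 7 * κ by positivity)
  suffices h : mE lA f + mE lB f ≤ FF (Sum.map lA lB) f m.val + κ * (7 * ph ((cr m).card)) by
    linarith
  by_cases hn : (cr m).card < 32
  · have h1 := triv lA lB hadd hlip m.card (by omega) _ m hm.1 rfl
    have h2 := mul_le_mul_of_nonneg_left (ph_small _ hn) hκ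
    have h3 : κ * (2 * ((cr m).card : ℝ) + ((m.card : ℝ) - m.card)) = κ * (2 * ((cr m).card : ℝ)) := by
      ring
    linarith
  · obtain ⟨w, r, lam, C, h1, h2, h3, h4, h5, h6, h7⟩ := num_big _ (not_lt.1 hn)
    have h8 := walk_main lA lB hadd hlip hconc w m hm h1 r lam C h2 h3 h4 h5 h6
    have h9 := mul_le_mul_of_nonneg_left h7 hκ
    linarith

lemma core (hadd : GraphParam.Additive f) {κ : ℝ} (hlip : GraphParam.Lipschitz f κ)
    (hconc : GraphParam.Concave f) :
    mE lA f + mE lB f ≤ mE (Sum.map lA lB) f +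
      7 * κ * ph (((Fintype.card P : ℝ) + Fintype.card Q) / 2) := by
  set R := 7 * κ * ph (((Fintype.card P : ℝ) + Fintype.card Q) / 2) with hR
  have h4 : (0 : ℝ) < (MM (P ⊕ Q)).card := by exact_mod_cast MM_card_pos (P ⊕ Q)
  have h1 : ∑ m ∈ MM (P ⊕ Q), FF (Sum.map lA lB) f m.val =
      ∑ m ∈ MM (P ⊕ Q), f (gr (Sum.map lA lB) m.val) := by
    unfold FF
    rw [← Finset.sum_div, Finset.sum_comm, div_eq_iff (card_pos' P Q).ne']
    rw [Finset.sum_congr rfl (g := fun _ => ∑ m ∈ MM (P ⊕ Q), f (gr (Sum.map lA lB) m.val))]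
    · simp [mul_comm]
    · intro g _
      rw [← sum_MM_equiv (Equiv.sumCongr g.1 g.2) (fun m => f (gr (Sum.map lA lB) m.val))]
      refine Finset.sum_congr rfl fun m _ => ?_
      rw [mapM_val, gr_map]
      rfl
  have h2 := Finset.card_nsmul_le_sum (MM (P ⊕ Q)) (fun m => FF (Sum.map lA lB) f m.val)
    (mE lA f + mE lB f - R) (fun m hm => by
      have := core_m lA lB hadd hlip hconc m (MM_mem.1 hm)
      linarith)
  rw [h1, nsmul_eq_mul] at h2
  have : mE lA f + mE lB f - R ≤ mE (Sum.map lA lB) f := by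
    unfold mE
    rw [le_div_iff₀ h4]
    unfold mE at h2
    linarith
  linarith

end four

lemma core_config {f : Multigraph → ℝ} (hinv : GraphParam.Invariant f)
    (hadd : GraphParam.Additive f) {κ : ℝ} (hlip : GraphParam.Lipschitz f κ)
    (hconc : GraphParam.Concave f) (a b : ℕ) (D : Fin a → ℕ) (D' : Fin b → ℕ) :
    configExpect (Fin a) D f + configExpect (Fin b) D' f ≤
      configExpect (Fin (a + b)) (Fin.append D D') f +
        7 * κ * ph (((∑ i, (D i : ℝ)) + ∑ i, (D' i : ℝ)) / 2) := by
  rw [configExpect_eq, configExpect_eq, configExpect_eq]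
  have h := core (P := HalfEdge (Fin a) D) (Q := HalfEdge (Fin b) D') Sigma.fst Sigma.fst
    hadd hlip hconc
  have hc : ∀ (n : ℕ) (d : Fin n → ℕ), (Fintype.card (HalfEdge (Fin n) d) : ℝ) = ∑ i, (d i : ℝ) := by
    intro n d
    simp
  rw [hc, hc] at h
  refine h.trans (le_of_eq ?_)
  congr 1
  let e1 : HalfEdge (Fin a) D ⊕ HalfEdge (Fin b) D' ≃
      Σ i : Fin a ⊕ Fin b, Fin (Sum.elim D D' i) := (Equiv.sumSigmaDistrib (fun i : Fin a ⊕ Fin b => Fin (Sum.elim D D' i))).symm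
  let e2 : (Σ i : Fin a ⊕ Fin b, Fin (Sum.elim D D' i)) ≃
      HalfEdge (Fin (a + b)) (Fin.append D D') :=
    Equiv.sigmaCongr finSumFinEquiv (fun i => finCongr (by
      rcases i with i | i <;> simp))
  refine mE_equiv hinv _ _ (e1.trans e2) finSumFinEquiv ?_
  rintro (⟨i, x⟩ | ⟨i, x⟩)
  · rfl
  · rfl

/-! ### Integration over i.i.d. degrees -/

lemma hasSum_pi_prod : ∀ (n : ℕ) (g : Fin n → ℕ → ℝ) (s : Fin n → ℝ),
    (∀ i k, 0 ≤ g i k) → (∀ i, HasSum (g i) (s i)) →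
    HasSum (fun D : Fin n → ℕ => ∏ i, g i (D i)) (∏ i, s i)
  | 0, g, s, _, _ => by
    have := hasSum_unique (fun D : Fin 0 → ℕ => ∏ i, g i (D i))
    simpa using this
  | n + 1, g, s, h0, hs => by
    have ih := hasSum_pi_prod n (fun i => g i.succ) (fun i => s i.succ)
      (fun i k => h0 _ _) (fun i => hs _)
    have hsm := (hs 0).summable.mul_of_nonneg ih.summable (fun k => h0 0 k)
      (fun D => Finset.prod_nonneg fun i _ => h0 _ _)
    have h := (hs 0).mul ih hsm
    rw [Fin.prod_univ_succ]
    rw [← (Fin.consEquiv (fun _ : Fin (n + 1) => ℕ)).hasSum_iff]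
    have heq : (fun D : Fin (n + 1) → ℕ => ∏ i, g i (D i)) ∘
        (Fin.consEquiv (fun _ : Fin (n + 1) => ℕ)) =
        fun x : ℕ × (Fin n → ℕ) => g 0 x.1 * ∏ i, g i.succ (x.2 i) := by
      funext x
      simp [Fin.prod_univ_succ, Fin.consEquiv]
    rw [heq]
    exact h

lemma hasSum_weight {μ : ℕ → ℝ} (hμ0 : ∀ k, 0 ≤ μ k) (hμ1 : HasSum μ 1) (n : ℕ) :
    HasSum (fun D : Fin n → ℕ => ∏ i, μ (D i)) 1 := by
  simpa using hasSum_pi_prod n (fun _ => μ) (fun _ => 1) (fun _ => hμ0) (fun _ => hμ1)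

lemma hasSum_mean {μ : ℕ → ℝ} {M : ℝ} (hμ0 : ∀ k, 0 ≤ μ k) (hμ1 : HasSum μ 1)
    (hM : HasSum (fun k : ℕ => (k : ℝ) * μ k) M) (n : ℕ) :
    HasSum (fun D : Fin n → ℕ => (∏ i, μ (D i)) * ∑ j, (D j : ℝ)) (n * M) := by
  have h : ∀ j : Fin n, HasSum (fun D : Fin n → ℕ => (∏ i, μ (D i)) * (D j : ℝ)) M := by
    intro j
    have h1 := hasSum_pi_prod n (fun i k => (if i = j then (k : ℝ) else 1) * μ k)
      (fun i => if i = j then M else 1)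
      (fun i k => mul_nonneg (by split_ifs <;> positivity) (hμ0 k))
      (fun i => by
        by_cases hij : i = j
        · simpa [hij] using hM
        · simpa [hij] using hμ1)
    convert h1 using 1
    · funext D
      rw [Finset.prod_mul_distrib, mul_comm]
      simp
    · simp
  have h2 := hasSum_sum (s := Finset.univ) (fun j _ => h j)
  convert h2 using 1
  · funext D
    rw [Finset.mul_sum]
  · simp

lemma gr_bound {f : Multigraph → ℝ} {κ : ℝ} (hlip : GraphParam.Lipschitz f κ) {H V : Type}
    [Fintype V] (l : H → V) (E : Multiset (Sym2 H)) :
    |f (gr l E) - f (gr l 0)| ≤ κ * E.card := by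
  induction E using Multiset.induction_on with
  | empty => simp
  | cons e E ih =>
    induction e with
    | _ x y =>
      rw [gr_cons]
      have h1 := hlip (gr l E) (l x) (l y)
      have h2 := abs_sub_le (f ((gr l E).addEdge (l x) (l y))) (f (gr l E)) (f (gr l 0))
      rw [Multiset.card_cons]
      push_cast
      linarith

lemma config_bound {f : Multigraph → ℝ} {κ : ℝ} (hlip : GraphParam.Lipschitz f κ) (n : ℕ) :
    ∃ C : ℝ, 0 ≤ C ∧ ∀ D : Fin n → ℕ, |configExpect (Fin n) D f| ≤ C + κ * ∑ i, (D i : ℝ) := by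
  refine ⟨|f { V := Fin n, edges := 0 }|, abs_nonneg _, fun D => ?_⟩
  have hκ := kappa_nonneg hlip
  have hS : (0 : ℝ) ≤ ∑ i, (D i : ℝ) := Finset.sum_nonneg fun i _ => by positivity
  set B := |f { V := Fin n, edges := 0 }| + κ * ∑ i, (D i : ℝ) with hB
  have hB0 : 0 ≤ B := by positivity
  have hm : ∀ m ∈ maximalMatchings (Fin n) D, |f (matchingGraph (Fin n) D m)| ≤ B := by
    intro m hm
    have hmm : IsPairMatching m := by
      have : IsMaximalMatching m := by simpa [maximalMatchings] using hm
      exact this.1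
    have hc := freeSet_card m hmm
    have hcard : (Fintype.card (HalfEdge (Fin n) D) : ℝ) = ∑ i, (D i : ℝ) := by simp
    have hle : (m.card : ℝ) ≤ ∑ i, (D i : ℝ) := by
      rw [← hcard]
      exact_mod_cast (by omega : m.card ≤ Fintype.card (HalfEdge (Fin n) D))
    have h1 := gr_bound hlip (Sigma.fst : HalfEdge (Fin n) D → Fin n) m.val
    have e1 : gr (Sigma.fst : HalfEdge (Fin n) D → Fin n) m.val = matchingGraph (Fin n) D m := rfl
    have e2 : gr (Sigma.fst : HalfEdge (Fin n) D → Fin n) 0 =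
        { V := Fin n, edges := 0 } := rfl
    rw [e1, e2] at h1
    have h2 := abs_sub_abs_le_abs_sub (f (matchingGraph (Fin n) D m)) (f { V := Fin n, edges := 0 })
    have h3 : κ * (Multiset.card m.val : ℝ) ≤ κ * ∑ i, (D i : ℝ) :=
      mul_le_mul_of_nonneg_left hle hκ
    linarith
  unfold configExpect
  rw [abs_div, Nat.abs_cast]
  refine div_le_of_le_mul₀ (by positivity) hB0 ?_
  refine (Finset.abs_sum_le_sum_abs _ _).trans ?_
  refine (Finset.sum_le_card_nsmul _ _ B hm).trans (le_of_eq ?_)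
  rw [nsmul_eq_mul, mul_comm]

lemma summable_config {f : Multigraph → ℝ} {κ : ℝ} (hlip : GraphParam.Lipschitz f κ)
    {μ : ℕ → ℝ} {M : ℝ} (hμ0 : ∀ k, 0 ≤ μ k) (hμ1 : HasSum μ 1)
    (hM : HasSum (fun k : ℕ => (k : ℝ) * μ k) M) (n : ℕ) :
    Summable (fun D : Fin n → ℕ => (∏ i, μ (D i)) * configExpect (Fin n) D f) := by
  obtain ⟨C, hC, hb⟩ := config_bound hlip n
  have h1 := ((hasSum_weight hμ0 hμ1 n).mul_left C).add ((hasSum_mean hμ0 hμ1 hM n).mul_left κ)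
  refine Summable.of_norm_bounded h1.summable fun D => ?_
  have hw : 0 ≤ ∏ i, μ (D i) := Finset.prod_nonneg fun i _ => hμ0 _
  rw [Real.norm_eq_abs, abs_mul, abs_of_nonneg hw]
  have := mul_le_mul_of_nonneg_left (hb D) hw
  linarith

/-- products of absolutely summable families over real numbers -/
lemma hasSum_mul_real {ι ι' : Type} {u : ι → ℝ} {v : ι' → ℝ} {s t : ℝ}
    (hu : HasSum u s) (hv : HasSum v t) :
    HasSum (fun x : ι × ι' => u x.1 * v x.2) (s * t) :=
  hu.mul hv (summable_mul_of_summable_norm hu.summable.norm hv.summable.norm)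

lemma main_ab {f : Multigraph → ℝ} {κ : ℝ}
    (hinv : GraphParam.Invariant f) (hadd : GraphParam.Additive f)
    (hlip : GraphParam.Lipschitz f κ) (hconc : GraphParam.Concave f)
    {μ : ℕ → ℝ} {M : ℝ} (hμ0 : ∀ k, 0 ≤ μ k) (hμ1 : HasSum μ 1)
    (hM : HasSum (fun k : ℕ => (k : ℝ) * μ k) M) (a b : ℕ) :
    iidExpect μ a f + iidExpect μ b f ≤
      iidExpect μ (a + b) f + 7 * κ * ph (M / 2 * ((a : ℝ) + b)) := by
  have hκ := kappa_nonneg hlip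
  have hM0 : 0 ≤ M := hM.nonneg fun k => mul_nonneg (by positivity) (hμ0 k)
  obtain ⟨c0, c1, hc, hcM⟩ := ph_tangent (M / 2 * ((a : ℝ) + b)) (by positivity)
  have sa := (summable_config hlip hμ0 hμ1 hM a).hasSum
  have sb := (summable_config hlip hμ0 hμ1 hM b).hasSum
  have sab := (summable_config hlip hμ0 hμ1 hM (a + b)).hasSum
  have wa := hasSum_weight hμ0 hμ1 a
  have wb := hasSum_weight hμ0 hμ1 b
  have ma := hasSum_mean hμ0 hμ1 hM a
  have mb := hasSum_mean hμ0 hμ1 hM b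
  have L := (hasSum_mul_real sa wb).add (hasSum_mul_real wa sb)
  rw [← (Fin.appendEquiv a b).hasSum_iff] at sab
  have X := (((hasSum_mul_real wa wb).mul_left c0).add
    (((hasSum_mul_real ma wb).add (hasSum_mul_real wa mb)).mul_left (c1 / 2))).mul_left (7 * κ)
  have key := hasSum_le (fun x : (Fin a → ℕ) × (Fin b → ℕ) => ?_) L (sab.add X)
  · unfold iidExpect
    have e : c0 * (1 * 1) + c1 / 2 * ((a : ℝ) * M * 1 + 1 * ((b : ℝ) * M)) =
        ph (M / 2 * ((a : ℝ) + b)) := by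
      rw [← hcM]; ring
    rw [e] at key
    linarith
  · obtain ⟨D, D'⟩ := x
    have hcc := core_config hinv hadd hlip hconc a b D D'
    have h0 : 0 ≤ ((∑ i, (D i : ℝ)) + ∑ i, (D' i : ℝ)) / 2 := by positivity
    have h1 := mul_le_mul_of_nonneg_left (hc _ h0) (by positivity : 0 ≤ 7 * κ)
    have hw1 : 0 ≤ ∏ i, μ (D i) := Finset.prod_nonneg fun i _ => hμ0 _
    have hw2 : 0 ≤ ∏ i, μ (D' i) := Finset.prod_nonneg fun i _ => hμ0 _
    have h2 := mul_le_mul_of_nonneg_left (hcc.trans (add_le_add_right h1 _)) (mul_nonneg hw1 hw2)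
    have hw : ∏ i, μ (Fin.append D D' i) = (∏ i, μ (D i)) * ∏ i, μ (D' i) := by
      rw [Fin.prod_univ_add]; simp
    simp only [Function.comp, Fin.appendEquiv, Equiv.coe_fn_mk]
    rw [hw]
    refine le_trans (le_of_eq ?_) (h2.trans (le_of_eq ?_)) <;> ring
end S9

theorem statement9 (f : Multigraph → ℝ) (κ : ℝ)
    (hinv : GraphParam.Invariant f) (hadd : GraphParam.Additive f)
    (hlip : GraphParam.Lipschitz f κ) (hconc : GraphParam.Concave f)
    (μ : ℕ → ℝ) (hμ0 : ∀ k, 0 ≤ μ k) (hμ1 : HasSum μ 1)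
    (hμmean : Summable fun k : ℕ => (k : ℝ) * μ k)
    (W : Type) [DecidableEq W] (A B : Finset W) (hAB : Disjoint A B) :
    iidExpect μ A.card f + iidExpect μ B.card f ≤
      iidExpect μ (A.card + B.card) f +
        7 * κ * Real.sqrt
          ((((∑' k : ℕ, (k : ℝ) * μ k) / 2) * ((A.card : ℝ) + (B.card : ℝ))) *
            Real.log (1 + ((∑' k : ℕ, (k : ℝ) * μ k) / 2) * ((A.card : ℝ) + (B.card : ℝ)))) := by

  exact S9.main_ab hinv hadd hlip hconc hμ0 hμ1 hμmean.hasSum A.card B.card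
end

section
/- Let 𝔣 be an additive, κ-Lipschitz, concave graph parameter and let μ be a probability measure on ℕ with finite mean. Then the limit Ψ(μ) := lim_{n→∞} E[𝔣(𝔾^iid_{μ,n})]/n exists and is a finite real number. -/
open Finset Filter Topology MeasureTheory
open scoped Classical BigOperators ENNReal

namespace Interp

noncomputable section

variable {α : Type} [Fintype α]

/-- number of left half-edges in a pair -/
def ty (l : α → Bool) : Sym2 α → ℕ :=
  Sym2.lift ⟨fun x y => (l x).toNat + (l y).toNat, fun _ _ => Nat.add_comm _ _⟩

@[simp] lemma ty_mk (l : α → Bool) (x y : α) : ty l s(x, y) = (l x).toNat + (l y).toNat := rfl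

/-- number of edges of a given type -/
def cnt (l : α → Bool) (m : Finset (Sym2 α)) (t : ℕ) : ℕ := (m.filter fun p => ty l p = t).card

/-- matchings with prescribed type counts -/
def MM (l : α → Bool) (T : ℕ → ℕ) : Finset (Finset (Sym2 α)) :=
  univ.filter fun m => IsPairMatching m ∧ ∀ t, cnt l m t = T t

/-- unmatched half-edges -/
def unm (m : Finset (Sym2 α)) : Finset α := univ.filter fun h => ∀ p ∈ m, h ∉ p

/-- ordered pairs of unmatched half-edges of given sides -/
def OP (l : α → Bool) (i j : Bool) (m : Finset (Sym2 α)) : Finset (α × α) :=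
  univ.filter fun q => q.1 ≠ q.2 ∧ q.1 ∈ unm m ∧ q.2 ∈ unm m ∧ l q.1 = i ∧ l q.2 = j

lemma mem_unm {m : Finset (Sym2 α)} {h : α} : h ∈ unm m ↔ ∀ p ∈ m, h ∉ p := by
  simp [unm]

lemma insert_notMem {m : Finset (Sym2 α)} {x y : α} (hx : x ∈ unm m) : s(x, y) ∉ m := by
  intro h
  exact mem_unm.1 hx _ h (by simp)

lemma pm_insert {m : Finset (Sym2 α)} (hm : IsPairMatching m) {x y : α} (hxy : x ≠ y)
    (hx : x ∈ unm m) (hy : y ∈ unm m) : IsPairMatching (insert s(x, y) m) := by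
  rw [mem_unm] at hx hy
  refine ⟨?_, ?_⟩
  · intro p hp
    rcases Finset.mem_insert.1 hp with rfl | hp
    · simpa using hxy
    · exact hm.1 p hp
  · intro p hp q hq hpq h hhp hhq
    rcases Finset.mem_insert.1 hp with rfl | hp' <;> rcases Finset.mem_insert.1 hq with rfl | hq'
    · exact hpq rfl
    · rcases Sym2.mem_iff.1 hhp with rfl | rfl
      · exact hx q hq' hhq
      · exact hy q hq' hhq
    · rcases Sym2.mem_iff.1 hhq with rfl | rfl
      · exact hx p hp' hhp
      · exact hy p hp' hhp
    · exact hm.2 p hp' q hq' hpq h hhp hhq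

lemma pm_subset {m m' : Finset (Sym2 α)} (hm : IsPairMatching m) (h : m' ⊆ m) :
    IsPairMatching m' :=
  ⟨fun p hp => hm.1 p (h hp), fun p hp q hq => hm.2 p (h hp) q (h hq)⟩

lemma unm_erase {m : Finset (Sym2 α)} (hm : IsPairMatching m) {p : Sym2 α} (hp : p ∈ m)
    {x : α} (hx : x ∈ p) : x ∈ unm (m.erase p) := by
  rw [mem_unm]
  intro q hq
  rw [Finset.mem_erase] at hq
  exact hm.2 p hp q hq.2 (Ne.symm hq.1) x hx

lemma cnt_insert (l : α → Bool) {m : Finset (Sym2 α)} {p : Sym2 α} (hp : p ∉ m) (t : ℕ) :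
    cnt l (insert p m) t = cnt l m t + if t = ty l p then 1 else 0 := by
  unfold cnt
  rw [Finset.filter_insert]
  split_ifs with h1 h2 h2
  · rw [Finset.card_insert_of_notMem (by simp [hp])]
  · exact absurd h1.symm h2
  · exact absurd h2.symm h1
  · simp

lemma cnt_erase (l : α → Bool) {m : Finset (Sym2 α)} {p : Sym2 α} (hp : p ∈ m) (t : ℕ) :
    cnt l m t = cnt l (m.erase p) t + if t = ty l p then 1 else 0 := by
  conv_lhs => rw [← Finset.insert_erase hp]
  exact cnt_insert l (Finset.notMem_erase p m) t

lemma card_ordered (l : α → Bool) (i j : Bool) {m : Finset (Sym2 α)} (hm : IsPairMatching m) :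
    (univ.filter fun q : α × α => s(q.1, q.2) ∈ m ∧ l q.1 = i ∧ l q.2 = j).card
      = (if i = j then 2 else 1) * cnt l m (i.toNat + j.toNat) := by
  unfold cnt
  rw [Finset.card_eq_sum_card_fiberwise (f := fun q : α × α => s(q.1, q.2))
    (t := m.filter fun p => ty l p = i.toNat + j.toNat)]
  · rw [Finset.sum_const_nat (m := if i = j then 2 else 1), mul_comm]
    intro p hp
    rw [Finset.mem_filter] at hp
    obtain ⟨hp, ht⟩ := hp
    induction p using Sym2.ind with
    | _ x y =>
    have hne : x ≠ y := by simpa using hm.1 _ hp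
    rw [ty_mk] at ht
    have key : ∀ q : α × α, s(q.1, q.2) = s(x, y) ↔ q = (x, y) ∨ q = (y, x) := by
      rintro ⟨a, b⟩; simp [Prod.ext_iff]
    by_cases hij : i = j
    · subst hij
      have hx : l x = i ∧ l y = i := by
        revert ht; cases l x <;> cases l y <;> cases i <;> simp
      rw [if_pos rfl, ← Finset.card_pair (a := (x, y)) (b := (y, x)) (by simp [hne])]
      congr 1
      ext q
      simp only [Finset.mem_filter, Finset.mem_univ, true_and, key, Finset.mem_insert,
        Finset.mem_singleton]
      constructor
      · exact fun h => h.2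
      · rintro (rfl | rfl)
        · exact ⟨⟨hp, hx⟩, Or.inl rfl⟩
        · exact ⟨⟨by rw [Sym2.eq_swap]; exact hp, hx.2, hx.1⟩, Or.inr rfl⟩
    · rw [if_neg hij]
      have hx : (l x = i ∧ l y = j) ∨ (l y = i ∧ l x = j) := by
        revert ht hij; cases l x <;> cases l y <;> cases i <;> cases j <;> simp
      rw [Finset.card_eq_one]
      rcases hx with hx | hx
      · refine ⟨(x, y), ?_⟩
        ext q
        simp only [Finset.mem_filter, Finset.mem_univ, true_and, key, Finset.mem_singleton]
        constructor
        · rintro ⟨⟨_, h1, h2⟩, (rfl | rfl)⟩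
          · rfl
          · exfalso; apply hij; simp only at h1 h2; rw [← hx.1, h2]
        · rintro rfl
          exact ⟨⟨hp, hx⟩, Or.inl rfl⟩
      · refine ⟨(y, x), ?_⟩
        ext q
        simp only [Finset.mem_filter, Finset.mem_univ, true_and, key, Finset.mem_singleton]
        constructor
        · rintro ⟨⟨_, h1, h2⟩, (rfl | rfl)⟩
          · exfalso; apply hij; simp only at h1 h2; rw [← hx.1, h2]
          · rfl
        · rintro rfl
          exact ⟨⟨by rw [Sym2.eq_swap]; exact hp, hx⟩, Or.inr rfl⟩
  · intro q hq
    simp only [Finset.coe_filter, Set.mem_ofPred_eq, Finset.mem_univ, true_and] at hq ⊢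
    exact ⟨hq.1, by rw [ty_mk, hq.2.1, hq.2.2]⟩

/-- double counting of extensions of a matching by one edge -/
lemma sum_ext (l : α → Bool) (i j : Bool) (T : ℕ → ℕ) (g : Finset (Sym2 α) → ℝ) :
    (((if i = j then 2 else 1) * (T (i.toNat + j.toNat) + 1) : ℕ) : ℝ) *
      ∑ m ∈ MM l (fun t => T t + if t = i.toNat + j.toNat then 1 else 0), g m
    = ∑ m ∈ MM l T, ∑ q ∈ OP l i j m, g (insert s(q.1, q.2) m) := by
  have h1 : ∀ m ∈ MM l (fun t => T t + if t = i.toNat + j.toNat then 1 else 0),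
      (((if i = j then 2 else 1) * (T (i.toNat + j.toNat) + 1) : ℕ) : ℝ) * g m
      = ∑ q ∈ (univ.filter fun q : α × α => s(q.1, q.2) ∈ m ∧ l q.1 = i ∧ l q.2 = j), g m := by
    intro m hm
    simp only [MM, Finset.mem_filter, Finset.mem_univ, true_and] at hm
    rw [Finset.sum_const, card_ordered l i j hm.1, hm.2]
    simp
  rw [Finset.mul_sum, Finset.sum_congr rfl h1, Finset.sum_sigma', Finset.sum_sigma']
  refine Finset.sum_bij' (fun a _ => ⟨a.1.erase s(a.2.1, a.2.2), a.2⟩)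
    (fun a _ => ⟨insert s(a.2.1, a.2.2) a.1, a.2⟩) ?_ ?_ ?_ ?_ ?_
  · rintro ⟨m, x, y⟩ h
    simp only [MM, OP, Finset.mem_sigma, Finset.mem_filter, Finset.mem_univ, true_and] at h ⊢
    obtain ⟨⟨hm, hT⟩, hp, hi, hj⟩ := h
    refine ⟨⟨pm_subset hm (Finset.erase_subset _ _), ?_⟩, ?_, ?_, ?_, hi, hj⟩
    · intro t
      have := cnt_erase l hp t
      rw [hT, ty_mk, hi, hj] at this
      omega
    · simpa using hm.1 _ hp
    · exact unm_erase hm hp (by simp)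
    · exact unm_erase hm hp (by simp)
  · rintro ⟨m, x, y⟩ h
    simp only [MM, OP, Finset.mem_sigma, Finset.mem_filter, Finset.mem_univ, true_and] at h ⊢
    obtain ⟨⟨hm, hT⟩, hne, hx, hy, hi, hj⟩ := h
    refine ⟨⟨pm_insert hm hne hx hy, ?_⟩, by simp, hi, hj⟩
    intro t
    rw [cnt_insert l (insert_notMem hx) t, hT, ty_mk, hi, hj]
  · rintro ⟨m, x, y⟩ h
    simp only [Finset.mem_sigma, Finset.mem_filter, Finset.mem_univ, true_and] at h
    simp [Finset.insert_erase h.2.1]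
  · rintro ⟨m, x, y⟩ h
    simp only [OP, Finset.mem_sigma, Finset.mem_filter, Finset.mem_univ, true_and] at h
    simp [Finset.erase_insert (insert_notMem h.2.2.1)]
  · rintro ⟨m, x, y⟩ h
    simp only [Finset.mem_sigma, Finset.mem_filter, Finset.mem_univ, true_and] at h
    simp [Finset.insert_erase h.2.1]

lemma sum_unm {m : Finset (Sym2 α)} (hm : IsPairMatching m) (w : α → ℕ) (W : Sym2 α → ℕ)
    (hW : ∀ x y, W s(x, y) = w x + w y) :
    ∑ h ∈ unm m, w h + ∑ p ∈ m, W p = ∑ h, w h := by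
  have h1 : ∑ p ∈ m, W p = ∑ h ∈ m.biUnion Sym2.toFinset, w h := by
    rw [Finset.sum_biUnion]
    · refine Finset.sum_congr rfl fun p hp => ?_
      have := hm.1 p hp
      induction p using Sym2.ind with
      | _ x y =>
      rw [Sym2.toFinset_mk_eq, Finset.sum_pair (by simpa using this), hW]
    · intro p hp q hq hpq
      rw [Function.onFun, Finset.disjoint_left]
      intro h hhp hhq
      exact hm.2 p hp q hq hpq h (Sym2.mem_toFinset.1 hhp) (Sym2.mem_toFinset.1 hhq)
  have h2 : unm m = univ \ m.biUnion Sym2.toFinset := by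
    ext h; simp [mem_unm]
  rw [h1, h2, Finset.sum_sdiff (Finset.subset_univ _)]

/-- number of half-edges on a side -/
def NS (l : α → Bool) (i : Bool) : ℕ := (univ.filter fun h => l h = i).card
/-- number of unmatched half-edges on a side -/
def US (l : α → Bool) (i : Bool) (m : Finset (Sym2 α)) : Finset α := (unm m).filter fun h => l h = i

/-- type counts -/
def tri (a b c : ℕ) : ℕ → ℕ := fun t => if t = 2 then a else if t = 0 then b else if t = 1 then c else 0

lemma ty_le (l : α → Bool) (p : Sym2 α) : ty l p ≤ 2 := by
  induction p using Sym2.ind with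
  | _ x y => rw [ty_mk]; cases l x <;> cases l y <;> simp

lemma sum_ty (l : α → Bool) (m : Finset (Sym2 α)) (φ : ℕ → ℕ) :
    ∑ p ∈ m, φ (ty l p) = φ 0 * cnt l m 0 + φ 1 * cnt l m 1 + φ 2 * cnt l m 2 := by
  rw [← Finset.sum_fiberwise_of_maps_to (s := m) (t := Finset.range 3) (g := ty l)
    (fun p _ => by have := ty_le l p; simp; omega)]
  simp only [Finset.sum_range_succ, Finset.sum_range_zero, zero_add]
  have : ∀ k, ∑ p ∈ m with ty l p = k, φ (ty l p) = φ k * cnt l m k := by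
    intro k
    rw [Finset.sum_congr rfl (g := fun _ => φ k) (fun p hp => by rw [(Finset.mem_filter.1 hp).2])]
    simp [cnt, mul_comm]
  rw [this, this, this]

lemma card_left (l : α → Bool) {m : Finset (Sym2 α)} (hm : IsPairMatching m) :
    (US l true m).card + (2 * cnt l m 2 + cnt l m 1) = NS l true := by
  have := sum_unm hm (fun h => (l h).toNat) (ty l) (fun x y => rfl)
  have h2 := sum_ty l m id
  simp only [id] at h2
  rw [h2] at this
  have e : ∀ s : Finset α, ∑ h ∈ s, (l h).toNat = (s.filter fun h => l h = true).card := by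
    intro s
    rw [Finset.card_filter]
    refine Finset.sum_congr rfl fun x _ => ?_
    cases l x <;> simp
  rw [e, e] at this
  unfold US NS
  omega

lemma card_right (l : α → Bool) {m : Finset (Sym2 α)} (hm : IsPairMatching m) :
    (US l false m).card + (2 * cnt l m 0 + cnt l m 1) = NS l false := by
  have := sum_unm hm (fun h => 1 - (l h).toNat) (fun p => 2 - ty l p) (fun x y => by
    simp only [ty_mk]; cases l x <;> cases l y <;> simp)
  have h2 := sum_ty l m (fun t => 2 - t)
  rw [h2] at this
  have e : ∀ s : Finset α, ∑ h ∈ s, (1 - (l h).toNat) = (s.filter fun h => l h = false).card := by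
    intro s
    rw [Finset.card_filter]
    refine Finset.sum_congr rfl fun x _ => ?_
    cases l x <;> simp
  rw [e, e] at this
  unfold US NS
  omega

lemma card_unm (l : α → Bool) (m : Finset (Sym2 α)) :
    (unm m).card = (US l true m).card + (US l false m).card := by
  unfold US
  rw [← Finset.card_filter_add_card_filter_not (s := unm m) (p := fun h => l h = true)]
  simp

lemma OP_same (l : α → Bool) (i : Bool) (m : Finset (Sym2 α)) :
    OP l i i m = (US l i m).offDiag := by
  ext q; simp [OP, US, Finset.mem_offDiag]; tauto

lemma OP_cross (l : α → Bool) (m : Finset (Sym2 α)) :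
    OP l true false m = (US l true m) ×ˢ (US l false m) := by
  ext q; simp [OP, US]
  constructor
  · rintro ⟨h1, h2, h3, h4, h5⟩; exact ⟨⟨h2, h4⟩, h3, h5⟩
  · rintro ⟨⟨h2, h4⟩, h3, h5⟩
    refine ⟨?_, h2, h3, h4, h5⟩
    intro h
    rw [h, h5] at h4
    exact Bool.noConfusion h4

end

end Interp

namespace Interp

noncomputable section

variable {α : Type} [Fintype α] {V : Type} [Fintype V]

/-- graph of a matching -/
def gr (v : α → V) (m : Finset (Sym2 α)) : Multigraph :=
  { V := V, edges := m.val.map (Sym2.map v) }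

/-- average over matchings with given type counts -/
def Fav (l : α → Bool) (g : Finset (Sym2 α) → ℝ) (T : ℕ → ℕ) : ℝ :=
  (∑ m ∈ MM l T, g m) / ((MM l T).card : ℝ)

lemma gr_insert (v : α → V) {m : Finset (Sym2 α)} {x y : α} (hx : x ∈ unm m) :
    gr v (insert s(x, y) m) = (gr v m).addEdge (v x) (v y) := by
  unfold gr Multigraph.addEdge
  congr 1
  simp only
  rw [Finset.insert_val_of_notMem (insert_notMem hx)]
  simp

lemma avg_ext (l : α → Bool) (i j : Bool) (T : ℕ → ℕ) (g : Finset (Sym2 α) → ℝ) (q : ℕ)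
    (hq : ∀ m ∈ MM l T, (OP l i j m).card = q) (hq0 : 0 < q) (hne : (MM l T).Nonempty) :
    (MM l (fun t => T t + if t = i.toNat + j.toNat then 1 else 0)).Nonempty ∧
    Fav l g (fun t => T t + if t = i.toNat + j.toNat then 1 else 0)
      = (∑ m ∈ MM l T, (∑ p ∈ OP l i j m, g (insert s(p.1, p.2) m)) / (q : ℝ)) /
        ((MM l T).card : ℝ) := by
  have h1 := sum_ext l i j T g
  have h2 := sum_ext l i j T (fun _ => 1)
  set w : ℝ := (((if i = j then 2 else 1) * (T (i.toNat + j.toNat) + 1) : ℕ) : ℝ) with hw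
  have h3 : ∑ m ∈ MM l T, ∑ p ∈ OP l i j m, (1 : ℝ) = ((MM l T).card : ℝ) * q := by
    rw [Finset.sum_congr rfl (g := fun _ => (q : ℝ)) (fun m hm => by simp [hq m hm])]
    simp
  rw [h3] at h2
  have hM : (0 : ℝ) < (MM l T).card := by exact_mod_cast hne.card_pos
  have hq0' : (0 : ℝ) < q := by exact_mod_cast hq0
  have hw0 : w ≠ 0 := by
    intro h; rw [h, zero_mul] at h2
    have := mul_pos hM hq0'
    linarith
  simp only [Finset.sum_const, nsmul_eq_mul, mul_one] at h2
  set T' := (fun t => T t + if t = i.toNat + j.toNat then 1 else 0) with hT'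
  have hM' : ((MM l T').card : ℝ) ≠ 0 := by
    intro h; rw [h, mul_zero] at h2
    have := mul_pos hM hq0'
    linarith
  refine ⟨?_, ?_⟩
  · rw [← Finset.card_pos]
    exact Nat.pos_of_ne_zero (by exact_mod_cast hM')
  · unfold Fav
    rw [← Finset.sum_div, ← h1, div_div, div_eq_div_iff hM' (by positivity)]
    linear_combination (-(∑ m ∈ MM l T', g m)) * h2

lemma fav_lip (l : α → Bool) (i j : Bool) (T : ℕ → ℕ) (f : Multigraph → ℝ) (v : α → V) (κ : ℝ)
    (hlip : GraphParam.Lipschitz f κ) (q : ℕ)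
    (hq : ∀ m ∈ MM l T, (OP l i j m).card = q) (hq0 : 0 < q) (hne : (MM l T).Nonempty) :
    |Fav l (fun m => f (gr v m)) (fun t => T t + if t = i.toNat + j.toNat then 1 else 0)
      - Fav l (fun m => f (gr v m)) T| ≤ κ := by
  rw [(avg_ext l i j T _ q hq hq0 hne).2]
  unfold Fav
  have hM : (0 : ℝ) < (MM l T).card := by exact_mod_cast hne.card_pos
  have hq0' : (0 : ℝ) < q := by exact_mod_cast hq0
  rw [← sub_div, ← Finset.sum_sub_distrib, abs_div, abs_of_pos hM, div_le_iff₀ hM]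
  refine (Finset.abs_sum_le_sum_abs _ _).trans ?_
  rw [mul_comm, ← nsmul_eq_mul, ← Finset.sum_const]
  refine Finset.sum_le_sum fun m hm => ?_
  have : (∑ p ∈ OP l i j m, f (gr v (insert s(p.1, p.2) m))) / (q : ℝ) - f (gr v m)
      = (∑ p ∈ OP l i j m, (f (gr v (insert s(p.1, p.2) m)) - f (gr v m))) / q := by
    rw [Finset.sum_sub_distrib, Finset.sum_const, hq m hm, sub_div]
    simp [hq0'.ne']
  rw [this, abs_div, abs_of_pos hq0', div_le_iff₀ hq0']
  refine (Finset.abs_sum_le_sum_abs _ _).trans ?_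
  rw [mul_comm, ← nsmul_eq_mul, ← hq m hm, ← Finset.sum_const]
  refine Finset.sum_le_sum fun p hp => ?_
  simp only [OP, Finset.mem_filter] at hp
  rw [gr_insert v hp.2.2.1]
  exact hlip (gr v m) (v p.1) (v p.2)

lemma conc_push (f : Multigraph → ℝ) (hconc : GraphParam.Concave f) (v : α → V)
    (m : Finset (Sym2 α)) (y : α → ℝ) (hy : ∑ a, y a = 0) :
    ∑ a, ∑ b, (f ((gr v m).addEdge (v a) (v b)) - f (gr v m)) * y a * y b ≤ 0 := by
  have hz := hconc (gr v m) (fun i : V => ∑ a with v a = i, y a)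
    (by rw [← hy]; exact Finset.sum_fiberwise _ _ _)
  refine le_of_eq_of_le ?_ hz
  change _ = ∑ i : V, ∑ j : V, (f ((gr v m).addEdge i j) - f (gr v m)) * (∑ a with v a = i, y a) *
    (∑ a with v a = j, y a)
  rw [← Finset.sum_fiberwise (s := univ) (g := v)]
  refine Finset.sum_congr rfl fun i _ => ?_
  have : ∀ a ∈ univ.filter (fun a => v a = i),
    ∑ b, (f ((gr v m).addEdge (v a) (v b)) - f (gr v m)) * y a * y b
    = ∑ j : V, (f ((gr v m).addEdge i j) - f (gr v m)) * y a * (∑ a with v a = j, y a) := by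
    intro a ha
    have ha : v a = i := (Finset.mem_filter.1 ha).2
    rw [← Finset.sum_fiberwise (s := univ) (g := v)]
    refine Finset.sum_congr rfl fun j _ => ?_
    rw [Finset.mul_sum]
    refine Finset.sum_congr rfl fun b hb => ?_
    have hb : v b = j := (Finset.mem_filter.1 hb).2
    rw [ha, hb]
  rw [Finset.sum_congr rfl this, Finset.sum_comm]
  refine Finset.sum_congr rfl fun j _ => ?_
  rw [← Finset.sum_mul, ← Finset.mul_sum]

lemma off_bound (κ All Off Dg s : ℝ) (hs : 2 ≤ s) (h : All = Dg + Off) (hD : |Dg| ≤ κ * s)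
    (hO : |Off| ≤ κ * (s * (s - 1))) :
    Off / (s * (s - 1)) ≤ All / s ^ 2 + 2 * κ / s := by
  have hs0 : 0 < s := by linarith
  have hs1 : 0 < s - 1 := by linarith
  have e1 : Off / (s * (s - 1)) = Off / s ^ 2 + (Off / (s * (s - 1))) / s := by
    field_simp; ring
  have e2 : Off / (s * (s - 1)) ≤ κ := by
    rw [div_le_iff₀ (by positivity)]; exact (le_abs_self _).trans hO
  have e3 : Off / s ^ 2 ≤ All / s ^ 2 + κ / s := by
    have : κ / s = κ * s / s ^ 2 := by field_simp
    rw [this, ← add_div]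
    gcongr
    have := neg_abs_le Dg
    linarith
  have e4 : (Off / (s * (s - 1))) / s ≤ κ / s := by gcongr
  have e5 : 2 * κ / s = κ / s + κ / s := by ring
  rw [e5]; linarith

lemma conc_local (l : α → Bool) (f : Multigraph → ℝ) (v : α → V) (κ : ℝ)
    (hlip : GraphParam.Lipschitz f κ) (hconc : GraphParam.Concave f) (m : Finset (Sym2 α))
    (s1 s2 : ℕ) (h1 : (US l true m).card = s1) (h2 : (US l false m).card = s2)
    (hs1 : 2 ≤ s1) (hs2 : 2 ≤ s2) :
    (∑ p ∈ OP l true true m, f (gr v (insert s(p.1, p.2) m))) / ((s1 * (s1 - 1) : ℕ) : ℝ) +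
    (∑ p ∈ OP l false false m, f (gr v (insert s(p.1, p.2) m))) / ((s2 * (s2 - 1) : ℕ) : ℝ) ≤
    2 * ((∑ p ∈ OP l true false m, f (gr v (insert s(p.1, p.2) m))) / ((s1 * s2 : ℕ) : ℝ)) +
      2 * κ / s1 + 2 * κ / s2 := by
  set De : α → α → ℝ := fun a b => f ((gr v m).addEdge (v a) (v b)) - f (gr v m) with hDe
  have hDabs : ∀ a b, |De a b| ≤ κ := fun a b => hlip (gr v m) (v a) (v b)
  have hsymm : ∀ a b, De a b = De b a := by
    intro a b
    have : (gr v m).addEdge (v a) (v b) = (gr v m).addEdge (v b) (v a) := by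
      unfold Multigraph.addEdge
      congr 2
      exact Sym2.eq_swap
    simp only [hDe, this]
  have r1 : (2 : ℝ) ≤ s1 := by exact_mod_cast hs1
  have r2 : (2 : ℝ) ≤ s2 := by exact_mod_cast hs2
  set U := US l true m with hU
  set W := US l false m with hW
  have hins : ∀ i j, ∀ p ∈ OP l i j m, f (gr v (insert s(p.1, p.2) m)) = De p.1 p.2 + f (gr v m) := by
    intro i j p hp
    simp only [OP, Finset.mem_filter] at hp
    rw [gr_insert v hp.2.2.1, hDe]; ring
  have hav : ∀ i j, ∀ q : ℕ, (OP l i j m).card = q → 0 < q →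
      (∑ p ∈ OP l i j m, f (gr v (insert s(p.1, p.2) m))) / (q : ℝ)
      = (∑ p ∈ OP l i j m, De p.1 p.2) / q + f (gr v m) := by
    intro i j q hq hq0
    have : (q : ℝ) ≠ 0 := by positivity
    rw [Finset.sum_congr rfl (hins i j), Finset.sum_add_distrib, Finset.sum_const, hq]
    field_simp
    simp
  have c1 : (OP l true true m).card = s1 * (s1 - 1) := by
    rw [OP_same, Finset.offDiag_card, h1, Nat.mul_sub, mul_one]
  have c2 : (OP l false false m).card = s2 * (s2 - 1) := by
    rw [OP_same, Finset.offDiag_card, h2, Nat.mul_sub, mul_one]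
  have c3 : (OP l true false m).card = s1 * s2 := by
    rw [OP_cross, Finset.card_product, h1, h2]
  rw [hav _ _ _ c1 (Nat.mul_pos (by omega) (by omega)),
    hav _ _ _ c2 (Nat.mul_pos (by omega) (by omega)),
    hav _ _ _ c3 (Nat.mul_pos (by omega) (by omega)), OP_same, OP_same, OP_cross,
    Finset.sum_product]
  -- quadratic form
  have hq := conc_push f hconc v m
    (fun a => (if a ∈ U then (1 : ℝ) / s1 else 0) - (if a ∈ W then (1 : ℝ) / s2 else 0)) (by
      rw [Finset.sum_sub_distrib]
      simp only [Finset.sum_ite_mem, Finset.univ_inter, Finset.sum_const, h1, h2, nsmul_eq_mul]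
      field_simp; norm_num)
  have expand : ∑ a, ∑ b, (f ((gr v m).addEdge (v a) (v b)) - f (gr v m)) *
      ((if a ∈ U then (1 : ℝ) / s1 else 0) - (if a ∈ W then (1 : ℝ) / s2 else 0)) *
      ((if b ∈ U then (1 : ℝ) / s1 else 0) - (if b ∈ W then (1 : ℝ) / s2 else 0))
      = (∑ a ∈ U, ∑ b ∈ U, De a b) / s1 ^ 2 + (∑ a ∈ W, ∑ b ∈ W, De a b) / s2 ^ 2
        - 2 * ((∑ a ∈ U, ∑ b ∈ W, De a b) / (s1 * s2)) := by
    have e : ∀ (A B : Finset α) (c d : ℝ), ∑ a, ∑ b, De a b * (if a ∈ A then c else 0) *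
        (if b ∈ B then d else 0) = (∑ a ∈ A, ∑ b ∈ B, De a b) * (c * d) := by
      intro A B c d
      simp only [mul_ite, mul_zero, ite_mul, zero_mul]
      simp only [Finset.sum_ite_mem, Finset.univ_inter]
      rw [Finset.sum_mul, ← Finset.sum_filter_add_sum_filter_not univ (fun a => a ∈ A)]
      simp only [Finset.filter_mem_eq_inter, Finset.univ_inter]
      rw [Finset.sum_eq_zero (s := univ.filter (fun a => a ∉ A))]
      · rw [add_zero]
        refine Finset.sum_congr rfl fun a ha => ?_
        rw [Finset.sum_mul]
        refine Finset.sum_congr rfl fun b hb => ?_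
        rw [if_pos ha]; ring
      · intro a ha
        rw [Finset.mem_filter] at ha
        simp [ha.2]
    have sw : ∑ a ∈ W, ∑ b ∈ U, De a b = ∑ a ∈ U, ∑ b ∈ W, De a b := by
      rw [Finset.sum_comm]
      exact Finset.sum_congr rfl fun a _ => Finset.sum_congr rfl fun b _ => hsymm _ _
    have : ∀ a b, (f ((gr v m).addEdge (v a) (v b)) - f (gr v m)) *
      ((if a ∈ U then (1 : ℝ) / s1 else 0) - (if a ∈ W then (1 : ℝ) / s2 else 0)) *
      ((if b ∈ U then (1 : ℝ) / s1 else 0) - (if b ∈ W then (1 : ℝ) / s2 else 0))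
      = De a b * (if a ∈ U then (1 : ℝ) / s1 else 0) * (if b ∈ U then (1 : ℝ) / s1 else 0)
      + De a b * (if a ∈ W then (1 : ℝ) / s2 else 0) * (if b ∈ W then (1 : ℝ) / s2 else 0)
      - De a b * (if a ∈ U then (1 : ℝ) / s1 else 0) * (if b ∈ W then (1 : ℝ) / s2 else 0)
      - De a b * (if a ∈ W then (1 : ℝ) / s2 else 0) * (if b ∈ U then (1 : ℝ) / s1 else 0) := by
      intro a b; simp only [hDe]; ring
    simp only [this, Finset.sum_add_distrib, Finset.sum_sub_distrib, e, sw]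
    field_simp
    ring
  rw [expand] at hq
  have off : ∀ (A : Finset α) (s : ℕ), A.card = s → 2 ≤ s →
      (∑ p ∈ A.offDiag, De p.1 p.2) / ((s * (s - 1) : ℕ) : ℝ) ≤
      (∑ a ∈ A, ∑ b ∈ A, De a b) / s ^ 2 + 2 * κ / s := by
    intro A s hA hs
    have hsum : ∀ t : Finset (α × α), |∑ p ∈ t, De p.1 p.2| ≤ κ * t.card := by
      intro t
      refine (Finset.abs_sum_le_sum_abs _ _).trans ?_
      rw [mul_comm, ← nsmul_eq_mul, ← Finset.sum_const]
      exact Finset.sum_le_sum fun p _ => hDabs _ _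
    have hcast : ((s * (s - 1) : ℕ) : ℝ) = (s : ℝ) * (s - 1) := by
      rw [Nat.cast_mul, Nat.cast_sub (by omega)]; simp
    rw [hcast]
    refine off_bound κ _ _ (∑ p ∈ A.diag, De p.1 p.2) s (by exact_mod_cast hs) ?_ ?_ ?_
    · rw [← Finset.sum_union (Finset.disjoint_diag_offDiag A), Finset.diag_union_offDiag,
        Finset.sum_product]
    · have := hsum A.diag
      rwa [Finset.diag_card, hA] at this
    · have := hsum A.offDiag
      rw [Finset.offDiag_card, hA] at this
      rw [← hcast, Nat.mul_sub, mul_one]; exact this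
  have o1 := off U s1 h1 hs1
  have o2 := off W s2 h2 hs2
  push_cast at o1 o2 hq ⊢
  linarith

lemma mem_MM {l : α → Bool} {T : ℕ → ℕ} {m : Finset (Sym2 α)} :
    m ∈ MM l T ↔ IsPairMatching m ∧ ∀ t, cnt l m t = T t := by simp [MM]

lemma card_US_left {l : α → Bool} {a b c : ℕ} {m : Finset (Sym2 α)} (hm : m ∈ MM l (tri a b c)) :
    (US l true m).card = NS l true - (2 * a + c) := by
  rw [mem_MM] at hm
  have := card_left l hm.1
  rw [hm.2, hm.2] at this
  simp [tri] at this
  omega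

lemma card_US_right {l : α → Bool} {a b c : ℕ} {m : Finset (Sym2 α)} (hm : m ∈ MM l (tri a b c)) :
    (US l false m).card = NS l false - (2 * b + c) := by
  rw [mem_MM] at hm
  have := card_right l hm.1
  rw [hm.2, hm.2] at this
  simp [tri] at this
  omega

lemma tri_a (a b c : ℕ) :
    (fun t => tri a b c t + if t = true.toNat + true.toNat then 1 else 0) = tri (a + 1) b c := by
  funext t; unfold tri; simp; split_ifs <;> omega
lemma tri_b (a b c : ℕ) :
    (fun t => tri a b c t + if t = false.toNat + false.toNat then 1 else 0) = tri a (b + 1) c := by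
  funext t; unfold tri; simp; split_ifs <;> omega
lemma tri_c (a b c : ℕ) :
    (fun t => tri a b c t + if t = true.toNat + false.toNat then 1 else 0) = tri a b (c + 1) := by
  funext t; unfold tri; simp; split_ifs <;> omega

lemma card_OPa {l : α → Bool} {a b c : ℕ} : ∀ m ∈ MM l (tri a b c), (OP l true true m).card =
    (NS l true - (2 * a + c)) * ((NS l true - (2 * a + c)) - 1) := by
  intro m hm
  rw [OP_same, Finset.offDiag_card, card_US_left hm, Nat.mul_sub _ _ 1, mul_one]
lemma card_OPb {l : α → Bool} {a b c : ℕ} : ∀ m ∈ MM l (tri a b c), (OP l false false m).card =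
    (NS l false - (2 * b + c)) * ((NS l false - (2 * b + c)) - 1) := by
  intro m hm
  rw [OP_same, Finset.offDiag_card, card_US_right hm, Nat.mul_sub _ _ 1, mul_one]
lemma card_OPc {l : α → Bool} {a b c : ℕ} : ∀ m ∈ MM l (tri a b c), (OP l true false m).card =
    (NS l true - (2 * a + c)) * (NS l false - (2 * b + c)) := by
  intro m hm
  rw [OP_cross, Finset.card_product, card_US_left hm, card_US_right hm]

lemma MM_nonempty (l : α → Bool) : ∀ (a b c : ℕ), 2 * a + c ≤ NS l true → 2 * b + c ≤ NS l false →
    (MM l (tri a b c)).Nonempty := by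
  intro a
  induction a with
  | zero =>
    intro b
    induction b with
    | zero =>
      intro c
      induction c with
      | zero =>
        intro _ _
        refine ⟨∅, ?_⟩
        rw [mem_MM]
        refine ⟨⟨by simp, by simp⟩, ?_⟩
        intro t; simp [cnt, tri]
      | succ c ih =>
        intro h1 h2
        rw [← tri_c]
        exact (avg_ext l true false _ (fun _ => 0) _ card_OPc
          (Nat.mul_pos (by omega) (by omega)) (ih (by omega) (by omega))).1
    | succ b ih =>
      intro c h1 h2
      rw [← tri_b]
      exact (avg_ext l false false _ (fun _ => 0) _ card_OPb
          (Nat.mul_pos (by omega) (by omega)) (ih c (by omega) (by omega))).1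
  | succ a ih =>
    intro b c h1 h2
    rw [← tri_a]
    exact (avg_ext l true true _ (fun _ => 0) _ card_OPa
          (Nat.mul_pos (by omega) (by omega)) (ih b c (by omega) (by omega))).1

section


lemma F_lip_a (l : α → Bool) (f : Multigraph → ℝ) (v : α → V) (κ : ℝ) (hlip : GraphParam.Lipschitz f κ)
    (a b c : ℕ) (h1 : 2 * (a + 1) + c ≤ NS l true) (h2 : 2 * b + c ≤ NS l false) :
    |Fav l (fun m => f (gr v m)) (tri (a + 1) b c) - Fav l (fun m => f (gr v m)) (tri a b c)| ≤ κ := by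
  rw [← tri_a]
  exact fav_lip l true true _ f v κ hlip _ card_OPa (Nat.mul_pos (by omega) (by omega))
    (MM_nonempty l a b c (by omega) (by omega))

lemma F_lip_b (l : α → Bool) (f : Multigraph → ℝ) (v : α → V) (κ : ℝ) (hlip : GraphParam.Lipschitz f κ)
    (a b c : ℕ) (h1 : 2 * a + c ≤ NS l true) (h2 : 2 * (b + 1) + c ≤ NS l false) :
    |Fav l (fun m => f (gr v m)) (tri a (b + 1) c) - Fav l (fun m => f (gr v m)) (tri a b c)| ≤ κ := by
  rw [← tri_b]
  exact fav_lip l false false _ f v κ hlip _ card_OPb (Nat.mul_pos (by omega) (by omega))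
    (MM_nonempty l a b c (by omega) (by omega))

lemma F_lip_c (l : α → Bool) (f : Multigraph → ℝ) (v : α → V) (κ : ℝ) (hlip : GraphParam.Lipschitz f κ)
    (a b c : ℕ) (h1 : 2 * a + (c + 1) ≤ NS l true) (h2 : 2 * b + (c + 1) ≤ NS l false) :
    |Fav l (fun m => f (gr v m)) (tri a b (c + 1)) - Fav l (fun m => f (gr v m)) (tri a b c)| ≤ κ := by
  rw [← tri_c]
  exact fav_lip l true false _ f v κ hlip _ card_OPc (Nat.mul_pos (by omega) (by omega))
    (MM_nonempty l a b c (by omega) (by omega))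


lemma F_conc (l : α → Bool) (f : Multigraph → ℝ) (v : α → V) (κ : ℝ) (hlip : GraphParam.Lipschitz f κ) (hconc : GraphParam.Concave f)
    (a b c : ℕ) (h1 : 2 * a + c + 2 ≤ NS l true) (h2 : 2 * b + c + 2 ≤ NS l false) :
    Fav l (fun m => f (gr v m)) (tri (a + 1) b c) + Fav l (fun m => f (gr v m)) (tri a (b + 1) c) ≤
    2 * Fav l (fun m => f (gr v m)) (tri a b (c + 1)) +
      2 * κ / ((NS l true - (2 * a + c) : ℕ) : ℝ) + 2 * κ / ((NS l false - (2 * b + c) : ℕ) : ℝ) := by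
  have hne := MM_nonempty l a b c (by omega) (by omega)
  rw [← tri_a, ← tri_b, ← tri_c,
    (avg_ext l true true _ _ _ card_OPa (Nat.mul_pos (by omega) (by omega)) hne).2,
    (avg_ext l false false _ _ _ card_OPb (Nat.mul_pos (by omega) (by omega)) hne).2,
    (avg_ext l true false _ _ _ card_OPc (Nat.mul_pos (by omega) (by omega)) hne).2]
  have hM : (0 : ℝ) < (MM l (tri a b c)).card := by exact_mod_cast hne.card_pos
  rw [← add_div, ← mul_div_assoc, add_assoc, div_add' _ _ _ hM.ne', div_le_div_iff_of_pos_right hM,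
    ← Finset.sum_add_distrib, Finset.mul_sum, mul_comm _ (_ : ℝ), ← nsmul_eq_mul,
    ← Finset.sum_const, ← Finset.sum_add_distrib]
  refine Finset.sum_le_sum fun m hm => ?_
  have := conc_local l f v κ hlip hconc m _ _ (card_US_left hm) (card_US_right hm)
    (by omega) (by omega)
  linarith

end

end

end Interp

namespace Interp

section walk

lemma walk_down (F : ℕ → ℕ → ℕ → ℝ) (N1 N2 : ℕ) (κ : ℝ) (hC : ∀ a b c, 2 * a + (c + 1) ≤ N1 → 2 * b + (c + 1) ≤ N2 → |F a b (c + 1) - F a b c| ≤ κ)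
    (a b c : ℕ) : ∀ k, 2 * a + (c + k) ≤ N1 → 2 * b + (c + k) ≤ N2 →
    F a b c - κ * k ≤ F a b (c + k) := by
  intro k
  induction k with
  | zero => intro _ _; simp
  | succ k ih =>
    intro h1 h2
    have h3 := ih (by omega) (by omega)
    have h4 := (abs_le.1 (hC a b (c + k) (by omega) (by omega))).1
    push_cast
    rw [← add_assoc]
    linarith

lemma walk_a (F : ℕ → ℕ → ℕ → ℝ) (N1 N2 : ℕ) (κ : ℝ) (hA : ∀ a b c, 2 * (a + 1) + c ≤ N1 → 2 * b + c ≤ N2 → |F (a + 1) b c - F a b c| ≤ κ)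
    (a b : ℕ) (hb : 2 * b ≤ N2) : ∀ k, 2 * (a + k) ≤ N1 →
    F (a + k) b 0 - κ * k ≤ F a b 0 := by
  intro k
  induction k with
  | zero => intro _; simp
  | succ k ih =>
    intro h1
    have h3 := ih (by omega)
    have h4 := (abs_le.1 (hA (a + k) b 0 (by omega) (by omega))).2
    push_cast
    rw [← add_assoc]
    linarith

lemma walk_b (F : ℕ → ℕ → ℕ → ℝ) (N1 N2 : ℕ) (κ : ℝ) (hB : ∀ a b c, 2 * a + c ≤ N1 → 2 * (b + 1) + c ≤ N2 → |F a (b + 1) c - F a b c| ≤ κ)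
    (a b : ℕ) (ha : 2 * a ≤ N1) : ∀ k, 2 * (b + k) ≤ N2 →
    F a (b + k) 0 - κ * k ≤ F a b 0 := by
  intro k
  induction k with
  | zero => intro _; simp
  | succ k ih =>
    intro h1
    have h3 := ih (by omega)
    have h4 := (abs_le.1 (hB a (b + k) 0 (by omega) (by omega))).2
    push_cast
    rw [← add_assoc]
    linarith

lemma crude (F : ℕ → ℕ → ℕ → ℝ) (N1 N2 : ℕ) (κ : ℝ) (hκ : 0 ≤ κ) (hA : ∀ a b c, 2 * (a + 1) + c ≤ N1 → 2 * b + c ≤ N2 → |F (a + 1) b c - F a b c| ≤ κ) (hB : ∀ a b c, 2 * a + c ≤ N1 → 2 * (b + 1) + c ≤ N2 → |F a (b + 1) c - F a b c| ≤ κ) (hC : ∀ a b c, 2 * a + (c + 1) ≤ N1 → 2 * b + (c + 1) ≤ N2 → |F a b (c + 1) - F a b c| ≤ κ)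
    (a b c : ℕ) (h1 : 2 * a + c ≤ N1) (h2 : 2 * b + c ≤ N2) :
    F (N1 / 2) (N2 / 2) 0 - κ * (2 * c + ((N1 : ℝ) + N2 - 2 * (a + b + c)) / 2) ≤ F a b c := by
  have d := walk_down F N1 N2 κ hC a b 0 c (by omega) (by omega)
  have e1 := walk_a F N1 N2 κ hA a b (by omega) (N1 / 2 - a) (by omega)
  have e2 := walk_b F N1 N2 κ hB (N1 / 2) b (by omega) (N2 / 2 - b) (by omega)
  rw [show a + (N1 / 2 - a) = N1 / 2 by omega] at e1
  rw [show b + (N2 / 2 - b) = N2 / 2 by omega] at e2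
  rw [zero_add] at d
  have k1 : ((N1 / 2 - a : ℕ) : ℝ) ≤ ((N1 : ℝ) - 2 * a) / 2 := by
    have : (N1 / 2 - a) * 2 + 2 * a ≤ N1 := by omega
    have : (((N1 / 2 - a) * 2 + 2 * a : ℕ) : ℝ) ≤ N1 := by exact_mod_cast this
    push_cast [-Nat.cast_sub] at this
    linarith
  have k2 : ((N2 / 2 - b : ℕ) : ℝ) ≤ ((N2 : ℝ) - 2 * b) / 2 := by
    have : (N2 / 2 - b) * 2 + 2 * b ≤ N2 := by omega
    have : (((N2 / 2 - b) * 2 + 2 * b : ℕ) : ℝ) ≤ N2 := by exact_mod_cast this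
    push_cast [-Nat.cast_sub] at this
    linarith
  have := mul_le_mul_of_nonneg_left k1 hκ
  have := mul_le_mul_of_nonneg_left k2 hκ
  linarith

lemma walk_main (F : ℕ → ℕ → ℕ → ℝ) (N1 N2 : ℕ) (κ : ℝ) (hκ : 0 ≤ κ) (hA : ∀ a b c, 2 * (a + 1) + c ≤ N1 → 2 * b + c ≤ N2 → |F (a + 1) b c - F a b c| ≤ κ) (hB : ∀ a b c, 2 * a + c ≤ N1 → 2 * (b + 1) + c ≤ N2 → |F a (b + 1) c - F a b c| ≤ κ) (hC : ∀ a b c, 2 * a + (c + 1) ≤ N1 → 2 * b + (c + 1) ≤ N2 → |F a b (c + 1) - F a b c| ≤ κ) (hQ : ∀ a b c, 2 * a + c + 2 ≤ N1 → 2 * b + c + 2 ≤ N2 → F (a + 1) b c + F a (b + 1) c ≤ 2 * F a b (c + 1) + 2 * κ / ((N1 - (2 * a + c) : ℕ) : ℝ) + 2 * κ / ((N2 - (2 * b + c) : ℕ) : ℝ))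
    (R : ℕ) (hR : 1 ≤ R) (T : ℝ) : ∀ c a b : ℕ, 2 * a + c ≤ N1 → 2 * b + c ≤ N2 →
    2 * R + 2 * (a + b + c) ≤ N1 + N2 → N1 + N2 ≤ 2 * R + 1 + 2 * (a + b + c) → (c : ℝ) ≤ T →
    F (N1 / 2) (N2 / 2) 0 - κ * ((R : ℝ) + 1 / 2 +
      2 * T * (((N1 : ℝ) - 2 * a) - (N2 - 2 * b)) ^ 2 / R ^ 2 + c * (8 * T / R ^ 2 + 4 / R))
      ≤ F a b c := by
  have hR' : (1 : ℝ) ≤ R := by exact_mod_cast hR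
  intro c
  induction c with
  | zero =>
    intro a b h1 h2 h3 h4 hT
    have := crude F N1 N2 κ hκ hA hB hC a b 0 h1 h2
    refine le_trans ?_ this
    have h4' : (N1 : ℝ) + N2 ≤ 2 * R + 1 + 2 * (a + b + 0) := by exact_mod_cast h4
    push_cast at hT ⊢
    refine sub_le_sub_left (mul_le_mul_of_nonneg_left ?_ hκ) _
    have : 0 ≤ 2 * T * (((N1 : ℝ) - 2 * a) - (N2 - 2 * b)) ^ 2 / R ^ 2 := by positivity
    linarith
  | succ c ih =>
    intro a b h1 h2 h3 h4 hT
    have h4' : (N1 : ℝ) + N2 ≤ 2 * R + 1 + 2 * (a + b + (c + 1)) := by exact_mod_cast h4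
    have h3' : 2 * R + 2 * (a + b + (c + 1)) ≤ (N1 : ℝ) + N2 := by exact_mod_cast h3
    push_cast at hT
    have hc0 : (0 : ℝ) ≤ c := by positivity
    have hT0 : 0 ≤ T := by linarith
    by_cases hy : (R : ℝ) ^ 2 ≤ (((N1 : ℝ) - 2 * a) - (N2 - 2 * b)) ^ 2
    · have := crude F N1 N2 κ hκ hA hB hC a b (c + 1) h1 h2
      refine le_trans ?_ this
      push_cast
      refine sub_le_sub_left (mul_le_mul_of_nonneg_left ?_ hκ) _
      have i1 : 2 * T ≤ 2 * T * (((N1 : ℝ) - 2 * a) - (N2 - 2 * b)) ^ 2 / R ^ 2 := by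
        rw [le_div_iff₀ (by positivity)]
        gcongr
      have i2 : 0 ≤ ((c : ℝ) + 1) * (8 * T / R ^ 2 + 4 / R) := by positivity
      linarith
    · push Not at hy
      have hy' := abs_lt_of_sq_lt_sq hy (by positivity)
      rw [abs_lt] at hy'
      have s1 : (R : ℝ) / 2 ≤ (N1 : ℝ) - 2 * a - (c + 1) := by linarith
      have s2 : (R : ℝ) / 2 ≤ (N2 : ℝ) - 2 * b - (c + 1) := by linarith
      have n1 : 2 * a + c + 2 ≤ N1 := by
        have : (2 * a + c + 1 : ℕ) < (N1 : ℝ) := by push_cast; linarith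
        have : 2 * a + c + 1 < N1 := by exact_mod_cast this
        omega
      have n2 : 2 * b + c + 2 ≤ N2 := by
        have : (2 * b + c + 1 : ℕ) < (N2 : ℝ) := by push_cast; linarith
        have : 2 * b + c + 1 < N2 := by exact_mod_cast this
        omega
      have q := hQ a b c n1 n2
      have ia := ih (a + 1) b (by omega) (by omega) (by omega) (by omega) (by linarith)
      have ib := ih a (b + 1) (by omega) (by omega) (by omega) (by omega) (by linarith)
      rw [Nat.cast_sub (by omega), Nat.cast_sub (by omega)] at q
      push_cast at q ia ib ⊢
      have z1 : 2 * κ / ((N1 : ℝ) - (2 * a + c)) ≤ 2 * κ / (R / 2) := by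
        gcongr; linarith
      have z2 : 2 * κ / ((N2 : ℝ) - (2 * b + c)) ≤ 2 * κ / (R / 2) := by
        gcongr; linarith
      have z3 : 2 * κ / ((R : ℝ) / 2) = κ * (4 / R) := by field_simp; ring
      rw [z3] at z1 z2
      have id : κ * ((R : ℝ) + 1 / 2 +
          2 * T * (((N1 : ℝ) - 2 * (a + 1)) - (N2 - 2 * b)) ^ 2 / R ^ 2 + c * (8 * T / R ^ 2 + 4 / R))
        + κ * ((R : ℝ) + 1 / 2 +
          2 * T * (((N1 : ℝ) - 2 * a) - (N2 - 2 * (b + 1))) ^ 2 / R ^ 2 + c * (8 * T / R ^ 2 + 4 / R))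
        + 2 * (κ * (4 / R))
        = 2 * (κ * ((R : ℝ) + 1 / 2 +
          2 * T * (((N1 : ℝ) - 2 * a) - (N2 - 2 * b)) ^ 2 / R ^ 2 + (c + 1) * (8 * T / R ^ 2 + 4 / R))) := by
        ring
      linarith

lemma walk_final (F : ℕ → ℕ → ℕ → ℝ) (N1 N2 : ℕ) (κ : ℝ) (hκ : 0 ≤ κ) (hA : ∀ a b c, 2 * (a + 1) + c ≤ N1 → 2 * b + c ≤ N2 → |F (a + 1) b c - F a b c| ≤ κ) (hB : ∀ a b c, 2 * a + c ≤ N1 → 2 * (b + 1) + c ≤ N2 → |F a (b + 1) c - F a b c| ≤ κ) (hC : ∀ a b c, 2 * a + (c + 1) ≤ N1 → 2 * b + (c + 1) ≤ N2 → |F a b (c + 1) - F a b c| ≤ κ) (hQ : ∀ a b c, 2 * a + c + 2 ≤ N1 → 2 * b + c + 2 ≤ N2 → F (a + 1) b c + F a (b + 1) c ≤ 2 * F a b (c + 1) + 2 * κ / ((N1 - (2 * a + c) : ℕ) : ℝ) + 2 * κ / ((N2 - (2 * b + c) : ℕ) : ℝ))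
    (a b c : ℕ) (h1 : 2 * a + c ≤ N1) (h2 : 2 * b + c ≤ N2)
    (h3 : N1 + N2 ≤ 2 * (a + b + c) + 1) :
    F (N1 / 2) (N2 / 2) 0 - κ * (20 * ((N1 : ℝ) ^ (2 / 3 : ℝ) + 1)) ≤ F a b c := by
  set X : ℝ := (N1 : ℝ) ^ (1 / 3 : ℝ) with hX
  have hX0 : 0 ≤ X := by positivity
  have hX2 : (N1 : ℝ) ^ (2 / 3 : ℝ) = X ^ 2 := by
    rw [hX, ← Real.rpow_natCast, ← Real.rpow_mul (by positivity)]; norm_num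
  have hX3 : (N1 : ℝ) = X ^ 3 := by
    rw [hX, ← Real.rpow_natCast, ← Real.rpow_mul (by positivity)]; norm_num
  rw [hX2]
  set R : ℕ := ⌈X ^ 2⌉₊ + 1 with hR
  have hR1 : 1 ≤ R := by omega
  have hRl : X ^ 2 + 1 ≤ R := by rw [hR]; push_cast; linarith [Nat.le_ceil (X ^ 2)]
  have hRu : (R : ℝ) ≤ X ^ 2 + 2 := by
    rw [hR]; push_cast; linarith [Nat.ceil_lt_add_one (sq_nonneg X)]
  have h3' : (N1 : ℝ) + N2 ≤ 2 * (a + b + c) + 1 := by exact_mod_cast h3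
  by_cases hc : c < R
  · have := crude F N1 N2 κ hκ hA hB hC a b c h1 h2
    refine le_trans ?_ this
    gcongr
    have : (c : ℝ) ≤ R := by exact_mod_cast hc.le
    linarith [sq_nonneg X]
  · push Not at hc
    obtain ⟨c', rfl⟩ := Nat.exists_eq_add_of_le' hc
    have d := walk_down F N1 N2 κ hC a b c' R (by omega) (by omega)
    have w := walk_main F N1 N2 κ hκ hA hB hC hQ R hR1 N1 c' a b (by omega) (by omega) (by omega)
      (by omega) (by exact_mod_cast (by omega))
    refine le_trans ?_ d
    have y2 : (((N1 : ℝ) - 2 * a) - (N2 - 2 * b)) ^ 2 ≤ 1 := by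
      rw [sq_le_one_iff_abs_le_one, abs_le]
      have g1 : N1 + 2 * b ≤ N2 + 2 * a + 1 := by omega
      have g2 : N2 + 2 * a ≤ N1 + 2 * b + 1 := by omega
      have g1' : (N1 : ℝ) + 2 * b ≤ N2 + 2 * a + 1 := by exact_mod_cast g1
      have g2' : (N2 : ℝ) + 2 * a ≤ N1 + 2 * b + 1 := by exact_mod_cast g2
      constructor <;> linarith
    have hRp : (0 : ℝ) < R := by positivity
    have c1 : (c' : ℝ) ≤ N1 := by exact_mod_cast (by omega)
    have b1 : 2 * (N1 : ℝ) * (((N1 : ℝ) - 2 * a) - (N2 - 2 * b)) ^ 2 / R ^ 2 ≤ 2 * X ^ 2 + 2 := by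
      rw [div_le_iff₀ (by positivity)]
      have : 2 * (N1 : ℝ) * (((N1 : ℝ) - 2 * a) - (N2 - 2 * b)) ^ 2 ≤ 2 * N1 * 1 := by gcongr
      have r2 : (X ^ 2 + 1) ^ 2 ≤ (R : ℝ) ^ 2 := by gcongr
      have : (2 * X ^ 2 + 2) * (X ^ 2 + 1) ^ 2 ≤ (2 * X ^ 2 + 2) * R ^ 2 := by gcongr
      nlinarith [sq_nonneg (X - 1), sq_nonneg X, pow_nonneg hX0 3, pow_nonneg hX0 4, pow_nonneg hX0 6]
    have b2 : (c' : ℝ) * (8 * N1 / R ^ 2) ≤ 8 * X ^ 2 := by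
      rw [mul_div_assoc', div_le_iff₀ (by positivity)]
      have r2 : (X ^ 2) ^ 2 ≤ (R : ℝ) ^ 2 := by gcongr; linarith
      calc (c' : ℝ) * (8 * N1) ≤ N1 * (8 * N1) := by gcongr
        _ = 8 * X ^ 2 * (X ^ 2) ^ 2 := by rw [hX3]; ring
        _ ≤ _ := by gcongr
    have b3 : (c' : ℝ) * (4 / R) ≤ 4 * X := by
      rw [mul_div_assoc', div_le_iff₀ (by positivity)]
      calc (c' : ℝ) * 4 ≤ N1 * 4 := by gcongr
        _ = 4 * X * (X ^ 2) := by rw [hX3]; ring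
        _ ≤ _ := by gcongr; linarith
    have tot : (R : ℝ) + 1 / 2 + 2 * N1 * (((N1 : ℝ) - 2 * a) - (N2 - 2 * b)) ^ 2 / R ^ 2
      + c' * (8 * N1 / R ^ 2 + 4 / R) + R ≤ 20 * (X ^ 2 + 1) := by
      rw [mul_add]
      nlinarith [sq_nonneg (X - 1)]
    have := mul_le_mul_of_nonneg_left tot hκ
    linarith

end walk
end Interp

namespace Interp

noncomputable section

variable {α : Type} [Fintype α] {V : Type} [Fintype V]

/-- maximal matchings -/
def maxM (α : Type) [Fintype α] : Finset (Finset (Sym2 α)) :=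
  univ.filter fun m => IsMaximalMatching m

/-- average over maximal matchings -/
def avgMax (v : α → V) (f : Multigraph → ℝ) : ℝ :=
  (∑ m ∈ maxM α, f (gr v m)) / ((maxM α).card : ℝ)

lemma card_unm_add {m : Finset (Sym2 α)} (hm : IsPairMatching m) :
    (unm m).card + 2 * m.card = Fintype.card α := by
  have := sum_unm hm (fun _ => 1) (fun _ => 2) (fun _ _ => rfl)
  simp at this
  rw [← this]; ring

lemma max_iff {m : Finset (Sym2 α)} :
    IsMaximalMatching m ↔ IsPairMatching m ∧ Fintype.card α ≤ 2 * m.card + 1 := by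
  constructor
  · rintro ⟨hm, hmax⟩
    refine ⟨hm, ?_⟩
    by_contra hlt
    push Not at hlt
    have h1 := card_unm_add hm
    have : 1 < (unm m).card := by omega
    obtain ⟨x, hx, y, hy, hxy⟩ := Finset.one_lt_card.1 this
    have h2 := hmax _ (pm_insert hm hxy hx hy) (Finset.subset_insert _ _)
    have : s(x, y) ∈ m := by rw [← h2]; simp
    exact insert_notMem hx this
  · rintro ⟨hm, hc⟩
    refine ⟨hm, ?_⟩
    intro m' hm' hsub
    symm
    apply Finset.eq_of_subset_of_card_le hsub
    have := card_unm_add hm'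
    omega

lemma mem_maxM {m : Finset (Sym2 α)} :
    m ∈ maxM α ↔ IsPairMatching m ∧ Fintype.card α ≤ 2 * m.card + 1 := by
  simp [maxM, max_iff]

lemma cnt_eq_tri (l : α → Bool) (m : Finset (Sym2 α)) (t : ℕ) :
    cnt l m t = tri (cnt l m 2) (cnt l m 0) (cnt l m 1) t := by
  unfold tri
  split_ifs with h1 h2 h3
  · rw [h1]
  · rw [h2]
  · rw [h3]
  · unfold cnt
    rw [Finset.card_eq_zero, Finset.filter_eq_empty_iff]
    intro p _
    have := ty_le l p
    omega

lemma NS_add (l : α → Bool) : NS l true + NS l false = Fintype.card α := by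
  unfold NS
  rw [← Finset.card_univ,
    ← Finset.card_filter_add_card_filter_not (s := univ) (p := fun h => l h = true)]
  simp

lemma card_eq_cnt (l : α → Bool) (m : Finset (Sym2 α)) :
    m.card = cnt l m 0 + cnt l m 1 + cnt l m 2 := by
  have := sum_ty l m (fun _ => 1)
  simpa using this

lemma maxM_nonempty : (maxM α).Nonempty := by
  obtain ⟨m, hm⟩ := MM_nonempty (fun _ : α => true) (NS (fun _ : α => true) true / 2) 0 0
    (by omega) (by omega)
  rw [mem_MM] at hm
  refine ⟨m, mem_maxM.2 ⟨hm.1, ?_⟩⟩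
  have h1 := card_eq_cnt (fun _ : α => true) m
  have h2 := hm.2 2
  have h3 := NS_add (fun _ : α => true)
  have h4 : NS (fun _ : α => true) false = 0 := by simp [NS]
  simp [tri] at h2
  omega

lemma avg_lower (l : α → Bool) (f : Multigraph → ℝ) (v : α → V) (L : ℝ)
    (hL : ∀ a b c, 2 * a + c ≤ NS l true → 2 * b + c ≤ NS l false →
      NS l true + NS l false ≤ 2 * (a + b + c) + 1 →
      L ≤ Fav l (fun m => f (gr v m)) (tri a b c)) :
    L ≤ avgMax v f := by
  unfold avgMax
  have hM : (0 : ℝ) < (maxM α).card := by exact_mod_cast maxM_nonempty.card_pos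
  rw [le_div_iff₀ hM, mul_comm, ← nsmul_eq_mul, ← Finset.sum_const, ← sub_nonneg,
    ← Finset.sum_sub_distrib,
    ← Finset.sum_fiberwise_of_maps_to (s := maxM α)
      (t := (maxM α).image fun m => (cnt l m 2, cnt l m 0, cnt l m 1))
      (g := fun m => (cnt l m 2, cnt l m 0, cnt l m 1))
      (fun m hm => Finset.mem_image_of_mem _ hm)]
  refine Finset.sum_nonneg fun t ht => ?_
  obtain ⟨m0, hm0, rfl⟩ := Finset.mem_image.1 ht
  rw [mem_maxM] at hm0
  have h1 := card_left l hm0.1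
  have h2 := card_right l hm0.1
  have h3 := NS_add l
  have h4 := card_eq_cnt l m0
  have hfib : (maxM α).filter (fun m => (cnt l m 2, cnt l m 0, cnt l m 1) =
      (cnt l m0 2, cnt l m0 0, cnt l m0 1)) =
      MM l (tri (cnt l m0 2) (cnt l m0 0) (cnt l m0 1)) := by
    ext m
    rw [Finset.mem_filter, mem_maxM, mem_MM]
    simp only [Prod.mk.injEq]
    constructor
    · rintro ⟨⟨h, _⟩, e1, e2, e3⟩
      refine ⟨h, fun t => ?_⟩
      rw [cnt_eq_tri, e1, e2, e3]
    · rintro ⟨h, e⟩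
      have e1 := e 2
      have e2 := e 0
      have e3 := e 1
      simp [tri] at e1 e2 e3
      have := card_eq_cnt l m
      exact ⟨⟨h, by omega⟩, e1, e2, e3⟩
  rw [hfib]
  have hF := hL (cnt l m0 2) (cnt l m0 0) (cnt l m0 1) (by omega) (by omega) (by omega)
  have hne := MM_nonempty l (cnt l m0 2) (cnt l m0 0) (cnt l m0 1) (by omega) (by omega)
  have hM' : (0 : ℝ) < (MM l (tri (cnt l m0 2) (cnt l m0 0) (cnt l m0 1))).card := by
    exact_mod_cast hne.card_pos
  unfold Fav at hF
  rw [le_div_iff₀ hM'] at hF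
  rw [Finset.sum_sub_distrib, Finset.sum_const, nsmul_eq_mul]
  linarith

lemma avg_interp (l : α → Bool) (f : Multigraph → ℝ) (v : α → V) (κ : ℝ) (hκ : 0 ≤ κ)
    (hlip : GraphParam.Lipschitz f κ) (hconc : GraphParam.Concave f) :
    Fav l (fun m => f (gr v m)) (tri (NS l true / 2) (NS l false / 2) 0)
      - κ * (20 * ((NS l true : ℝ) ^ (2 / 3 : ℝ) + 1)) ≤ avgMax v f := by
  apply avg_lower l
  intro a b c h1 h2 h3
  exact walk_final (fun a b c => Fav l (fun m => f (gr v m)) (tri a b c)) (NS l true) (NS l false)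
    κ hκ (F_lip_a l f v κ hlip) (F_lip_b l f v κ hlip) (F_lip_c l f v κ hlip)
    (F_conc l f v κ hlip hconc) a b c h1 h2 h3

/-- induced embedding of pairs -/
def emb {α β : Type} (φ : α ↪ β) : Sym2 α ↪ Sym2 β := ⟨Sym2.map φ, Sym2.map.injective φ.injective⟩

lemma pm_map {α β : Type} (φ : α ↪ β) (m : Finset (Sym2 α)) :
    IsPairMatching (m.map (emb φ)) ↔ IsPairMatching m := by
  have hd : ∀ p : Sym2 α, (emb φ p).IsDiag ↔ p.IsDiag := by
    intro p
    induction p using Sym2.ind with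
    | _ x y => simp [emb]
  constructor
  · rintro ⟨h1, h2⟩
    refine ⟨fun p hp hdp => h1 _ (Finset.mem_map_of_mem _ hp) ((hd p).2 hdp), ?_⟩
    intro p hp q hq hpq h hhp hhq
    refine h2 _ (Finset.mem_map_of_mem _ hp) _ (Finset.mem_map_of_mem _ hq)
      (fun e => hpq ((emb φ).injective e)) (φ h) ?_ ?_
    · exact Sym2.mem_map.2 ⟨h, hhp, rfl⟩
    · exact Sym2.mem_map.2 ⟨h, hhq, rfl⟩
  · rintro ⟨h1, h2⟩
    refine ⟨?_, ?_⟩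
    · intro p hp
      obtain ⟨p, hp', rfl⟩ := Finset.mem_map.1 hp
      rw [hd]; exact h1 p hp'
    · intro p hp q hq hpq h hhp hhq
      obtain ⟨p, hp', rfl⟩ := Finset.mem_map.1 hp
      obtain ⟨q, hq', rfl⟩ := Finset.mem_map.1 hq
      obtain ⟨x, hx, rfl⟩ := Sym2.mem_map.1 hhp
      obtain ⟨y, hy, hxy⟩ := Sym2.mem_map.1 hhq
      have : y = x := φ.injective hxy
      subst this
      exact h2 p hp' q hq' (fun e => hpq (by rw [e])) y hx hy

lemma avg_transport {β W : Type} [Fintype β] [Fintype W] (f : Multigraph → ℝ)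
    (hinv : GraphParam.Invariant f) (v : α → V) (w : β → W) (e : α ≃ β) (ev : V ≃ W)
    (hc : ∀ a, w (e a) = ev (v a)) : avgMax v f = avgMax w f := by
  have hcard := Fintype.card_congr e
  have key : ∀ g : Finset (Sym2 β) → ℝ,
      ∑ m ∈ maxM α, g (m.map (emb e.toEmbedding)) = ∑ m ∈ maxM β, g m := by
    intro g
    refine Finset.sum_bij' (fun m _ => m.map (emb e.toEmbedding))
      (fun m _ => m.map (emb e.symm.toEmbedding)) ?_ ?_ ?_ ?_ ?_
    · intro m hm
      rw [mem_maxM] at hm ⊢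
      rw [pm_map, Finset.card_map, ← hcard]; exact hm
    · intro m hm
      rw [mem_maxM] at hm ⊢
      rw [pm_map, Finset.card_map, hcard]; exact hm
    · intro m hm
      rw [Finset.map_map]
      convert Finset.map_refl
      ext p
      simp [emb, Sym2.map_map]
    · intro m hm
      rw [Finset.map_map]
      convert Finset.map_refl
      ext p
      simp [emb, Sym2.map_map]
    · intro m hm; rfl
  have k1 := key (fun m => f (gr w m))
  have k2 := key (fun _ => 1)
  simp only [Finset.sum_const, nsmul_eq_mul, mul_one] at k2
  unfold avgMax
  rw [← k1, ← k2]
  congr 1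
  refine Finset.sum_congr rfl fun m hm => ?_
  apply hinv (gr v m) (gr w (m.map (emb e.toEmbedding))) ev
  simp only [gr, Finset.map_val, Multiset.map_map]
  refine Multiset.map_congr rfl fun p _ => ?_
  simp only [emb, Function.comp, Function.Embedding.coeFn_mk, Sym2.map_map]
  congr 1
  funext a
  exact hc a

end
end Interp

namespace Interp

noncomputable section

variable {α β : Type} [Fintype α] [Fintype β] {V W : Type} [Fintype V] [Fintype W]

abbrev eL (α β : Type) : Sym2 α ↪ Sym2 (α ⊕ β) := emb (Function.Embedding.inl)
abbrev eR (α β : Type) : Sym2 β ↪ Sym2 (α ⊕ β) := emb (Function.Embedding.inr)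

lemma ty_eL (p : Sym2 α) : ty (Sum.isLeft (β := β)) (eL α β p) = 2 := by
  induction p using Sym2.ind with
  | _ x y => simp [eL, emb]

lemma ty_eR (p : Sym2 β) : ty (Sum.isLeft (α := α)) (eR α β p) = 0 := by
  induction p using Sym2.ind with
  | _ x y => simp [eR, emb]

lemma ty_two {p : Sym2 (α ⊕ β)} (h : ty (Sum.isLeft) p = 2) : ∃ q, eL α β q = p := by
  induction p using Sym2.ind with
  | _ x y =>
  rcases x with x | x <;> rcases y with y | y <;> simp at h
  exact ⟨s(x, y), rfl⟩

lemma ty_zero {p : Sym2 (α ⊕ β)} (h : ty (Sum.isLeft) p = 0) : ∃ q, eR α β q = p := by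
  induction p using Sym2.ind with
  | _ x y =>
  rcases x with x | x <;> rcases y with y | y <;> simp at h
  exact ⟨s(x, y), rfl⟩

lemma disj_LR (m1 : Finset (Sym2 α)) (m2 : Finset (Sym2 β)) :
    Disjoint (m1.map (eL α β)) (m2.map (eR α β)) := by
  rw [Finset.disjoint_left]
  intro p h1 h2
  obtain ⟨q, _, rfl⟩ := Finset.mem_map.1 h1
  obtain ⟨q', _, e⟩ := Finset.mem_map.1 h2
  have := ty_eL (β := β) q
  rw [← e, ty_eR] at this
  omega

/-- union of two matchings -/
def glue (m1 : Finset (Sym2 α)) (m2 : Finset (Sym2 β)) : Finset (Sym2 (α ⊕ β)) :=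
  (m1.map (eL α β)).disjUnion (m2.map (eR α β)) (disj_LR m1 m2)

/-- left part -/
def lp (m : Finset (Sym2 (α ⊕ β))) : Finset (Sym2 α) := univ.filter fun p => eL α β p ∈ m
/-- right part -/
def rp (m : Finset (Sym2 (α ⊕ β))) : Finset (Sym2 β) := univ.filter fun p => eR α β p ∈ m

lemma lp_map (m : Finset (Sym2 (α ⊕ β))) :
    (lp m).map (eL α β) = m.filter fun p => ty Sum.isLeft p = 2 := by
  ext p
  simp only [lp, Finset.mem_map, Finset.mem_filter, Finset.mem_univ, true_and]
  constructor
  · rintro ⟨q, hq, rfl⟩; exact ⟨hq, ty_eL q⟩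
  · rintro ⟨hp, h⟩
    obtain ⟨q, rfl⟩ := ty_two h
    exact ⟨q, hp, rfl⟩

lemma rp_map (m : Finset (Sym2 (α ⊕ β))) :
    (rp m).map (eR α β) = m.filter fun p => ty Sum.isLeft p = 0 := by
  ext p
  simp only [rp, Finset.mem_map, Finset.mem_filter, Finset.mem_univ, true_and]
  constructor
  · rintro ⟨q, hq, rfl⟩; exact ⟨hq, ty_eR q⟩
  · rintro ⟨hp, h⟩
    obtain ⟨q, rfl⟩ := ty_zero h
    exact ⟨q, hp, rfl⟩

lemma mem_glue {m1 : Finset (Sym2 α)} {m2 : Finset (Sym2 β)} {p : Sym2 (α ⊕ β)} :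
    p ∈ glue m1 m2 ↔ (∃ q ∈ m1, eL α β q = p) ∨ (∃ q ∈ m2, eR α β q = p) := by
  simp only [glue, Finset.mem_disjUnion, Finset.mem_map]

lemma lp_glue (m1 : Finset (Sym2 α)) (m2 : Finset (Sym2 β)) : lp (glue m1 m2) = m1 := by
  ext p
  simp only [lp, Finset.mem_filter, Finset.mem_univ, true_and, mem_glue]
  constructor
  · rintro (⟨q, hq, e⟩ | ⟨q, hq, e⟩)
    · rwa [← (eL α β).injective e]
    · have := ty_eL (β := β) p
      rw [← e, ty_eR] at this
      omega
  · intro h; exact Or.inl ⟨p, h, rfl⟩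

lemma rp_glue (m1 : Finset (Sym2 α)) (m2 : Finset (Sym2 β)) : rp (glue m1 m2) = m2 := by
  ext p
  simp only [rp, Finset.mem_filter, Finset.mem_univ, true_and, mem_glue]
  constructor
  · rintro (⟨q, hq, e⟩ | ⟨q, hq, e⟩)
    · have := ty_eR (α := α) p
      rw [← e, ty_eL] at this
      omega
    · rwa [← (eR α β).injective e]
  · intro h; exact Or.inr ⟨p, h, rfl⟩

lemma glue_parts (m : Finset (Sym2 (α ⊕ β))) (h : cnt Sum.isLeft m 1 = 0) :
    glue (lp m) (rp m) = m := by
  ext p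
  rw [glue, Finset.mem_disjUnion, lp_map, rp_map, Finset.mem_filter, Finset.mem_filter]
  constructor
  · rintro (h | h) <;> exact h.1
  · intro hp
    unfold cnt at h
    rw [Finset.card_eq_zero, Finset.filter_eq_empty_iff] at h
    have h1 := h hp
    have h2 := ty_le Sum.isLeft p
    have : ty Sum.isLeft p = 2 ∨ ty Sum.isLeft p = 0 := by omega
    rcases this with h | h
    · exact Or.inl ⟨hp, h⟩
    · exact Or.inr ⟨hp, h⟩

lemma pm_glue {m1 : Finset (Sym2 α)} {m2 : Finset (Sym2 β)} (h1 : IsPairMatching m1)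
    (h2 : IsPairMatching m2) : IsPairMatching (glue m1 m2) := by
  have g1 := (pm_map (Function.Embedding.inl (β := β)) m1).2 h1
  have g2 := (pm_map (Function.Embedding.inr (α := α)) m2).2 h2
  have hcross : ∀ p ∈ m1.map (eL α β), ∀ q ∈ m2.map (eR α β), ∀ h, h ∈ p → h ∉ q := by
    intro p hp q hq h hhp hhq
    obtain ⟨p, _, rfl⟩ := Finset.mem_map.1 hp
    obtain ⟨q, _, rfl⟩ := Finset.mem_map.1 hq
    obtain ⟨x, _, rfl⟩ := Sym2.mem_map.1 hhp
    obtain ⟨y, _, hxy⟩ := Sym2.mem_map.1 hhq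
    simp at hxy
  refine ⟨?_, ?_⟩
  · intro p hp
    rcases Finset.mem_disjUnion.1 hp with hp | hp
    · exact g1.1 p hp
    · exact g2.1 p hp
  · intro p hp q hq hpq h hhp hhq
    rcases Finset.mem_disjUnion.1 hp with hp | hp <;> rcases Finset.mem_disjUnion.1 hq with hq | hq
    · exact g1.2 p hp q hq hpq h hhp hhq
    · exact hcross p hp q hq h hhp hhq
    · exact hcross q hq p hp h hhq hhp
    · exact g2.2 p hp q hq hpq h hhp hhq

lemma card_lp (m : Finset (Sym2 (α ⊕ β))) : (lp m).card = cnt Sum.isLeft m 2 := by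
  rw [← Finset.card_map (eL α β), lp_map]; rfl
lemma card_rp (m : Finset (Sym2 (α ⊕ β))) : (rp m).card = cnt Sum.isLeft m 0 := by
  rw [← Finset.card_map (eR α β), rp_map]; rfl

lemma NS_left : NS (Sum.isLeft : α ⊕ β → Bool) true = Fintype.card α := by
  unfold NS
  rw [← Finset.card_univ, ← Finset.card_map (Function.Embedding.inl (α := α) (β := β))]
  congr 1
  ext x; rcases x with x | x <;> simp
lemma NS_right : NS (Sum.isLeft : α ⊕ β → Bool) false = Fintype.card β := by
  unfold NS
  rw [← Finset.card_univ, ← Finset.card_map (Function.Embedding.inr (α := α) (β := β))]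
  congr 1
  ext x; rcases x with x | x <;> simp

lemma gr_glue (v : α → V) (w : β → W) (m1 : Finset (Sym2 α)) (m2 : Finset (Sym2 β)) :
    gr (Sum.map v w) (glue m1 m2) = (gr v m1).disjUnion (gr w m2) := by
  unfold gr Multigraph.disjUnion
  congr 1
  simp only [glue, Finset.disjUnion, Multiset.map_add, Finset.map_val, Multiset.map_map]
  congr 1
  · refine Multiset.map_congr rfl fun p _ => ?_
    simp only [emb, Function.comp, Function.Embedding.coeFn_mk, Sym2.map_map]
    rfl
  · refine Multiset.map_congr rfl fun p _ => ?_
    simp only [emb, Function.comp, Function.Embedding.coeFn_mk, Sym2.map_map]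
    rfl

lemma sum_split (g : Finset (Sym2 (α ⊕ β)) → ℝ) :
    ∑ m ∈ MM Sum.isLeft (tri (Fintype.card α / 2) (Fintype.card β / 2) 0), g m
      = ∑ q ∈ maxM α ×ˢ maxM β, g (glue q.1 q.2) := by
  symm
  refine Finset.sum_bij' (fun q _ => glue q.1 q.2) (fun m _ => (lp m, rp m)) ?_ ?_ ?_ ?_ ?_
  · rintro ⟨m1, m2⟩ h
    rw [Finset.mem_product, mem_maxM, mem_maxM] at h
    obtain ⟨⟨h1, c1⟩, h2, c2⟩ := h
    rw [mem_MM]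
    refine ⟨pm_glue h1 h2, ?_⟩
    intro t
    have u1 := card_unm_add h1
    have u2 := card_unm_add h2
    have e1 := card_lp (glue m1 m2)
    have e2 := card_rp (glue m1 m2)
    have e3 := card_eq_cnt Sum.isLeft (glue m1 m2)
    rw [lp_glue] at e1
    rw [rp_glue] at e2
    have e4 : (glue m1 m2).card = m1.card + m2.card := by
      rw [glue, Finset.card_disjUnion, Finset.card_map, Finset.card_map]
    simp only at u1 u2 c1 c2
    rw [cnt_eq_tri]
    congr 1 <;> simp only at * <;> omega
  · intro m hm
    rw [mem_MM] at hm
    obtain ⟨hm, hT⟩ := hm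
    rw [Finset.mem_product, mem_maxM, mem_maxM]
    have t1 := hT 2
    have t2 := hT 0
    simp [tri] at t1 t2
    refine ⟨⟨?_, ?_⟩, ?_, ?_⟩
    · refine (pm_map (Function.Embedding.inl (β := β)) _).1 (pm_subset hm ?_)
      change (lp m).map (eL α β) ⊆ m
      rw [lp_map]; exact Finset.filter_subset _ _
    · simp only [card_lp, t1]; omega
    · refine (pm_map (Function.Embedding.inr (α := α)) _).1 (pm_subset hm ?_)
      change (rp m).map (eR α β) ⊆ m
      rw [rp_map]; exact Finset.filter_subset _ _
    · simp only [card_rp, t2]; omega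
  · rintro ⟨m1, m2⟩ h
    simp [lp_glue, rp_glue]
  · intro m hm
    rw [mem_MM] at hm
    have := hm.2 1
    simp [tri] at this
    exact glue_parts m this
  · intro q _; rfl

lemma fav_split (f : Multigraph → ℝ) (hadd : GraphParam.Additive f) (v : α → V) (w : β → W) :
    Fav Sum.isLeft (fun m => f (gr (Sum.map v w) m))
      (tri (Fintype.card α / 2) (Fintype.card β / 2) 0) = avgMax v f + avgMax w f := by
  have k1 := sum_split (α := α) (β := β) (fun m => f (gr (Sum.map v w) m))
  have k2 := sum_split (α := α) (β := β) (fun _ => 1)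
  simp only [Finset.sum_const, nsmul_eq_mul, mul_one, Finset.card_product] at k2
  unfold Fav avgMax
  rw [k1, k2]
  have h1 : ((maxM α).card : ℝ) ≠ 0 := by exact_mod_cast maxM_nonempty.card_pos.ne'
  have h2 : ((maxM β).card : ℝ) ≠ 0 := by exact_mod_cast maxM_nonempty.card_pos.ne'
  have : ∀ q ∈ maxM α ×ˢ maxM β, f (gr (Sum.map v w) (glue q.1 q.2)) = f (gr v q.1) + f (gr w q.2) := by
    intro q _
    rw [gr_glue, hadd]
  rw [Finset.sum_congr rfl this, Finset.sum_product]
  simp only [Finset.sum_add_distrib, Finset.sum_const, nsmul_eq_mul, ← Finset.mul_sum]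
  push_cast
  field_simp

lemma avg_super (f : Multigraph → ℝ) (κ : ℝ) (hκ : 0 ≤ κ) (hadd : GraphParam.Additive f)
    (hlip : GraphParam.Lipschitz f κ) (hconc : GraphParam.Concave f) (v : α → V) (w : β → W) :
    avgMax v f + avgMax w f - κ * (20 * ((Fintype.card α : ℝ) ^ (2 / 3 : ℝ) + 1)) ≤
      avgMax (Sum.map v w) f := by
  have := avg_interp (Sum.isLeft : α ⊕ β → Bool) f (Sum.map v w) κ hκ hlip hconc
  rw [NS_left, NS_right, fav_split f hadd] at this
  exact this

lemma config_eq (V : Type) [Fintype V] [iD : DecidableEq V] (d : V → ℕ) (f : Multigraph → ℝ) :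
    configExpect V d f = avgMax (Sigma.fst : HalfEdge V d → V) f := by
  have : maximalMatchings V d = maxM (HalfEdge V d) := by
    ext m
    simp [maximalMatchings, maxM]
  unfold configExpect avgMax
  rw [this]
  rfl

/-- splitting half-edges -/
def heEquiv (m n : ℕ) (d1 : Fin m → ℕ) (d2 : Fin n → ℕ) :
    HalfEdge (Fin m) d1 ⊕ HalfEdge (Fin n) d2 ≃ HalfEdge (Fin (m + n)) (Fin.append d1 d2) :=
  (Equiv.sumSigmaDistrib (fun s : Fin m ⊕ Fin n => Fin (Sum.elim d1 d2 s))).symm.trans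
    ((Equiv.sigmaCongrRight (fun s => finCongr (by
      rcases s with s | s <;> simp))).trans
    (Equiv.sigmaCongrLeft (β := fun a => Fin (Fin.append d1 d2 a)) finSumFinEquiv))

lemma config_super (f : Multigraph → ℝ) (κ : ℝ) (hκ : 0 ≤ κ) (hinv : GraphParam.Invariant f)
    (hadd : GraphParam.Additive f)
    (hlip : GraphParam.Lipschitz f κ) (hconc : GraphParam.Concave f) (m n : ℕ)
    (d1 : Fin m → ℕ) (d2 : Fin n → ℕ) :
    configExpect (Fin m) d1 f + configExpect (Fin n) d2 f
      - κ * (20 * (((∑ i, d1 i : ℕ) : ℝ) ^ (2 / 3 : ℝ) + 1)) ≤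
      configExpect (Fin (m + n)) (Fin.append d1 d2) f := by
  rw [config_eq, config_eq, config_eq]
  rw [← avg_transport f hinv (Sum.map Sigma.fst Sigma.fst) Sigma.fst (heEquiv m n d1 d2)
    finSumFinEquiv]
  · have := avg_super f κ hκ hadd hlip hconc (Sigma.fst : HalfEdge (Fin m) d1 → Fin m)
      (Sigma.fst : HalfEdge (Fin n) d2 → Fin n)
    have hc : Fintype.card (HalfEdge (Fin m) d1) = ∑ i, d1 i := by simp
    rw [hc] at this
    exact this
  · rintro (⟨i, x⟩ | ⟨i, x⟩) <;> rfl

lemma gr_bound (f : Multigraph → ℝ) (κ : ℝ)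
    (hlip : GraphParam.Lipschitz f κ) (v : α → V) (m : Finset (Sym2 α)) :
    |f (gr v m) - f (gr v (∅ : Finset (Sym2 α)))| ≤ κ * m.card := by
  induction m using Finset.induction_on with
  | empty => simp
  | insert p m hp ih =>
    have : ∃ i j, gr v (insert p m) = (gr v m).addEdge i j := by
      induction p using Sym2.ind with
      | _ x y =>
      refine ⟨v x, v y, ?_⟩
      unfold gr Multigraph.addEdge
      congr 1
      simp only
      rw [Finset.insert_val_of_notMem hp]
      simp
    obtain ⟨i, j, e⟩ := this
    have h1 := hlip (gr v m) i j
    rw [e, Finset.card_insert_of_notMem hp]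
    have := abs_sub_le (f ((gr v m).addEdge i j)) (f (gr v m)) (f (gr v (∅ : Finset (Sym2 α))))
    push_cast
    linarith

/-- empty graph on n vertices -/
def Emp (n : ℕ) : Multigraph := { V := Fin n, edges := 0 }

lemma emp_add (f : Multigraph → ℝ) (hinv : GraphParam.Invariant f)
    (hadd : GraphParam.Additive f) (m n : ℕ) : f (Emp (m + n)) = f (Emp m) + f (Emp n) := by
  rw [← hadd]
  symm
  apply hinv _ _ finSumFinEquiv
  rfl

lemma emp_eq (f : Multigraph → ℝ) (hinv : GraphParam.Invariant f)
    (hadd : GraphParam.Additive f) (n : ℕ) : f (Emp n) = n * f (Emp 1) := by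
  induction n with
  | zero =>
    have := emp_add f hinv hadd 0 0
    simp at this ⊢; exact this
  | succ n ih =>
    rw [emp_add f hinv hadd, ih]; push_cast; ring

lemma config_bound (f : Multigraph → ℝ) (κ : ℝ) (hκ : 0 ≤ κ) (hinv : GraphParam.Invariant f)
    (hadd : GraphParam.Additive f) (hlip : GraphParam.Lipschitz f κ) (n : ℕ) (d : Fin n → ℕ) :
    |configExpect (Fin n) d f| ≤ n * |f (Emp 1)| + κ * ∑ i, (d i : ℝ) := by
  rw [config_eq]
  unfold avgMax
  have hM : (0 : ℝ) < (maxM (HalfEdge (Fin n) d)).card := by exact_mod_cast maxM_nonempty.card_pos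
  rw [abs_div, abs_of_pos hM, div_le_iff₀ hM]
  refine (Finset.abs_sum_le_sum_abs _ _).trans ?_
  rw [mul_comm, ← nsmul_eq_mul, ← Finset.sum_const]
  refine Finset.sum_le_sum fun m hm => ?_
  have h1 := gr_bound f κ hlip (Sigma.fst : HalfEdge (Fin n) d → Fin n) m
  have h2 : f (gr (Sigma.fst : HalfEdge (Fin n) d → Fin n) ∅) = n * f (Emp 1) := by
    rw [← emp_eq f hinv hadd]; rfl
  rw [mem_maxM] at hm
  have h3 := card_unm_add hm.1
  have hc : Fintype.card (HalfEdge (Fin n) d) = ∑ i, d i := by simp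
  have h4 : (m.card : ℝ) ≤ ∑ i, (d i : ℝ) := by
    rw [hc] at h3
    have : m.card ≤ ∑ i, d i := by omega
    exact_mod_cast this
  have h5 := mul_le_mul_of_nonneg_left h4 hκ
  rw [h2] at h1
  have h6 := abs_sub_abs_le_abs_sub (f (gr (Sigma.fst : HalfEdge (Fin n) d → Fin n) m)) (n * f (Emp 1))
  rw [abs_mul (n : ℝ), Nat.abs_cast] at h6
  linarith

end
end Interp

namespace Interp
noncomputable section

lemma hasSum_prod_nonneg {α β : Type} {f : α → ℝ} {g : β → ℝ} {a b : ℝ} (hf : HasSum f a)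
    (hg : HasSum g b) (hf0 : ∀ x, 0 ≤ f x) (hg0 : ∀ x, 0 ≤ g x) :
    HasSum (fun p : α × β => f p.1 * g p.2) (a * b) :=
  hf.mul hg (hf.summable.mul_of_nonneg hg.summable hf0 hg0)

def PW (μ : ℕ → ℝ) (n : ℕ) (D : Fin n → ℕ) : ℝ := ∏ i, μ (D i)

def DS (n : ℕ) (D : Fin n → ℕ) : ℝ := ∑ i, (D i : ℝ)

lemma PW_nonneg {μ : ℕ → ℝ} (h : ∀ k, 0 ≤ μ k) (n : ℕ) (D : Fin n → ℕ) : 0 ≤ PW μ n D :=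
  Finset.prod_nonneg fun _ _ => h _

lemma DS_nonneg (n : ℕ) (D : Fin n → ℕ) : 0 ≤ DS n D :=
  Finset.sum_nonneg fun _ _ => Nat.cast_nonneg _

lemma hasSum_PW {μ : ℕ → ℝ} (h0 : ∀ k, 0 ≤ μ k) (h1 : HasSum μ 1) (n : ℕ) :
    HasSum (PW μ n) 1 := by
  induction n with
  | zero =>
    have := hasSum_unique (PW μ 0)
    convert this using 1
    simp [PW]
  | succ n ih =>
    rw [← (Fin.consEquiv (fun _ : Fin (n+1) => ℕ)).hasSum_iff]
    have := hasSum_prod_nonneg h1 ih h0 (PW_nonneg h0 n)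
    rw [one_mul] at this
    convert this using 1
    ext p
    simp [PW, Fin.consEquiv, Fin.prod_univ_succ]

lemma hasSum_PWDS {μ : ℕ → ℝ} (h0 : ∀ k, 0 ≤ μ k) (h1 : HasSum μ 1) {M : ℝ}
    (hM : HasSum (fun k : ℕ => (k : ℝ) * μ k) M) (n : ℕ) :
    HasSum (fun D => PW μ n D * DS n D) (n * M) := by
  induction n with
  | zero =>
    have := hasSum_unique (fun D => PW μ 0 D * DS 0 D)
    convert this using 1
    simp [DS]
  | succ n ih =>
    rw [← (Fin.consEquiv (fun _ : Fin (n+1) => ℕ)).hasSum_iff]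
    have a1 := hasSum_prod_nonneg hM (hasSum_PW h0 h1 n)
      (fun k => mul_nonneg (Nat.cast_nonneg _) (h0 k)) (PW_nonneg h0 n)
    have a2 := hasSum_prod_nonneg h1 ih h0
      (fun D => mul_nonneg (PW_nonneg h0 n D) (DS_nonneg n D))
    convert a1.add a2 using 1
    · ext p
      simp [PW, DS, Fin.consEquiv, Fin.prod_univ_succ, Fin.sum_univ_succ]
      ring
    · push_cast; ring

lemma PW_append (μ : ℕ → ℝ) (m n : ℕ) (D : Fin m → ℕ) (D' : Fin n → ℕ) :
    PW μ (m + n) (Fin.append D D') = PW μ m D * PW μ n D' := by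
  simp [PW, Fin.prod_univ_add]

section main

lemma kappa_nonneg (f : Multigraph → ℝ) (κ : ℝ) (hlip : GraphParam.Lipschitz f κ)
    : 0 ≤ κ := (abs_nonneg _).trans (hlip (Emp 1) (0 : Fin 1) (0 : Fin 1))

lemma iid_hasSum_bound (f : Multigraph → ℝ) (κ : ℝ) (hinv : GraphParam.Invariant f) (hadd : GraphParam.Additive f) (hlip : GraphParam.Lipschitz f κ) (μ : ℕ → ℝ) (hμ0 : ∀ k, 0 ≤ μ k) (hμ1 : HasSum μ 1) (M : ℝ) (hM : HasSum (fun k : ℕ => (k : ℝ) * μ k) M)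
    (n : ℕ) :
    HasSum (fun D => PW μ n D * configExpect (Fin n) D f) (iidExpect μ n f) ∧
    |iidExpect μ n f| ≤ n * (|f (Emp 1)| + κ * M) := by
  have hκ := kappa_nonneg f κ hlip
  have hb : HasSum (fun D => PW μ n D * (n * |f (Emp 1)| + κ * DS n D))
      (n * (|f (Emp 1)| + κ * M)) := by
    have h := ((hasSum_PW hμ0 hμ1 n).mul_right (n * |f (Emp 1)|)).add
      ((hasSum_PWDS hμ0 hμ1 hM n).mul_left κ)
    have e1 : (fun D => PW μ n D * (n * |f (Emp 1)| + κ * DS n D)) =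
      fun D => PW μ n D * (n * |f (Emp 1)|) + κ * (PW μ n D * DS n D) := by
      funext D; ring
    rw [e1, show n * (|f (Emp 1)| + κ * M) = 1 * (n * |f (Emp 1)|) + κ * (n * M) by ring]
    exact h
  have hle : ∀ D, ‖PW μ n D * configExpect (Fin n) D f‖ ≤
      PW μ n D * (n * |f (Emp 1)| + κ * DS n D) := by
    intro D
    rw [norm_mul, Real.norm_eq_abs, Real.norm_eq_abs, abs_of_nonneg (PW_nonneg hμ0 n D)]
    exact mul_le_mul_of_nonneg_left (config_bound f κ hκ hinv hadd hlip n D) (PW_nonneg hμ0 n D)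
  have hs : Summable (fun D => PW μ n D * configExpect (Fin n) D f) :=
    Summable.of_norm_bounded hb.summable hle
  refine ⟨hs.hasSum, ?_⟩
  exact tsum_of_norm_bounded hb hle

lemma rpow_lin (x m : ℝ) (hx : 0 ≤ x) (hm : 0 < m) :
    x ^ (2/3 : ℝ) ≤ m ^ (2/3 : ℝ) * (x / m + 1) := by
  have h1 : x ^ (2/3 : ℝ) = m ^ (2/3 : ℝ) * (x / m) ^ (2/3 : ℝ) := by
    rw [← Real.mul_rpow hm.le (by positivity)]
    congr 1; field_simp
  rw [h1]
  refine mul_le_mul_of_nonneg_left ?_ (by positivity)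
  have hy : 0 ≤ x / m := by positivity
  rcases le_total (x / m) 1 with h | h
  · have := Real.rpow_le_one hy h (by norm_num : (0:ℝ) ≤ 2/3)
    linarith
  · have := Real.rpow_le_rpow_of_exponent_le h (by norm_num : (2/3:ℝ) ≤ 1)
    rw [Real.rpow_one] at this
    linarith

set_option maxHeartbeats 1600000 in
lemma iid_super (f : Multigraph → ℝ) (κ : ℝ) (hinv : GraphParam.Invariant f) (hadd : GraphParam.Additive f) (hlip : GraphParam.Lipschitz f κ) (hconc : GraphParam.Concave f) (μ : ℕ → ℝ) (hμ0 : ∀ k, 0 ≤ μ k) (hμ1 : HasSum μ 1) (M : ℝ) (hM : HasSum (fun k : ℕ => (k : ℝ) * μ k) M)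
    (m n : ℕ) (hm : 1 ≤ m) :
    iidExpect μ m f + iidExpect μ n f - 20 * κ * (M + 2) * (m : ℝ) ^ (2/3 : ℝ)
      ≤ iidExpect μ (m + n) f := by
  have hκ := kappa_nonneg f κ hlip
  have s1 := (iid_hasSum_bound f κ hinv hadd hlip μ hμ0 hμ1 M hM m).1
  have s2 := (iid_hasSum_bound f κ hinv hadd hlip μ hμ0 hμ1 M hM n).1
  have s3 := (iid_hasSum_bound f κ hinv hadd hlip μ hμ0 hμ1 M hM (m + n)).1
  rw [← (Fin.appendEquiv m n).hasSum_iff] at s3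
  have p1 := hasSum_PW hμ0 hμ1 m
  have p2 := hasSum_PW hμ0 hμ1 n
  have q1 := hasSum_PWDS hμ0 hμ1 hM m
  have hm' : (1 : ℝ) ≤ m := by exact_mod_cast hm
  have hm0 : (0 : ℝ) < m := by linarith
  have hR : (1 : ℝ) ≤ (m : ℝ) ^ (2/3 : ℝ) := Real.one_le_rpow hm' (by norm_num)
  set R := (m : ℝ) ^ (2/3 : ℝ) with hRdef
  -- the error as a function of the first degree sequence
  have e1 : HasSum (fun D => PW μ m D * (κ * (20 * (R * (DS m D / m + 1) + R))))
      (20 * κ * (M + 2) * R) := by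
    have h := (q1.mul_right (20 * κ * R / m)).add (p1.mul_right (40 * κ * R))
    have e1 : (fun D => PW μ m D * (κ * (20 * (R * (DS m D / m + 1) + R)))) =
      fun D => PW μ m D * DS m D * (20 * κ * R / m) + PW μ m D * (40 * κ * R) := by
      funext D; ring
    have e2 : 20 * κ * (M + 2) * R = m * M * (20 * κ * R / m) + 1 * (40 * κ * R) := by
      field_simp; ring
    rw [e1, e2]
    exact h
  have hsm : Summable fun p : (Fin m → ℕ) × (Fin n → ℕ) =>
      (PW μ m p.1 * configExpect (Fin m) p.1 f) * PW μ n p.2 :=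
    summable_mul_of_summable_norm s1.summable.norm p2.summable.norm
  have hsm2 : Summable fun p : (Fin m → ℕ) × (Fin n → ℕ) =>
      PW μ m p.1 * (PW μ n p.2 * configExpect (Fin n) p.2 f) :=
    summable_mul_of_summable_norm p1.summable.norm s2.summable.norm
  have t1 := s1.mul p2 hsm
  have t2 := p1.mul s2 hsm2
  have t3 := hasSum_prod_nonneg e1 p2 (fun D => by
    have := PW_nonneg hμ0 m D
    have := DS_nonneg m D
    positivity) (PW_nonneg hμ0 n)
  rw [mul_one] at t1 t3
  rw [one_mul] at t2
  refine hasSum_le ?_ ((t1.add t2).sub t3) s3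
  rintro ⟨D, D'⟩
  have key := config_super f κ hκ hinv hadd hlip hconc m n D D'
  have hDS : ((∑ i, D i : ℕ) : ℝ) = DS m D := by simp [DS]
  rw [hDS] at key
  have hr := rpow_lin (DS m D) m (DS_nonneg m D) hm0
  have hle : κ * (20 * (DS m D ^ (2/3 : ℝ) + 1)) ≤ κ * (20 * (R * (DS m D / m + 1) + R)) :=
    mul_le_mul_of_nonneg_left (by linarith) hκ
  have hw : 0 ≤ PW μ m D * PW μ n D' := mul_nonneg (PW_nonneg hμ0 _ _) (PW_nonneg hμ0 _ _)
  have := mul_le_mul_of_nonneg_left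
    ((sub_le_sub_left hle _).trans key) hw
  have happ : (Fin.appendEquiv m n) (D, D') = Fin.append D D' := rfl
  simp only [Function.comp, happ, PW_append]
  refine le_trans (le_of_eq ?_) this
  ring

lemma rpow_gap (m n : ℕ) (hm : 1 ≤ m) (hmn : m ≤ n) :
    ((m + n : ℕ) : ℝ) ^ (2/3 : ℝ) + (1/3) * (m : ℝ) ^ (2/3 : ℝ)
      ≤ (m : ℝ) ^ (2/3 : ℝ) + (n : ℝ) ^ (2/3 : ℝ) := by
  have hm0 : (0 : ℝ) < m := by exact_mod_cast hm
  have hmn' : (m : ℝ) ≤ n := by exact_mod_cast hmn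
  have hn0 : (0 : ℝ) < n := by linarith
  have h1 : ((m + n : ℕ) : ℝ) ^ (2/3 : ℝ) = (n : ℝ) ^ (2/3 : ℝ) * (1 + m / n) ^ (2/3 : ℝ) := by
    rw [← Real.mul_rpow hn0.le (by positivity)]
    congr 1; push_cast; field_simp; ring
  have hq : -1 ≤ (m : ℝ) / n := by
    have : 0 ≤ (m : ℝ) / n := by positivity
    linarith
  have h2 : (1 + (m : ℝ) / n) ^ (2/3 : ℝ) ≤ 1 + 2/3 * (m / n) :=
    rpow_one_add_le_one_add_mul_self hq (by norm_num) (by norm_num)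
  have h3 : (n : ℝ) ^ (2/3 : ℝ) * (m / n) ≤ (m : ℝ) ^ (2/3 : ℝ) := by
    have e : (m : ℝ) ^ (2/3 : ℝ) = (n : ℝ) ^ (2/3 : ℝ) * (m / n) ^ (2/3 : ℝ) := by
      rw [← Real.mul_rpow hn0.le (by positivity)]
      congr 1; field_simp
    rw [e]
    refine mul_le_mul_of_nonneg_left ?_ (by positivity)
    have := Real.rpow_le_rpow_of_exponent_ge (x := (m : ℝ) / n) (y := 1) (z := 2/3)
      (by positivity) ((div_le_one hn0).2 hmn') (by norm_num)
    rwa [Real.rpow_one] at this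
  have h4 := mul_le_mul_of_nonneg_left h2 (by positivity : 0 ≤ (n : ℝ) ^ (2/3 : ℝ))
  rw [← h1] at h4
  nlinarith

lemma main_limit (f : Multigraph → ℝ) (κ : ℝ) (hinv : GraphParam.Invariant f) (hadd : GraphParam.Additive f) (hlip : GraphParam.Lipschitz f κ) (hconc : GraphParam.Concave f) (μ : ℕ → ℝ) (hμ0 : ∀ k, 0 ≤ μ k) (hμ1 : HasSum μ 1) (M : ℝ) (hM : HasSum (fun k : ℕ => (k : ℝ) * μ k) M)
    : ∃ Ψ : ℝ, Tendsto (fun n => iidExpect μ n f / (n : ℝ)) atTop (nhds Ψ) := by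
  have hκ := kappa_nonneg f κ hlip
  have hM0 : 0 ≤ M := hM.nonneg fun k => mul_nonneg (Nat.cast_nonneg _) (hμ0 k)
  have hbd := fun n => (iid_hasSum_bound f κ hinv hadd hlip μ hμ0 hμ1 M hM n).2
  have hsup := iid_super f κ hinv hadd hlip hconc μ hμ0 hμ1 M hM
  set a : ℕ → ℝ := fun n => iidExpect μ n f with ha
  change ∀ n : ℕ, |a n| ≤ _ at hbd
  change ∀ m n : ℕ, 1 ≤ m → a m + a n - _ ≤ a (m + n) at hsup
  set B := |f (Emp 1)| + κ * M
  set C := 20 * κ * (M + 2) with hC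
  have hC0 : 0 ≤ C := by positivity
  have ha0 : a 0 = 0 := by
    have := hbd 0
    simpa using this
  let u : ℕ → ℝ := fun n => - a n + 3 * C * (n : ℝ) ^ (2/3 : ℝ)
  have hu0 : u 0 = 0 := by
    simp only [u, ha0]
    rw [Nat.cast_zero, Real.zero_rpow (by norm_num)]; simp
  have hu1 : ∀ m n : ℕ, m ≤ n → u (m + n) ≤ u m + u n := by
    intro m n hmn
    rcases Nat.eq_zero_or_pos m with rfl | hm
    · rw [hu0]; simp
    · have h1 := hsup m n hm
      have h2 := mul_le_mul_of_nonneg_left (rpow_gap m n hm hmn) (by positivity : 0 ≤ 3 * C)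
      simp only [u]
      linarith
  have hu : Subadditive u := by
    intro m n
    rcases le_total m n with h | h
    · exact hu1 m n h
    · rw [add_comm m n, add_comm (u m)]; exact hu1 n m h
  have hbdd : BddBelow (Set.range fun n => u n / n) := by
    refine ⟨-B, ?_⟩
    rintro _ ⟨n, rfl⟩
    have hB : 0 ≤ B := by positivity
    rcases Nat.eq_zero_or_pos n with rfl | hn
    · simpa using hB
    · have hn0 : (0 : ℝ) < n := by exact_mod_cast hn
      show -B ≤ u n / n
      rw [le_div_iff₀ hn0]
      have := (abs_le.1 (hbd n)).2
      have h3 : 0 ≤ 3 * C * (n : ℝ) ^ (2/3 : ℝ) := by positivity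
      simp only [u]
      linarith
  have hlim := hu.tendsto_lim hbdd
  have hz : Tendsto (fun n : ℕ => (n : ℝ) ^ (-(1/3) : ℝ)) atTop (𝓝 0) :=
    (tendsto_rpow_neg_atTop (by norm_num : (0 : ℝ) < 1/3)).comp tendsto_natCast_atTop_atTop
  refine ⟨3 * C * 0 - hu.lim, ((hz.const_mul (3 * C)).sub hlim).congr' ?_⟩
  filter_upwards [eventually_ge_atTop 1] with n hn
  have hn0 : (0 : ℝ) < n := by exact_mod_cast hn
  have : (n : ℝ) ^ (2/3 : ℝ) = (n : ℝ) ^ (-(1/3) : ℝ) * n := by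
    nth_rewrite 3 [← Real.rpow_one (n : ℝ)]
    rw [← Real.rpow_add hn0]; norm_num
  simp only [u, this]
  field_simp
  ring

end main
end
end Interp

theorem statement10 (f : Multigraph → ℝ) (κ : ℝ)
    (hinv : GraphParam.Invariant f) (hadd : GraphParam.Additive f)
    (hlip : GraphParam.Lipschitz f κ) (hconc : GraphParam.Concave f)
    (μ : ℕ → ℝ) (hμ0 : ∀ k, 0 ≤ μ k) (hμ1 : HasSum μ 1)
    (hμmean : Summable fun k : ℕ => (k : ℝ) * μ k) :
    ∃ Ψ : ℝ, Tendsto (fun n => iidExpect μ n f / (n : ℝ)) atTop (nhds Ψ) := by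
  obtain ⟨M, hM⟩ := hμmean
  exact Interp.main_limit f κ hinv hadd hlip hconc μ hμ0 hμ1 M hM
end
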